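/- Let n ≥ 2, 0 ≤ q < n, 0 < λ ≤ Λ and 0 < r < R. Let v be a generalized solution of λ v^q χ_{{v>0}} ≤ det D²v ≤ Λ v^q χ_{{v>0}} in Ω satisfying Assumption (H). Then there exist α ∈ (0,1) and constants 0 < c < C, all depending only on n, q, λ, Λ, r, R, such that: (1) B'_c(0) ⊆ K_1' ⊆ B'_C(0); (2) B_c(0) ⊆ {v ≤ 1} ∩ {x_n ≤ 3/4} ⊆ B_C(0); (3) v is differentiable at every point of B_c(0), with sup_{B_c(0)} (|v| + |∇v|) ≤ C and |∇v(x) − ∇v(y)| ≤ C|x−y|^α for all x, y ∈ B_c(0); (4) c|x'|^{(1+α)/α} ≤ ψ(x') ≤ C|x'|^{1+α} for all x' ∈ B'_c(0); (5) v is strictly convex at every point of B_c(0) \ K, i.e. for each x ∈ B_c(0) \ K there is p ∈ ∂v(x) such that v(y) > v(x) + p·(y−x) for every y ∈ Ω with y ≠ x; (6) c·dist(x,K)^{(1+α)/α} ≤ v(x) ≤ C·dist(x,K)^{1+α} for all x ∈ B_c(0). -/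

import Mathlib

open MeasureTheory Set Metric
open scoped RealInnerProductSpace

noncomputable section

/-- The subdifferential of a convex function `v` at `x`, relative to the domain `Ω`. -/
def subgrad {n : ℕ} (Ω : Set (EuclideanSpace ℝ (Fin n))) (v : EuclideanSpace ℝ (Fin n) → ℝ)
    (x : EuclideanSpace ℝ (Fin n)) : Set (EuclideanSpace ℝ (Fin n)) :=
  {p | ∀ y ∈ Ω, v x + ⟪p, y - x⟫ ≤ v y}

/-- The image `∂v(E) = ⋃_{x ∈ E} ∂v(x)` of a set under the subdifferential. -/
def subgradImg {n : ℕ} (Ω : Set (EuclideanSpace ℝ (Fin n))) (v : EuclideanSpace ℝ (Fin n) → ℝ)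
    (E : Set (EuclideanSpace ℝ (Fin n))) : Set (EuclideanSpace ℝ (Fin n)) :=
  ⋃ x ∈ E, subgrad Ω v x

/-- The last coordinate `x_n` of a point of `ℝⁿ`. -/
def lastCoord {n : ℕ} (x : EuclideanSpace ℝ (Fin n)) : ℝ :=
  if h : 0 < n then x ⟨n - 1, by omega⟩ else 0

/-- The first `n-1` coordinates `x'` of a point of `ℝⁿ`. -/
def fstCoords {n : ℕ} (x : EuclideanSpace ℝ (Fin n)) : EuclideanSpace ℝ (Fin (n - 1)) :=
  (EuclideanSpace.equiv (Fin (n - 1)) ℝ).symm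
    (fun i => x ⟨i, lt_of_lt_of_le i.isLt (Nat.sub_le n 1)⟩)

/-- The point `(x', t) ∈ ℝⁿ = ℝ^{n-1} × ℝ`. -/
def app (n : ℕ) (x' : EuclideanSpace ℝ (Fin (n - 1))) (t : ℝ) : EuclideanSpace ℝ (Fin n) :=
  (EuclideanSpace.equiv (Fin n) ℝ).symm
    (fun i => if h : (i : ℕ) < n - 1 then x' ⟨i, h⟩ else t)

/-- `v` is a generalized (Aleksandrov) solution of
`λ v^q χ_{v>0} ≤ det D²v ≤ Λ v^q χ_{v>0}` on the open convex set `Ω`: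
`v` is continuous, convex and nonnegative on `Ω`, and for every Borel `E ⊆ Ω` one has
`|∂v(E)| ≤ Λ ∫_{E ∩ {v>0}} v^q` and `|∂v(E ∩ {v>0})| ≥ λ ∫_{E ∩ {v>0}} v^q`. -/
def GenSol (n : ℕ) (q lam Lam : ℝ) (Ω : Set (EuclideanSpace ℝ (Fin n)))
    (v : EuclideanSpace ℝ (Fin n) → ℝ) : Prop :=
  ContinuousOn v Ω ∧ ConvexOn ℝ Ω v ∧ (∀ x ∈ Ω, 0 ≤ v x) ∧
  (∀ E : Set (EuclideanSpace ℝ (Fin n)), MeasurableSet E → E ⊆ Ω →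
    volume (subgradImg Ω v E) ≤
      ENNReal.ofReal Lam * ∫⁻ x in E ∩ {x | 0 < v x}, ENNReal.ofReal (v x ^ q)) ∧
  (∀ E : Set (EuclideanSpace ℝ (Fin n)), MeasurableSet E → E ⊆ Ω →
    ENNReal.ofReal lam * ∫⁻ x in E ∩ {x | 0 < v x}, ENNReal.ofReal (v x ^ q) ≤
      volume (subgradImg Ω v (E ∩ {x | 0 < v x})))

/-- The coincidence set `K = {x ∈ Ω : v x = 0}`. -/
def coin {n : ℕ} (Ω : Set (EuclideanSpace ℝ (Fin n))) (v : EuclideanSpace ℝ (Fin n) → ℝ) :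
    Set (EuclideanSpace ℝ (Fin n)) :=
  {x ∈ Ω | v x = 0}

/-- The slice `K₁' = {x' ∈ ℝ^{n-1} : (x',1) ∈ K}` of the coincidence set. -/
def sliceOne (n : ℕ) (Ω : Set (EuclideanSpace ℝ (Fin n))) (v : EuclideanSpace ℝ (Fin n) → ℝ) :
    Set (EuclideanSpace ℝ (Fin (n - 1))) :=
  {x' | app n x' 1 ∈ coin Ω v}

/-- Assumption (H): `0 ∈ Ω` is an exposed point of `K`; `K ⊆ {x_n ≥ 0}`;
`K ∩ {0 ≤ x_n ≤ 1}` is the region between the graph of a convex function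
`ψ : K₁' → [0,1]` and `{x_n = 1}`; `{v ≤ 1} ∩ {x_n ≤ 1}` is a compact subset of `Ω`;
and `K₁'` is normalized: `B'_r(x₀') ⊆ K₁' ⊆ B'_R(x₀')` with `x₀'` the centroid of `K₁'`. -/
def AssumptionH (n : ℕ) (r R : ℝ) (Ω : Set (EuclideanSpace ℝ (Fin n)))
    (v : EuclideanSpace ℝ (Fin n) → ℝ) (ψ : EuclideanSpace ℝ (Fin (n - 1)) → ℝ) : Prop :=
  (0 : EuclideanSpace ℝ (Fin n)) ∈ Ω ∧
  (0 : EuclideanSpace ℝ (Fin n)) ∈ Set.exposedPoints ℝ (coin Ω v) ∧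
  (∀ x ∈ coin Ω v, 0 ≤ lastCoord x) ∧
  ConvexOn ℝ (sliceOne n Ω v) ψ ∧
  (∀ x' ∈ sliceOne n Ω v, 0 ≤ ψ x' ∧ ψ x' ≤ 1) ∧
  (coin Ω v ∩ {x | 0 ≤ lastCoord x ∧ lastCoord x ≤ 1}
    = {x | fstCoords x ∈ sliceOne n Ω v ∧ ψ (fstCoords x) ≤ lastCoord x ∧ lastCoord x ≤ 1}) ∧
  IsCompact ({x ∈ Ω | v x ≤ 1} ∩ {x | lastCoord x ≤ 1}) ∧
  (∃ x₀' : EuclideanSpace ℝ (Fin (n - 1)),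
    (∫ y in sliceOne n Ω v, y) = (volume (sliceOne n Ω v)).toReal • x₀' ∧
    Metric.ball x₀' r ⊆ sliceOne n Ω v ∧ sliceOne n Ω v ⊆ Metric.ball x₀' R)

/-- Euclidean `n`-space. -/
abbrev Euc (n : ℕ) := EuclideanSpace ℝ (Fin n)

theorem mem_subgrad_of_min {n : ℕ} {S Ω : Set (Euc n)} {v : Euc n → ℝ} (hv : ConvexOn ℝ Ω v)
    (hS : IsOpen S) (hSΩ : S ⊆ Ω) {x ξ : Euc n} (hx : x ∈ S)
    (hmin : ∀ y ∈ S, v x - ⟪ξ, x⟫ ≤ v y - ⟪ξ, y⟫) : ξ ∈ subgrad Ω v x := by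
  have hg : ConvexOn ℝ Ω (fun y => v y - ⟪ξ, y⟫) := by
    refine hv.sub ?_
    refine ⟨hv.1, fun a _ b _ s t _ _ _ => ?_⟩
    simp [inner_add_right, inner_smul_right]
  have hloc : IsLocalMinOn (fun y => v y - ⟪ξ, y⟫) Ω x := by
    refine Filter.Eventually.filter_mono nhdsWithin_le_nhds ?_
    filter_upwards [hS.mem_nhds hx] with y hy using hmin y hy
  have := IsMinOn.of_isLocalMinOn_of_convexOn (hSΩ hx) hloc hg
  intro y hy
  have h := this hy
  simp only [mem_ofPred_eq] at h
  rw [inner_sub_right]; linarith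

theorem exists_mem_subgrad {n : ℕ} {Ω : Set (Euc n)} {v : Euc n → ℝ} (hΩ : IsOpen Ω)
    (hc : ContinuousOn v Ω) (hv : ConvexOn ℝ Ω v) {x : Euc n} (hx : x ∈ Ω) :
    ∃ p, p ∈ subgrad Ω v x := by
  have hopen : IsOpen {z : Euc n × ℝ | z.1 ∈ Ω ∧ v z.1 < z.2} := by
    have h1 : IsOpen (Prod.fst ⁻¹' Ω : Set (Euc n × ℝ)) := hΩ.preimage continuous_fst
    have h2 : ContinuousOn (fun z : Euc n × ℝ => z.2 - v z.1) (Prod.fst ⁻¹' Ω) :=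
      continuous_snd.continuousOn.sub (hc.comp continuous_fst.continuousOn (fun z hz => hz))
    have := h2.isOpen_inter_preimage h1 isOpen_Ioi (t := Ioi 0)
    convert this using 1
    ext z; simp
  have hconv := hv.convex_strict_epigraph
  obtain ⟨f, hf⟩ := geometric_hahn_banach_open_point hconv hopen (x := (x, v x)) (by simp)
  have hdec : ∀ y t, f (y, t) = f (y, 0) + t * f (0, 1) := by
    intro y t
    have : (y, t) = (y, (0:ℝ)) + t • ((0 : Euc n), (1:ℝ)) := by simp
    rw [this, map_add, map_smul, smul_eq_mul]
  set c := f (0, 1) with hcdef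
  have hcneg : c < 0 := by
    have := hf (x, v x + 1) ⟨hx, by simp⟩
    rw [hdec, hdec x (v x)] at this; linarith
  let g : Euc n →L[ℝ] ℝ := f.comp (ContinuousLinearMap.inl ℝ (Euc n) ℝ)
  have hgdef : ∀ y, g y = f (y, 0) := fun y => by simp [g]
  let p := (InnerProductSpace.toDual ℝ (Euc n)).symm ((-c⁻¹) • g)
  have hp : ∀ y, ⟪p, y⟫ = (-c⁻¹) * g y := by
    intro y
    rw [show ⟪p, y⟫ = ((-c⁻¹) • g) y from InnerProductSpace.toDual_symm_apply]; rfl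
  refine ⟨p, fun y hy => ?_⟩
  refine le_of_forall_pos_le_add fun e he => ?_
  have h := hf (y, v y + e) ⟨hy, by simpa using he⟩
  rw [hdec, hdec x (v x), ← hgdef, ← hgdef] at h
  rw [inner_sub_right, hp, hp]
  have h2 : c⁻¹ < 0 := inv_lt_zero.2 hcneg
  have h3 : c⁻¹ * c = 1 := inv_mul_cancel₀ hcneg.ne
  have h4 := mul_lt_mul_of_neg_left h h2
  have h5 : c⁻¹ * (g x + v x * c) = c⁻¹ * g x + v x * (c⁻¹ * c) := by ring
  have h6 : c⁻¹ * (g y + (v y + e) * c) = c⁻¹ * g y + (v y + e) * (c⁻¹ * c) := by ring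
  rw [h5, h6, h3] at h4
  linarith

/-- Aleksandrov's estimate: a section which is thin on one side of `y0` in the direction `u`
is shallow at `y0`. -/
theorem alexandrov_estimate {n : ℕ} {q lam Lam : ℝ} (hq0 : 0 ≤ q) (hLam : 0 ≤ Lam)
    {Ω S : Set (Euc n)} {v : Euc n → ℝ} (hG : GenSol n q lam Lam Ω v)
    (hS : IsOpen S) (hScpt : IsCompact (closure S)) (hSΩ : closure S ⊆ Ω)
    (a : ℝ) (p : Euc n) (hbd : ∀ x ∈ closure S, x ∉ S → a + ⟪p, x⟫ ≤ v x)
    {y0 : Euc n} (hy0 : y0 ∈ S) {h0 : ℝ} (hh0 : 0 < h0) (hh : h0 ≤ a + ⟪p, y0⟫ - v y0)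
    {D d L : ℝ} (hD : S ⊆ ball y0 D) {u : Euc n} (hu : ‖u‖ = 1)
    (hd : 0 < d) (hdD : d ≤ D) (hud : ∀ x ∈ S, ⟪u, x - y0⟫ ≤ d) (hL : ∀ x ∈ S, v x ≤ L) :
    h0 ^ n ≤ 2 * d / D * (2 * D ^ 2) ^ n * Lam * L ^ q := by
  have hDpos : 0 < D := hd.trans_le hdD
  obtain ⟨hc, hv, hv0, hup, -⟩ := hG
  have hSΩ' : S ⊆ Ω := subset_closure.trans hSΩ
  have hL0 : 0 ≤ L := (hv0 _ (hSΩ' hy0)).trans (hL _ hy0)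
  have hucl : ∀ x ∈ closure S, ⟪u, x - y0⟫ ≤ d := by
    intro x hx
    have hcl : IsClosed {x : Euc n | ⟪u, x - y0⟫ ≤ d} :=
      isClosed_le (by fun_prop) continuous_const
    exact closure_minimal (fun x hx => hud x hx) hcl hx
  have hDcl : ∀ x ∈ closure S, ‖x - y0‖ ≤ D := by
    intro x hx
    have := closure_minimal (hD.trans ball_subset_closedBall) isClosed_closedBall hx
    rwa [mem_closedBall, dist_eq_norm] at this
  -- the slopes
  have key : ∀ s : ℝ, 0 ≤ s → s * d ≤ 1 / 2 → ∀ b : Euc n, ‖b‖ < 1 / (2 * D) →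
      p + h0 • (s • u + b) ∈ subgradImg Ω v S := by
    intro s hs hsd b hb
    set ξ := p + h0 • (s • u + b) with hξ
    have hcont : ContinuousOn (fun x => v x - ⟪ξ, x⟫) (closure S) :=
      (hc.mono hSΩ).sub (by fun_prop)
    obtain ⟨x, hx, hxmin⟩ := hScpt.exists_isMinOn ⟨y0, subset_closure hy0⟩ hcont
    have hxS : x ∈ S := by
      by_contra hxS
      have h1 := hxmin (subset_closure hy0)
      simp only [mem_ofPred_eq] at h1
      have h2 := hbd x hx hxS
      have h3 := hucl x hx
      have h4 : ⟪b, x - y0⟫ ≤ ‖b‖ * ‖x - y0‖ := real_inner_le_norm _ _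
      have h5 : ‖b‖ * ‖x - y0‖ < 1 / 2 := by
        calc ‖b‖ * ‖x - y0‖ ≤ ‖b‖ * D := by gcongr; exact hDcl x hx
          _ < 1 / (2 * D) * D := by gcongr
          _ = 1 / 2 := by field_simp
      have h6 : ⟪ξ, x⟫ - ⟪ξ, y0⟫ = ⟪p, x⟫ - ⟪p, y0⟫
          + h0 * (s * ⟪u, x - y0⟫ + ⟪b, x - y0⟫) := by
        rw [← inner_sub_right, hξ, inner_add_left, inner_smul_left, inner_add_left,
          inner_smul_left, inner_sub_right p]
        simp
      have h7 : s * ⟪u, x - y0⟫ ≤ s * d := by gcongr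
      have h8 : s * ⟪u, x - y0⟫ + ⟪b, x - y0⟫ < 1 := by linarith
      nlinarith [mul_lt_mul_of_pos_left h8 hh0]
    refine mem_iUnion₂.2 ⟨x, hxS, mem_subgrad_of_min hv hS hSΩ' hxS fun y hy => ?_⟩
    exact hxmin (subset_closure hy)
  set N := ⌊D / (2 * d)⌋₊ + 1 with hN
  have hNge : D / (2 * d) ≤ N := by
    rw [hN]; push_cast; exact (Nat.lt_floor_add_one _).le
  have hsub : (⋃ k ∈ Finset.range N, ball (p + (h0 * (k / D)) • u) (h0 / (2 * D)))
      ⊆ subgradImg Ω v S := by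
    refine iUnion₂_subset fun k hk => ?_
    intro ξ hξ
    rw [Finset.mem_range, hN, Nat.lt_succ_iff] at hk
    have hk' : (k : ℝ) ≤ D / (2 * d) := (Nat.le_floor_iff (by positivity)).1 hk
    have := key (k / D) (by positivity) (by
      calc (k : ℝ) / D * d ≤ D / (2 * d) / D * d := by gcongr
        _ = 1 / 2 := by field_simp) (h0⁻¹ • (ξ - (p + (h0 * (k / D)) • u))) (by
      rw [norm_smul, norm_inv, Real.norm_of_nonneg hh0.le]
      rw [mem_ball, dist_eq_norm] at hξ
      calc h0⁻¹ * _ < h0⁻¹ * (h0 / (2 * D)) := by gcongr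
        _ = 1 / (2 * D) := by field_simp)
    convert this using 1
    rw [smul_add, smul_smul, smul_smul, mul_inv_cancel₀ hh0.ne', one_smul]
    abel
  have hdisj : Set.PairwiseDisjoint (↑(Finset.range N))
      (fun k : ℕ => ball (p + (h0 * (k / D)) • u) (h0 / (2 * D))) := by
    intro i _ j _ hij
    refine ball_disjoint_ball ?_
    rw [dist_eq_norm]
    have : p + (h0 * (i / D)) • u - (p + (h0 * (j / D)) • u) = (h0 / D * ((i:ℝ) - j)) • u := by
      rw [add_sub_add_left_eq_sub, ← sub_smul]; congr 1; field_simp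
    rw [this, norm_smul, hu, mul_one, Real.norm_eq_abs, abs_mul, abs_of_pos (by positivity)]
    have h1 : (1:ℝ) ≤ |(i:ℝ) - j| := by
      have : (1:ℤ) ≤ |(i:ℤ) - j| := Int.one_le_abs (by omega)
      exact_mod_cast this
    calc h0 / (2 * D) + h0 / (2 * D) = h0 / D * 1 := by field_simp; ring
      _ ≤ _ := by gcongr
  set ω := volume (ball (0 : Euc n) 1) with hω
  have hω0 : ω ≠ 0 := (measure_ball_pos _ _ one_pos).ne'
  have hωt : ω ≠ ⊤ := measure_ball_lt_top.ne
  have hfin : Module.finrank ℝ (Euc n) = n := finrank_euclideanSpace_fin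
  have hlow : ENNReal.ofReal (N * (h0 / (2 * D)) ^ n) * ω ≤ volume (subgradImg Ω v S) := by
    refine le_trans ?_ (measure_mono hsub)
    rw [measure_biUnion_finset hdisj (fun _ _ => measurableSet_ball)]
    simp_rw [Measure.addHaar_ball_of_pos volume _ (show 0 < h0 / (2 * D) by positivity), hfin]
    rw [Finset.sum_const, Finset.card_range, nsmul_eq_mul, ENNReal.ofReal_mul (by positivity),
      ENNReal.ofReal_natCast, mul_assoc]
  have hupp : volume (subgradImg Ω v S) ≤ ENNReal.ofReal (Lam * (L ^ q * D ^ n)) * ω := by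
    refine (hup S hS.measurableSet hSΩ').trans ?_
    rw [ENNReal.ofReal_mul hLam, mul_assoc]
    gcongr
    calc ∫⁻ x in S ∩ {x | 0 < v x}, ENNReal.ofReal (v x ^ q)
        ≤ ∫⁻ x in S ∩ {x | 0 < v x}, ENNReal.ofReal (L ^ q) := by
          refine setLIntegral_mono' ?_ ?_
          · have := (hc.mono hSΩ').isOpen_inter_preimage hS isOpen_Ioi (t := Ioi 0)
            exact this.measurableSet
          · intro x hx
            exact ENNReal.ofReal_le_ofReal (Real.rpow_le_rpow hx.2.le (hL x hx.1) hq0)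
      _ = ENNReal.ofReal (L ^ q) * volume (S ∩ {x | 0 < v x}) := setLIntegral_const _ _
      _ ≤ ENNReal.ofReal (L ^ q) * volume (ball y0 D) := by
          gcongr; exact inter_subset_left.trans hD
      _ = _ := by
          rw [Measure.addHaar_ball_of_pos volume _ hDpos, hfin, ENNReal.ofReal_mul (by positivity),
            mul_assoc]
  have hfinal : (N : ℝ) * (h0 / (2 * D)) ^ n ≤ Lam * (L ^ q * D ^ n) := by
    have := hlow.trans hupp
    rw [ENNReal.mul_le_mul_iff_left hω0 hωt] at this
    exact (ENNReal.ofReal_le_ofReal_iff (by positivity)).1 this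
  have h1 : D / (2 * d) * (h0 / (2 * D)) ^ n ≤ Lam * (L ^ q * D ^ n) :=
    (mul_le_mul_of_nonneg_right hNge (by positivity)).trans hfinal
  calc h0 ^ n = (2 * d / D * (2 * D) ^ n) * (D / (2 * d) * (h0 / (2 * D)) ^ n) := by
        rw [div_pow]; field_simp
    _ ≤ (2 * d / D * (2 * D) ^ n) * (Lam * (L ^ q * D ^ n)) := by gcongr
    _ = 2 * d / D * (2 * D ^ 2) ^ n * Lam * L ^ q := by
        rw [show (2 * D ^ 2) = 2 * D * D by ring, mul_pow (2 * D) D]; ring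

theorem adjoint_det {n : ℕ} (T : Euc n →ₗ[ℝ] Euc n) :
    LinearMap.det (LinearMap.adjoint T) = LinearMap.det T := by
  have b := EuclideanSpace.basisFun (Fin n) ℝ
  rw [← LinearMap.det_toMatrix b.toBasis, ← LinearMap.det_toMatrix b.toBasis,
    LinearMap.toMatrix_adjoint b b, Matrix.det_conjTranspose]
  simp

theorem GenSol.comp_affine {n : ℕ} {q lam Lam : ℝ} {Ω : Set (Euc n)} {v : Euc n → ℝ}
    (hΩ : IsOpen Ω)
    (hG : GenSol n q lam Lam Ω v) (hlam : 0 ≤ lam) (hLam : 0 ≤ Lam) (z : Euc n)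
    (T : Euc n ≃L[ℝ] Euc n) {h : ℝ} (hh : 0 < h) :
    GenSol n q (lam * (LinearMap.det (T : Euc n →ₗ[ℝ] Euc n) ^ 2 * h ^ (q - n)))
      (Lam * (LinearMap.det (T : Euc n →ₗ[ℝ] Euc n) ^ 2 * h ^ (q - n)))
      {x | z + T x ∈ Ω} (fun x => v (z + T x) / h) := by
  obtain ⟨hc, hv, hv0, hup, hlo⟩ := hG
  set Ω' : Set (Euc n) := {x | z + T x ∈ Ω} with hΩ'
  set w : Euc n → ℝ := fun x => v (z + T x) / h with hw
  set dT := LinearMap.det (T : Euc n →ₗ[ℝ] Euc n) with hdT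
  have hΩ'o : IsOpen Ω' := hΩ.preimage (by fun_prop : Continuous fun x => z + T x)
  have hwc : ContinuousOn w Ω' :=
    (hc.comp (by fun_prop : Continuous fun x => z + T x).continuousOn (fun x hx => hx)).div_const h
  have hwv : ConvexOn ℝ Ω' w := by
    have h1 := hv.comp_affineMap
      ((T : Euc n →ₗ[ℝ] Euc n).toAffineMap + AffineMap.const ℝ (Euc n) z)
    have h2 := h1.smul (inv_nonneg.2 hh.le)
    have e1 : (⇑((T : Euc n →ₗ[ℝ] Euc n).toAffineMap + AffineMap.const ℝ (Euc n) z)) =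
        fun x => z + T x := by
      ext1 x; simp [add_comm]
    rw [e1] at h2
    refine h2.congr ?_
    intro x _
    simp [hw, div_eq_inv_mul]
  -- the slope map
  let A : Euc n →ₗ[ℝ] Euc n := h⁻¹ • LinearMap.adjoint (T : Euc n →ₗ[ℝ] Euc n)
  have hAin : ∀ p x, ⟪A p, x⟫ = h⁻¹ * ⟪p, T x⟫ := by
    intro p x
    simp only [A, LinearMap.smul_apply, inner_smul_left, LinearMap.adjoint_inner_left]
    simp
  have hAdet : |LinearMap.det A| = h⁻¹ ^ n * |dT| := by
    simp only [A]
    rw [LinearMap.det_smul, adjoint_det, finrank_euclideanSpace_fin, abs_mul,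
      abs_of_pos (by positivity)]
  have hAsurj : ∀ ξ, ∃ p, A p = ξ := by
    intro ξ
    refine ⟨h • LinearMap.adjoint (T.symm : Euc n →ₗ[ℝ] Euc n) ξ, ?_⟩
    refine ext_inner_right ℝ fun x => ?_
    rw [hAin, inner_smul_left, LinearMap.adjoint_inner_left]
    simp [hh.ne']
  have hsub : ∀ p x, A p ∈ subgrad Ω' w x ↔ p ∈ subgrad Ω v (z + T x) := by
    intro p x
    have key : ∀ y, (w x + ⟪A p, y - x⟫ ≤ w y ↔
        v (z + T x) + ⟪p, (z + T y) - (z + T x)⟫ ≤ v (z + T y)) := by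
      intro y
      rw [hAin, add_sub_add_left_eq_sub, ← map_sub]
      simp only [hw]
      rw [div_eq_inv_mul, div_eq_inv_mul, ← mul_add, mul_le_mul_iff_right₀ (inv_pos.2 hh)]
    constructor
    · intro H y hy
      have := (key (T.symm (y - z))).1 (H _ (by simpa [hΩ'] using hy))
      simpa using this
    · intro H y hy
      exact (key y).2 (H _ hy)
  have himg : ∀ E, subgradImg Ω' w E = A '' subgradImg Ω v ((fun x => z + T x) '' E) := by
    intro E
    ext ξ
    simp only [subgradImg, mem_iUnion, mem_image, exists_prop]
    constructor
    · rintro ⟨x, hx, hξ⟩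
      obtain ⟨p, rfl⟩ := hAsurj ξ
      exact ⟨p, ⟨_, ⟨x, hx, rfl⟩, (hsub p x).1 hξ⟩, rfl⟩
    · rintro ⟨p, ⟨_, ⟨x, hx, rfl⟩, hp⟩, rfl⟩
      exact ⟨x, hx, (hsub p x).2 hp⟩
  have hvol : ∀ E, volume (subgradImg Ω' w E) =
      ENNReal.ofReal (h⁻¹ ^ n * |dT|) * volume (subgradImg Ω v ((fun x => z + T x) '' E)) := by
    intro E
    rw [himg, Measure.addHaar_image_linearMap, hAdet]
  have hmeas : ∀ E, MeasurableSet E → MeasurableSet ((fun x => z + T x) '' E) := by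
    intro E hE
    have : (fun x => z + T x) '' E = (fun y => T.symm (y - z)) ⁻¹' E := by
      ext y
      constructor
      · rintro ⟨x, hx, rfl⟩; simpa using hx
      · intro hy; exact ⟨_, hy, by simp⟩
    rw [this]
    exact (by fun_prop : Continuous fun y => T.symm (y - z)).measurable hE
  have hinter : ∀ E, ((fun x => z + T x) '' E) ∩ {x | 0 < v x} =
      (fun x => z + T x) '' (E ∩ {x | 0 < w x}) := by
    intro E
    ext y
    constructor
    · rintro ⟨⟨x, hx, rfl⟩, hy⟩
      exact ⟨x, ⟨hx, div_pos hy hh⟩, rfl⟩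
    · rintro ⟨x, ⟨hx, hy⟩, rfl⟩
      refine ⟨⟨x, hx, rfl⟩, ?_⟩
      have : w x * h = v (z + T x) := by simp [hw, hh.ne']
      show 0 < v (z + T x)
      rw [← this]; exact mul_pos hy hh
  have hintegral : ∀ E, MeasurableSet E → E ⊆ Ω' →
      ∫⁻ y in ((fun x => z + T x) '' E) ∩ {x | 0 < v x}, ENNReal.ofReal (v y ^ q) =
        ENNReal.ofReal (|dT| * h ^ q) * ∫⁻ x in E ∩ {x | 0 < w x}, ENNReal.ofReal (w x ^ q) := by
    intro E hE hEΩ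
    have hm : MeasurableSet (E ∩ {x | 0 < w x}) := by
      have h1 := (hwc.isOpen_inter_preimage hΩ'o isOpen_Ioi (t := Ioi 0)).measurableSet
      have : E ∩ {x | 0 < w x} = E ∩ (Ω' ∩ w ⁻¹' Ioi 0) := by
        ext x
        constructor
        · rintro ⟨a, b⟩; exact ⟨a, hEΩ a, b⟩
        · rintro ⟨a, _, b⟩; exact ⟨a, b⟩
      rw [this]; exact hE.inter h1
    rw [hinter, lintegral_image_eq_lintegral_abs_det_fderiv_mul volume hm
      (f' := fun _ => (T : Euc n →L[ℝ] Euc n))]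
    · rw [ENNReal.ofReal_mul (abs_nonneg _), mul_assoc, ← lintegral_const_mul' _ _ (by simp),
        ← lintegral_const_mul' _ _ (by simp)]
      refine setLIntegral_congr_fun hm fun x hx => ?_
      show ENNReal.ofReal |dT| * _ = _
      have : w x * h = v (z + T x) := by simp [hw, hh.ne']
      have hwx : 0 < w x := hx.2
      rw [← this, Real.mul_rpow hwx.le hh.le, mul_comm (w x ^ q),
        ENNReal.ofReal_mul (p := h ^ q) (by positivity)]
    · intro x _
      exact (((T : Euc n →L[ℝ] Euc n).hasFDerivAt).const_add z).hasFDerivWithinAt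
    · intro x _ y _ hxy
      simpa using hxy
  have hcoef : (h⁻¹ ^ n * |dT|) * (|dT| * h ^ q) = dT ^ 2 * h ^ (q - n) := by
    rw [Real.rpow_sub hh, Real.rpow_natCast, ← sq_abs dT, inv_pow]; field_simp
  refine ⟨hwc, hwv, fun x hx => div_nonneg (hv0 _ hx) hh.le, fun E hE hEΩ => ?_, fun E hE hEΩ => ?_⟩
  · rw [hvol]
    have h1 := hup _ (hmeas E hE) (by rintro _ ⟨x, hx, rfl⟩; exact hEΩ hx)
    rw [hintegral E hE hEΩ] at h1
    calc _ ≤ ENNReal.ofReal (h⁻¹ ^ n * |dT|) * _ := mul_le_mul_right h1 _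
      _ = _ := by
        rw [← hcoef, ENNReal.ofReal_mul hLam, ENNReal.ofReal_mul (p := h⁻¹ ^ n * |dT|)
          (by positivity)]
        ring
  · rw [hvol, ← hinter]
    have h1 := hlo _ (hmeas E hE) (by rintro _ ⟨x, hx, rfl⟩; exact hEΩ hx)
    rw [hintegral E hE hEΩ] at h1
    calc _ = ENNReal.ofReal (h⁻¹ ^ n * |dT|) * (ENNReal.ofReal lam *
            (ENNReal.ofReal (|dT| * h ^ q) * ∫⁻ x in E ∩ {x | 0 < w x}, ENNReal.ofReal (w x ^ q))) := by
          rw [← hcoef, ENNReal.ofReal_mul hlam, ENNReal.ofReal_mul (p := h⁻¹ ^ n * |dT|)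
            (by positivity)]
          ring
      _ ≤ _ := by gcongr

theorem norm_le_of_inner_le {n : ℕ} {r M : ℝ} (hr : 0 < r) {η : Euc n}
    (H : ∀ w : Euc n, ‖w‖ < r → ⟪η, w⟫ ≤ M) : r * ‖η‖ ≤ M := by
  by_cases hη : η = 0
  · have := H 0 (by simpa using hr)
    simpa [hη] using this
  have hpos : 0 < ‖η‖ := norm_pos_iff.2 hη
  have : ∀ t ∈ Ioo 0 r, t * ‖η‖ ≤ M := by
    intro t ht
    have := H ((t / ‖η‖) • η) (by
      rw [norm_smul, Real.norm_of_nonneg (div_nonneg ht.1.le hpos.le)]; field_simp; exact ht.2)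
    rw [inner_smul_right, real_inner_self_eq_norm_sq] at this
    calc t * ‖η‖ = t / ‖η‖ * ‖η‖ ^ 2 := by field_simp
      _ ≤ M := this
  refine le_of_forall_lt fun c hc => ?_
  by_contra hM
  push Not at hM
  -- choose `t < r` with `t‖η‖ > c`
  have h1 : c / ‖η‖ < r := by rw [div_lt_iff₀ hpos]; exact hc
  obtain ⟨t, ht1, ht2⟩ := exists_between (max_lt h1 hr)
  have h2 := this t ⟨(le_max_right _ _).trans_lt ht1, ht2⟩
  have h3 := (div_lt_iff₀ hpos).1 ((le_max_left _ _).trans_lt ht1)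
  linarith

/-- If `v` is within `M0` of an affine function on a ball then `λ v^q` is controlled there. -/
theorem lower_estimate {n : ℕ} {q lam Lam : ℝ} (hq0 : 0 ≤ q) (hlam : 0 ≤ lam)
    {Ω : Set (Euc n)} {v : Euc n → ℝ} (hG : GenSol n q lam Lam Ω v)
    {y y' : Euc n} {s r' : ℝ} (hs : 0 < s) (hΩ : ball y s ⊆ Ω) (a : ℝ) (p : Euc n) {M0 : ℝ}
    (hM : ∀ x ∈ ball y s, a + ⟪p, x⟫ - M0 ≤ v x ∧ v x ≤ a + ⟪p, x⟫) (hr' : 0 < r')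
    (hsub : ball y' r' ⊆ ball y (s / 2)) {b : ℝ} (hb : 0 < b) (hbv : ∀ x ∈ ball y' r', b ≤ v x) :
    lam * b ^ q * r' ^ n ≤ (2 * M0 / s) ^ n := by
  obtain ⟨-, -, -, -, hlo⟩ := hG
  have hM0 : 0 ≤ M0 := by have := hM y (mem_ball_self hs); linarith
  have hbb : ball y (s / 2) ⊆ ball y s := ball_subset_ball (by linarith)
  have hslope : subgradImg Ω v (ball y' r' ∩ {x | 0 < v x}) ⊆ closedBall p (2 * M0 / s) := by
    refine iUnion₂_subset fun x hx ξ hξ => ?_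
    rw [mem_closedBall, dist_eq_norm]
    have hxb := hsub hx.1
    have := norm_le_of_inner_le (r := s / 2) (M := M0) (η := ξ - p) (by positivity) (fun w hw => by
      have hxw : x + w ∈ ball y s := by
        rw [mem_ball, dist_eq_norm] at hxb ⊢
        calc ‖x + w - y‖ = ‖(x - y) + w‖ := by congr 1; abel
          _ ≤ ‖x - y‖ + ‖w‖ := norm_add_le _ _
          _ < s := by linarith
      have h1 := hξ _ (hΩ hxw)
      have h2 := (hM _ hxw).2
      have h3 := (hM _ (hbb hxb)).1
      rw [add_sub_cancel_left] at h1
      rw [inner_add_right] at h2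
      rw [inner_sub_left]; linarith)
    rw [le_div_iff₀ hs]; linarith
  have hfin : Module.finrank ℝ (Euc n) = n := finrank_euclideanSpace_fin
  set ω := volume (ball (0 : Euc n) 1) with hω
  have hω0 : ω ≠ 0 := (measure_ball_pos _ _ one_pos).ne'
  have hωt : ω ≠ ⊤ := measure_ball_lt_top.ne
  have h1 := hlo (ball y' r') measurableSet_ball (hsub.trans (hbb.trans hΩ))
  have h2 := h1.trans (measure_mono hslope)
  have hE : ball y' r' ∩ {x | 0 < v x} = ball y' r' :=
    inter_eq_left.2 fun x hx => hb.trans_le (hbv x hx)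
  rw [hE, Measure.addHaar_closedBall _ _ (by positivity), hfin] at h2
  have h3 : ENNReal.ofReal (lam * (b ^ q * r' ^ n)) * ω ≤
      ENNReal.ofReal ((2 * M0 / s) ^ n) * ω := by
    refine le_trans ?_ h2
    rw [ENNReal.ofReal_mul hlam, mul_assoc]
    gcongr
    have hvb := Measure.addHaar_ball_of_pos volume y' hr'
    rw [hfin] at hvb
    rw [ENNReal.ofReal_mul (by positivity), mul_assoc, ← hvb, ← setLIntegral_const]
    exact setLIntegral_mono' measurableSet_ball fun x hx =>
      ENNReal.ofReal_le_ofReal (Real.rpow_le_rpow hb.le (hbv x hx) hq0)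
  rw [ENNReal.mul_le_mul_iff_left hω0 hωt] at h3
  have := (ENNReal.ofReal_le_ofReal_iff (by positivity)).1 h3
  linarith

/-- One step of the self-improvement: a lower power bound on all small balls of `B` forces a
lower bound for the supremum on a given ball. -/
theorem nondegeneracy_step {n : ℕ} {q lam Lam : ℝ} (hq0 : 0 ≤ q)
    (hqn : q < n) (hlam : 0 ≤ lam) {Ω : Set (Euc n)} {v : Euc n → ℝ} (hΩ : IsOpen Ω)
    (hG : GenSol n q lam Lam Ω v)
    {y' : Euc n} {s' m Z : ℝ} (hs' : 0 < s') (hB : ball y' s' ⊆ Ω)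
    (hm : ∀ x ∈ ball y' s', v x ≤ m) (hZ : 0 < Z) {y1 : Euc n} (hy1 : y1 ∈ ball y' (s' / 4))
    (hv1 : Z * (s' / 4) ^ (2 * n / (n - q)) ≤ v y1) :
    lam * ((1 / 4) ^ (2 * n / (n - q) * q) * (1 / 16) ^ n) * Z ^ q ≤
      (m / s' ^ (2 * n / (n - q))) ^ n := by
  set M : ℝ := 2 * n / (n - q) with hMdef
  have hnq : (0:ℝ) < n - q := by linarith
  have hM : M * (n - q) = 2 * n := by rw [hMdef]; field_simp
  have hy1' : y1 ∈ ball y' s' := ball_subset_ball (by linarith) hy1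
  obtain ⟨p1, hp1⟩ := exists_mem_subgrad hΩ hG.1 hG.2.1 (hB hy1')
  -- a ball in the half space where `v ≥ v y1`
  obtain ⟨e, he, hpe⟩ : ∃ e : Euc n, ‖e‖ ≤ 1 ∧ ⟪p1, e⟫ = ‖p1‖ := by
    by_cases h : p1 = 0
    · exact ⟨0, by simp, by simp [h]⟩
    · refine ⟨‖p1‖⁻¹ • p1, ?_, ?_⟩
      · rw [norm_smul, norm_inv, norm_norm, inv_mul_cancel₀ (norm_ne_zero_iff.2 h)]
      · rw [inner_smul_right, real_inner_self_eq_norm_sq]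
        have := norm_ne_zero_iff.2 h
        field_simp
  set b := Z * (s' / 4) ^ M with hb
  have hbpos : 0 < b := by positivity
  have hsub : ball (y1 + (s' / 8) • e) (s' / 8) ⊆ ball y' (s' / 2) := by
    apply ball_subset
    rw [dist_eq_norm]
    rw [mem_ball, dist_eq_norm] at hy1
    have h1 : ‖(s' / 8) • e‖ ≤ s' / 8 := by
      rw [norm_smul, Real.norm_of_nonneg (by positivity)]
      nlinarith
    calc ‖y1 + (s' / 8) • e - y'‖ = ‖(y1 - y') + (s' / 8) • e‖ := by congr 1; abel
      _ ≤ ‖y1 - y'‖ + ‖(s' / 8) • e‖ := norm_add_le _ _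
      _ ≤ s' / 2 - s' / 8 := by linarith
  have hbv : ∀ x ∈ ball (y1 + (s' / 8) • e) (s' / 8), b ≤ v x := by
    intro x hx
    have h1 := hp1 x (hB (ball_subset_ball (by linarith) (hsub hx)))
    have h2 : ⟪p1, x - y1⟫ = ⟪p1, x - (y1 + (s' / 8) • e)⟫ + s' / 8 * ‖p1‖ := by
      rw [← hpe, ← inner_smul_right, ← inner_add_right]; congr 1; abel
    have h3 : -(‖p1‖ * ‖x - (y1 + (s' / 8) • e)‖) ≤ ⟪p1, x - (y1 + (s' / 8) • e)⟫ :=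
      (abs_le.1 (abs_real_inner_le_norm _ _)).1
    rw [mem_ball, dist_eq_norm] at hx
    have h4 : ‖p1‖ * ‖x - (y1 + (s' / 8) • e)‖ ≤ ‖p1‖ * (s' / 8) := by gcongr
    linarith
  have hm0 : 0 ≤ m := (hG.2.2.1 _ (hB (mem_ball_self hs'))).trans (hm _ (mem_ball_self hs'))
  have key := lower_estimate hq0 hlam hG hs' hB m 0 (M0 := m) (fun x hx => by
    have := hG.2.2.1 _ (hB hx)
    have := hm x hx
    simp; constructor <;> linarith) (by positivity) hsub hbpos hbv
  have e1 : b ^ q = Z ^ q * ((1 / 4) ^ (M * q) * s' ^ (M * q)) := by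
    rw [hb, Real.mul_rpow hZ.le (by positivity), ← Real.rpow_mul (by positivity),
      show s' / 4 = (1 / 4) * s' by ring, Real.mul_rpow (by norm_num) hs'.le]
  have e2 : s' ^ (M * q) * s' ^ n * (s' ^ n) = (s' ^ M) ^ n := by
    rw [← Real.rpow_natCast, ← Real.rpow_natCast (s' ^ M), ← Real.rpow_mul hs'.le,
      ← Real.rpow_add hs', ← Real.rpow_add hs']
    congr 1; linarith
  rw [e1] at key
  have hsn : 0 < s' ^ n := by positivity
  rw [div_pow m, le_div_iff₀ (by positivity), ← e2]
  have e4 : (s' / 8) ^ n = s' ^ n * ((1 / 16 : ℝ) ^ n * 2 ^ n) := by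
    rw [← mul_pow, ← mul_pow]; congr 1; ring
  rw [div_pow (2 * m), le_div_iff₀ hsn, e4] at key
  have h2n : (0:ℝ) < 2 ^ n := by positivity
  rw [mul_pow] at key
  refine le_of_mul_le_mul_left ?_ h2n
  linarith

/-- Positive solutions are quantitatively nondegenerate. -/
theorem nondegeneracy (n : ℕ) {q : ℝ} (hq0 : 0 ≤ q) (hqn : q < n) :
    ∃ c : ℝ, 0 < c ∧ ∀ (lam Lam : ℝ) (Ω : Set (Euc n)) (v : Euc n → ℝ) (y : Euc n) (s m : ℝ),
      0 ≤ lam → IsOpen Ω → GenSol n q lam Lam Ω v → 0 < s → ball y s ⊆ Ω →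
      (∀ x ∈ ball y s, 0 < v x ∧ v x ≤ m) → lam * c * s ^ (2 * n) ≤ m ^ ((n : ℝ) - q) := by
  set M : ℝ := 2 * n / (n - q) with hMdef
  have hnq : (0:ℝ) < n - q := by linarith
  have hM : M * (n - q) = 2 * n := by rw [hMdef]; field_simp
  have hM0 : 0 ≤ M := by positivity
  set c0 : ℝ := (1 / 4) ^ (M * q) * (1 / 16) ^ n with hc0
  have hc0pos : 0 < c0 := by positivity
  refine ⟨c0 * (1 / 2) ^ (2 * n), by positivity, ?_⟩
  intro lam Lam Ω v y s m hlam hΩ hG hs hB hv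
  set P : ℝ → Prop := fun Z => 0 ≤ Z ∧ ∀ (y' : Euc n) (s' : ℝ), 0 < s' → dist y' y + s' ≤ s / 2 →
    ∃ x ∈ ball y' s', Z * s' ^ M ≤ v x with hP
  have hsubB : ∀ (y' : Euc n) (s' : ℝ), dist y' y + s' ≤ s / 2 → ball y' s' ⊆ ball y s := by
    intro y' s' h
    exact ball_subset_ball' (by linarith)
  -- a positive element
  obtain ⟨Z0, hZ0, hPZ0⟩ : ∃ Z0, 0 < Z0 ∧ P Z0 := by
    have hcb : closedBall y (s / 2) ⊆ ball y s := closedBall_subset_ball (by linarith)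
    obtain ⟨x0, hx0, hmin⟩ := (isCompact_closedBall y (s / 2)).exists_isMinOn
      ⟨y, mem_closedBall_self (by positivity)⟩ (hG.1.mono (hcb.trans hB))
    have hpos := (hv x0 (hcb hx0)).1
    refine ⟨v x0 / (s / 2) ^ M, by positivity, by positivity, fun y' s' hs' h => ?_⟩
    refine ⟨y', mem_ball_self hs', ?_⟩
    have h0 : 0 ≤ dist y' y := dist_nonneg
    have h1 : v x0 ≤ v y' := hmin (mem_closedBall.2 (by linarith))
    have h2 : s' ^ M ≤ (s / 2) ^ M := Real.rpow_le_rpow hs'.le (by linarith) hM0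
    calc v x0 / (s / 2) ^ M * s' ^ M ≤ v x0 / (s / 2) ^ M * (s / 2) ^ M := by gcongr
      _ = v x0 := by field_simp
      _ ≤ v y' := h1
  have hbd : ∀ Z, P Z → Z * (s / 2) ^ M ≤ m := by
    intro Z hZ
    obtain ⟨x, hx, h⟩ := hZ.2 y (s / 2) (by positivity) (by simp)
    exact h.trans (hv x (hsubB y (s / 2) (by simp) hx)).2
  have hbdd : BddAbove {Z | P Z} := by
    refine ⟨m / (s / 2) ^ M, fun Z hZ => ?_⟩
    rw [le_div_iff₀ (by positivity)]
    exact hbd Z hZ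
  set Zs := sSup {Z | P Z} with hZs
  have hZspos : 0 < Zs := hZ0.trans_le (le_csSup hbdd hPZ0)
  have hZsm : Zs * (s / 2) ^ M ≤ m := by
    rw [← le_div_iff₀ (by positivity)]
    refine csSup_le ⟨Z0, hPZ0⟩ fun Z hZ => ?_
    rw [le_div_iff₀ (by positivity)]
    exact hbd Z hZ
  have hstep : ∀ Z Z', 0 < Z → P Z → 0 ≤ Z' → Z' ^ n < lam * c0 * Z ^ q → P Z' := by
    intro Z Z' hZ hPZ hZ' hlt
    refine ⟨hZ', fun y' s' hs' h => ?_⟩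
    by_contra hcon
    push Not at hcon
    obtain ⟨y1, hy1, hv1⟩ := hPZ.2 y' (s' / 4) (by positivity) (by linarith)
    have := nondegeneracy_step hq0 hqn hlam hΩ hG hs' ((hsubB y' s' h).trans hB)
      (m := Z' * s' ^ M) (fun x hx => (hcon x hx).le) hZ hy1 hv1
    rw [← hMdef, mul_div_assoc, div_self (show s' ^ M ≠ 0 by positivity), mul_one] at this
    linarith
  have hineq : ∀ Z, 0 < Z → P Z → lam * c0 * Z ^ q ≤ Zs ^ n := by
    intro Z hZ hPZ
    by_contra hcon
    push Not at hcon
    have hcont : Filter.Tendsto (fun x : ℝ => x ^ n) (nhdsWithin Zs (Ioi Zs)) (nhds (Zs ^ n)) :=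
      ((continuous_pow n).tendsto Zs).mono_left nhdsWithin_le_nhds
    obtain ⟨Z', h1, h2⟩ := ((hcont.eventually_lt_const hcon).and self_mem_nhdsWithin).exists
    have := le_csSup hbdd (hstep Z Z' hZ hPZ (hZspos.le.trans (le_of_lt h2)) h1)
    exact absurd h2 (not_lt.2 this)
  have hineq2 : lam * c0 * Zs ^ q ≤ Zs ^ n := by
    have hcont : Filter.Tendsto (fun x : ℝ => lam * c0 * x ^ q) (nhdsWithin Zs (Iio Zs))
        (nhds (lam * c0 * Zs ^ q)) :=
      ((continuous_const.mul (Real.continuous_rpow_const hq0)).tendsto Zs).mono_left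
        nhdsWithin_le_nhds
    refine le_of_tendsto hcont ?_
    filter_upwards [self_mem_nhdsWithin, nhdsWithin_le_nhds (Ioi_mem_nhds hZspos)] with Z h1 h2
    obtain ⟨Z1, hZ1, hlt⟩ := exists_lt_of_lt_csSup ⟨Z0, hPZ0⟩ h1
    refine hineq Z h2 ⟨le_of_lt h2, fun y' s' hs' h => ?_⟩
    obtain ⟨x, hx, h3⟩ := hZ1.2 y' s' hs' h
    exact ⟨x, hx, le_trans (by gcongr) h3⟩
  have h3 : lam * c0 ≤ Zs ^ ((n:ℝ) - q) := by
    rw [Real.rpow_sub hZspos, Real.rpow_natCast, le_div_iff₀ (by positivity)]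
    exact hineq2
  calc lam * (c0 * (1 / 2) ^ (2 * n)) * s ^ (2 * n)
      = lam * c0 * (s / 2) ^ (2 * n) := by rw [div_pow, div_pow]; ring
    _ ≤ Zs ^ ((n:ℝ) - q) * (s / 2) ^ (2 * n) := by gcongr
    _ = (Zs * (s / 2) ^ M) ^ ((n:ℝ) - q) := by
        rw [Real.mul_rpow hZspos.le (by positivity), ← Real.rpow_mul (by positivity), hM,
          ← Real.rpow_natCast (s / 2)]
        push_cast; rfl
    _ ≤ m ^ ((n:ℝ) - q) := by gcongr

theorem exists_basis_of_interior {n : ℕ} {C : Set (Euc n)} (hinterior : (interior C).Nonempty)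
    (x0 : Euc n) : ∃ w : Fin n → Euc n, (∀ i, w i ∈ C) ∧
      (EuclideanSpace.basisFun (Fin n) ℝ).toBasis.det (fun i => w i - x0) ≠ 0 := by
  set S : Set (Euc n) := (fun x => x - x0) '' C with hS
  obtain ⟨b, hbS, hspan, hli⟩ := exists_linearIndependent ℝ S
  have htop : Submodule.span ℝ S = ⊤ := by
    apply Submodule.eq_top_of_nonempty_interior'
    obtain ⟨c, hc⟩ := hinterior
    have h1 : c - x0 ∈ interior S := by
      have := (Homeomorph.subRight x0).isOpenMap.image_interior_subset C
      exact this ⟨c, hc, rfl⟩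
    exact ⟨c - x0, interior_mono Submodule.subset_span h1⟩
  have hsp : ⊤ ≤ Submodule.span ℝ (range (Subtype.val : b → Euc n)) := by
    rw [Subtype.range_coe, hspan, htop]
  let B := Module.Basis.mk hli hsp
  have : Fintype b := FiniteDimensional.fintypeBasisIndex B
  have hcard : Fintype.card b = n := by
    rw [← Module.finrank_eq_card_basis B, finrank_euclideanSpace_fin]
  let e : b ≃ Fin n := Fintype.equivFinOfCardEq hcard
  let B' := B.reindex e
  have hB' : ∀ i, B' i = ((e.symm i : b) : Euc n) := fun i => by simp [B', B]
  have hex : ∀ i, ∃ x ∈ C, x - x0 = B' i := by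
    intro i
    have : B' i ∈ S := by rw [hB']; exact hbS (e.symm i).2
    exact this
  choose w hwC hw using hex
  refine ⟨w, hwC, ?_⟩
  rw [show (fun i => w i - x0) = ⇑B' from funext hw]
  exact ((EuclideanSpace.basisFun (Fin n) ℝ).toBasis.isUnit_det B').ne_zero

/-- A compact convex set with interior can be linearly normalized with respect to any of its
points. -/
theorem exists_normalization {n : ℕ} {C : Set (Euc n)} (hC : IsCompact C)
    (hconv : Convex ℝ C) (hinterior : (interior C).Nonempty) {x0 : Euc n} (hx0 : x0 ∈ C) :
    ∃ T : Euc n ≃L[ℝ] Euc n, (∀ x ∈ C, ‖T.symm (x - x0)‖ ≤ n) ∧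
      ∃ ζ, ball ζ (1 / ((n : ℝ) + 1) ^ 2) ⊆ {ξ | x0 + T ξ ∈ C} := by
  set e := (EuclideanSpace.basisFun (Fin n) ℝ).toBasis with he
  have hcompact : IsCompact (Set.pi univ (fun _ : Fin n => C)) := isCompact_univ_pi fun _ => hC
  have hcont : Continuous (fun w : Fin n → Euc n => |e.det (fun i => w i - x0)|) := by
    refine continuous_abs.comp ?_
    have h1 : Continuous (fun w : Fin n → Euc n => e.det w) := by
      have : (fun w : Fin n → Euc n => e.det w) = fun w => (Matrix.of fun i j => w j i).det := by
        ext1 w; rw [Module.Basis.det_apply]; congr 1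
      rw [this]; simp_rw [Matrix.det_apply]
      refine continuous_finsetSum _ fun σ _ => ?_
      refine Continuous.const_smul ?_ _
      refine continuous_finsetProd _ fun i _ => ?_
      simp only [Matrix.of_apply]
      fun_prop
    exact h1.comp (by fun_prop)
  obtain ⟨w, hwC, hmax⟩ := hcompact.exists_isMaxOn
    ⟨fun _ => x0, fun _ _ => hx0⟩ hcont.continuousOn
  obtain ⟨w1, hw1C, hw1⟩ := exists_basis_of_interior hinterior x0
  set W : Fin n → Euc n := fun i => w i - x0 with hW
  have hdet : e.det W ≠ 0 := by
    intro h0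
    have := hmax (show w1 ∈ Set.pi univ (fun _ : Fin n => C) from fun i _ => hw1C i)
    simp only [mem_ofPred_eq] at this
    rw [show (fun i => w i - x0) = W from rfl, h0, abs_zero] at this
    exact hw1 (abs_nonpos_iff.1 this)
  obtain ⟨hli, hsp⟩ := (e.is_basis_iff_det).2 (isUnit_iff_ne_zero.2 hdet)
  let B := Module.Basis.mk hli hsp.ge
  have hcoord : ∀ i, ∀ x ∈ C, |B.coord i (x - x0)| ≤ 1 := by
    intro i x hx
    have h1 := e.det_smul_mk_coord_eq_det_update hli hsp.ge i
    have h2 : e.det W * B.coord i (x - x0) = e.det (Function.update W i (x - x0)) := by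
      exact congrArg (fun f => f (x - x0)) h1
    have h3 := hmax (show Function.update w i x ∈ Set.pi univ (fun _ : Fin n => C) from by
      intro j _
      by_cases hj : j = i
      · subst hj; simpa using hx
      · simpa [hj] using hwC j trivial)
    simp only [mem_ofPred_eq] at h3
    have h4 : (fun j => Function.update w i x j - x0) = Function.update W i (x - x0) := by
      ext1 j
      by_cases hj : j = i
      · subst hj; simp
      · simp [hj, hW]
    rw [h4, ← h2, abs_mul] at h3
    have h5 : 0 < |e.det W| := abs_pos.2 hdet
    exact le_of_mul_le_mul_left (by simpa using h3) h5
  let T : Euc n ≃L[ℝ] Euc n :=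
    ((EuclideanSpace.equiv (Fin n) ℝ).toLinearEquiv.trans B.equivFun.symm).toContinuousLinearEquiv
  have hT : ∀ ξ, T ξ = ∑ i, ξ i • W i := by
    intro ξ
    simp [T, B, Module.Basis.equivFun_symm_apply, EuclideanSpace.equiv]
  have hTs : ∀ x i, T.symm x i = B.coord i x := by
    intro x i
    simp [T, B, EuclideanSpace.equiv]
  refine ⟨T, ?_, ?_⟩
  · intro x hx
    have h1 : ‖T.symm (x - x0)‖ ^ 2 ≤ (n : ℝ) ^ 2 := by
      rw [EuclideanSpace.norm_sq_eq]
      calc ∑ i, ‖T.symm (x - x0) i‖ ^ 2 ≤ ∑ _i : Fin n, (1 : ℝ) := by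
            refine Finset.sum_le_sum fun i _ => ?_
            rw [hTs, Real.norm_eq_abs]
            have := hcoord i x hx
            have := abs_nonneg (B.coord i (x - x0))
            nlinarith
        _ = n := by simp
        _ ≤ (n : ℝ) ^ 2 := by exact_mod_cast Nat.le_self_pow (by norm_num) n
    exact le_of_sq_le_sq h1 (by positivity)
  · refine ⟨WithLp.toLp 2 (fun _ => 1 / ((n : ℝ) + 1)), fun ξ hξ => ?_⟩
    rw [mem_ball, dist_eq_norm] at hξ
    have hi : ∀ i, |ξ i - 1 / ((n : ℝ) + 1)| < 1 / ((n : ℝ) + 1) ^ 2 := by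
      intro i
      have := PiLp.norm_apply_le (ξ - WithLp.toLp 2 (fun _ => 1 / ((n : ℝ) + 1))) i
      exact lt_of_le_of_lt (by simpa using this) hξ
    have hle : 1 / ((n : ℝ) + 1) ^ 2 ≤ 1 / ((n : ℝ) + 1) := by
      gcongr; nlinarith [(Nat.cast_nonneg n : (0:ℝ) ≤ n)]
    have hpos : ∀ i, 0 ≤ ξ i := fun i => by have := (abs_lt.1 (hi i)).1; linarith
    have hsum : ∑ i, ξ i ≤ 1 := by
      calc ∑ i, ξ i ≤ ∑ _i : Fin n, (1 / ((n : ℝ) + 1) + 1 / ((n : ℝ) + 1) ^ 2) :=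
            Finset.sum_le_sum fun i _ => by have := (abs_lt.1 (hi i)).2; linarith
        _ = n * (1 / ((n : ℝ) + 1) + 1 / ((n : ℝ) + 1) ^ 2) := by simp; ring
        _ ≤ 1 := by
          have : (0:ℝ) < (n : ℝ) + 1 := by positivity
          rw [← sub_nonneg]
          have : 1 - n * (1 / ((n : ℝ) + 1) + 1 / ((n : ℝ) + 1) ^ 2) = 1 / ((n : ℝ) + 1) ^ 2 := by
            field_simp; ring
          rw [this]; positivity
    show x0 + T ξ ∈ C
    rcases (Finset.sum_nonneg fun i _ => hpos i : 0 ≤ ∑ i, ξ i).eq_or_lt with h0 | h0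
    · have hz : ∀ i, ξ i = 0 := fun i =>
        (Finset.sum_eq_zero_iff_of_nonneg fun i _ => hpos i).1 h0.symm i (Finset.mem_univ i)
      rw [hT]; simpa [hz] using hx0
    · have hy : ∑ i, (ξ i / ∑ j, ξ j) • w i ∈ C := by
        refine hconv.sum_mem (fun i _ => div_nonneg (hpos i) h0.le) ?_ (fun i _ => hwC i trivial)
        rw [← Finset.sum_div, div_self h0.ne']
      have h2 := hconv hx0 hy (sub_nonneg.2 hsum) h0.le (by ring)
      convert h2 using 1
      rw [hT, Finset.smul_sum]
      simp only [hW, smul_sub, Finset.sum_sub_distrib, smul_smul, ← Finset.sum_smul]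
      simp only [mul_div_cancel₀ _ h0.ne', sub_smul, one_smul]
      abel

/-- `S` is a section of the solution `v` cut by the affine function `x ↦ a + ⟪p, x⟫`, of depth at
most `M0`. -/
structure IsSection (n : ℕ) (q lam Lam : ℝ) (Ω : Set (Euc n)) (v : Euc n → ℝ) (S : Set (Euc n))
    (a : ℝ) (p : Euc n) (M0 : ℝ) : Prop where
  isOpen_dom : IsOpen Ω
  gen : GenSol n q lam Lam Ω v
  isOpen : IsOpen S
  convex : Convex ℝ S
  isCompact : IsCompact (closure S)
  subset : closure S ⊆ Ω
  lt : ∀ x ∈ S, v x < a + ⟪p, x⟫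
  bdry : ∀ x ∈ closure S, x ∉ S → a + ⟪p, x⟫ ≤ v x
  depth : ∀ x ∈ S, a + ⟪p, x⟫ - v x ≤ M0

/-- A section either reaches a large height or contains a fat part of the positivity set. -/
def IsFat {n : ℕ} (v : Euc n → ℝ) (S : Set (Euc n)) (a : ℝ) (p : Euc n) (M0 C2 k : ℝ) : Prop :=
  (∃ x ∈ S, C2 * M0 ≤ a + ⟪p, x⟫) ∨
  ∃ (P : Euc n) (β D : ℝ), 0 < D ∧ (∀ x ∈ S, v x = 0 → ⟪P, x⟫ ≤ β) ∧
    (∃ x ∈ S, β + D ≤ ⟪P, x⟫) ∧ ∀ x ∈ S, β - k * D ≤ ⟪P, x⟫ ∧ ⟪P, x⟫ ≤ β + k * D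

/-- The height of the affine function relative to which sections are considered tall. -/
def tallC (n : ℕ) : ℝ := 4 * (1 + (2 * n + 1) * ((n : ℝ) + 1) ^ 2)

theorem tallC_pos (n : ℕ) : 0 < tallC n := by unfold tallC; positivity

set_option maxHeartbeats 2000000 in
theorem section_normalized (n : ℕ) {q : ℝ} (hq0 : 0 ≤ q) (hqn : q < n)
    {ratio C1 k : ℝ} (hratio : 0 < ratio) (hC1 : 0 < C1) (hk : 0 < k) :
    ∃ ε : ℝ, 0 < ε ∧ ∀ (lam Lam : ℝ) (Ω : Set (Euc n)) (v : Euc n → ℝ) (S : Set (Euc n))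
      (a : ℝ) (p : Euc n) (M0 : ℝ) (y0 u z : Euc n) (d W : ℝ),
      0 < lam → 0 ≤ Lam → Lam ≤ ratio * lam → IsSection n q lam Lam Ω v S a p M0 →
      ball z (1 / ((n : ℝ) + 1) ^ 2) ⊆ S → S ⊆ closedBall 0 n → y0 ∈ S →
      M0 ≤ C1 * (a + ⟪p, y0⟫ - v y0) → 0 < W → (∀ x ∈ S, ⟪u, x - y0⟫ ≤ d) →
      (∃ x ∈ S, ⟪u, x - y0⟫ ≤ -W) → d ≤ ε * W → IsFat v S a p M0 (tallC n) k → False := by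
  obtain ⟨cnd, hcnd, hND⟩ := nondegeneracy n hq0 hqn
  set c : ℝ := 1 / ((n : ℝ) + 1) ^ 2 with hc
  have hcpos : 0 < c := by positivity
  set A : ℝ := 1 + (2 * n + 1) * ((n : ℝ) + 1) ^ 2 with hA
  have hApos : 0 < A := by positivity
  have hC2 : tallC n = 4 * A := rfl
  set D : ℝ := 2 * n + 1 with hD
  have hDpos : 0 < D := by positivity
  set θ : ℝ := 1 / (2 * (k + 1)) with hθ
  set σ : ℝ := 1 / (4 * (k + 1)) with hσ
  have hθpos : 0 < θ := by positivity
  have hσpos : 0 < σ := by positivity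
  have hθ1 : θ < 1 := by rw [hθ, div_lt_one (by positivity)]; linarith
  have hσ1 : σ < 1 := by rw [hσ, div_lt_one (by positivity)]; linarith
  set s : ℝ := σ * (θ * c) with hs
  have hspos : 0 < s := by positivity
  set X1 : ℝ := 2 * C1 ^ n * (2 * D ^ 2) ^ n * ratio * (4 * A) ^ q * (4 / c ^ 2) ^ n with hX1
  set X2 : ℝ := 2 * C1 ^ n * (2 * D ^ 2) ^ n * ratio * (4 * A) ^ q * (4 * A) ^ ((n:ℝ) - q)
    / (cnd * s ^ (2 * n)) with hX2
  have hX1pos : 0 < X1 := by positivity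
  have hX2pos : 0 < X2 := by positivity
  refine ⟨1 / (1 + X1 + X2), by positivity, ?_⟩
  set ε : ℝ := 1 / (1 + X1 + X2) with hε
  have hεpos : 0 < ε := by positivity
  have hε1 : ε ≤ 1 := by rw [hε, div_le_one (by positivity)]; linarith
  have hεX1 : ε * X1 < 1 := by rw [hε, one_div, inv_mul_lt_iff₀ (by positivity)]; linarith
  have hεX2 : ε * X2 < 1 := by rw [hε, one_div, inv_mul_lt_iff₀ (by positivity)]; linarith
  intro lam Lam Ω v S a p M0 y0 u z d W hlam hLam hLl hS hzS hSR hy0 hM0 hW hud hW' hdW hfat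
  have hv0 : ∀ x ∈ S, 0 ≤ v x := fun x hx => hS.gen.2.2.1 _ (hS.subset (subset_closure hx))
  have hzS' : z ∈ S := hzS (mem_ball_self hcpos)
  have hM0pos : 0 < M0 := by have := hS.lt y0 hy0; have := hS.depth y0 hy0; linarith
  have hlpos : ∀ x ∈ S, 0 < a + ⟪p, x⟫ := fun x hx => (hv0 x hx).trans_lt (hS.lt x hx)
  have hdist : ∀ x ∈ S, ∀ y ∈ S, ‖x - y‖ ≤ 2 * n := by
    intro x hx y hy
    have h1 := hSR hx
    have h2 := hSR hy
    rw [mem_closedBall_zero_iff] at h1 h2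
    have := norm_sub_le x y
    linarith
  set lz := a + ⟪p, z⟫ with hlz
  set L := A * lz with hL
  have hlzpos : 0 < lz := hlpos z hzS'
  have hLpos : 0 < L := by positivity
  have hlL : ∀ x ∈ S, a + ⟪p, x⟫ ≤ L := by
    intro x hx
    have hmem : z + (-(c / D)) • (x - z) ∈ S := by
      apply hzS
      rw [mem_ball, dist_eq_norm, add_sub_cancel_left, norm_smul, norm_neg,
        Real.norm_of_nonneg (by positivity)]
      have := hdist x hx z hzS'
      calc c / D * ‖x - z‖ ≤ c / D * (2 * n) := by gcongr
        _ < c / D * D := by gcongr; rw [hD]; linarith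
        _ = c := by field_simp
    have h1 := hlpos _ hmem
    rw [inner_add_right, inner_smul_right, inner_sub_right] at h1
    have h2 : (D / c) * (a + (⟪p, z⟫ + -(c / D) * (⟪p, x⟫ - ⟪p, z⟫)))
        = D / c * lz - (⟪p, x⟫ - ⟪p, z⟫) := by rw [hlz]; field_simp; ring
    have h3 : 0 < D / c * lz - (⟪p, x⟫ - ⟪p, z⟫) := by rw [← h2]; positivity
    have h4 : L = lz + D / c * lz := by rw [hL, hA, hc, hD]; field_simp
    linarith
  have hvL : ∀ x ∈ S, v x ≤ L := fun x hx => ((hS.lt x hx).le).trans (hlL x hx)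
  -- the Aleksandrov bound
  have hAL : (M0 / C1) ^ n ≤ 2 * ε * (2 * D ^ 2) ^ n * (ratio * lam) * L ^ q := by
    obtain ⟨x1, hx1, hx1W⟩ := hW'
    have hune : u ≠ 0 := by
      rintro rfl
      simp at hx1W; linarith
    have hunorm : 0 < ‖u‖ := norm_pos_iff.2 hune
    have hWD : W ≤ ‖u‖ * D := by
      have h1 := (abs_le.1 (abs_real_inner_le_norm u (x1 - y0))).1
      have h2 := hdist x1 hx1 y0 hy0
      have h3 : ‖u‖ * ‖x1 - y0‖ ≤ ‖u‖ * D := by gcongr; linarith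
      linarith
    have := alexandrov_estimate hq0 hLam hS.gen hS.isOpen hS.isCompact hS.subset a p hS.bdry hy0
      (h0 := M0 / C1) (by positivity) (by rw [div_le_iff₀ hC1]; linarith) (D := D) (d := ε * D)
      (L := L) (fun x hx => by
        rw [mem_ball, dist_eq_norm]; have := hdist x hx y0 hy0; linarith)
      (u := ‖u‖⁻¹ • u) (by rw [norm_smul, norm_inv, norm_norm, inv_mul_cancel₀ hunorm.ne'])
      (by positivity) (by nlinarith) (fun x hx => by
        rw [inner_smul_left]
        simp only [conj_trivial]
        rw [inv_mul_le_iff₀ hunorm]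
        calc _ ≤ d := hud x hx
          _ ≤ ε * W := hdW
          _ ≤ ε * (‖u‖ * D) := by gcongr
          _ = _ := by ring) hvL
    rw [show 2 * (ε * D) / D = 2 * ε by field_simp] at this
    refine this.trans ?_
    gcongr
  have hM0n : M0 ^ n ≤ ε * (2 * C1 ^ n * (2 * D ^ 2) ^ n * ratio) * (lam * L ^ q) := by
    rw [div_pow, div_le_iff₀ (by positivity)] at hAL
    linarith
  have hM0n0 : 0 < M0 ^ n := by positivity
  by_cases hcase : 4 * A * M0 ≤ L
  · -- tall sections
    have hball : ∀ x ∈ ball z (c / 2), L / (4 * A) ≤ v x := by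
      intro x hx
      have hx2 : z + (2 : ℝ) • (x - z) ∈ S := by
        apply hzS
        rw [mem_ball, dist_eq_norm] at hx ⊢
        rw [add_sub_cancel_left, norm_smul, Real.norm_of_nonneg (by norm_num)]
        linarith
      have hxS : x ∈ S := hzS (ball_subset_ball (by linarith) hx)
      have h1 := hlpos _ hx2
      rw [inner_add_right, inner_smul_right, inner_sub_right] at h1
      have h2 := hS.depth x hxS
      have h3 : L / (4 * A) = lz / 4 := by rw [hL]; field_simp
      have h4 : M0 ≤ lz / 4 := by rw [← h3, le_div_iff₀ (by positivity)]; linarith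
      rw [h3]; linarith
    have h1 := lower_estimate hq0 hlam.le hS.gen hcpos (hzS.trans (subset_closure.trans hS.subset))
      a p (M0 := M0) (fun x hx => ⟨by have := hS.depth x (hzS hx); linarith, (hS.lt x (hzS hx)).le⟩)
      (r' := c / 2) (by positivity) (Subset.refl _) (b := L / (4 * A)) (by positivity) hball
    have h2 : lam * L ^ q ≤ (4 * A) ^ q * (4 / c ^ 2) ^ n * M0 ^ n := by
      rw [Real.div_rpow hLpos.le (by positivity)] at h1
      have e1 : (2 * M0 / c) ^ n = (4 / c ^ 2) ^ n * M0 ^ n * (c / 2) ^ n := by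
        rw [← mul_pow, ← mul_pow]; congr 1; field_simp; ring
      rw [e1] at h1
      have h3 := le_of_mul_le_mul_right h1 (by positivity)
      rw [← mul_div_assoc, div_le_iff₀ (by positivity)] at h3
      linarith
    have h3 : M0 ^ n ≤ ε * X1 * M0 ^ n := by
      refine hM0n.trans ?_
      calc _ ≤ ε * (2 * C1 ^ n * (2 * D ^ 2) ^ n * ratio) *
            ((4 * A) ^ q * (4 / c ^ 2) ^ n * M0 ^ n) := by gcongr
        _ = _ := by rw [hX1]; ring
    nlinarith
  · push Not at hcase
    rcases hfat with ⟨x, hx, hxl⟩ | ⟨P, β, D', hD', hKP, ⟨x2, hx2, hx2P⟩, hPb⟩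
    · rw [hC2] at hxl
      have := hlL x hx
      linarith
    · set xm := (1 - θ) • x2 + θ • z with hxm
      have hin : ball xm (θ * c) ⊆ S := by
        intro x hx
        have h1 : z + θ⁻¹ • (x - xm) ∈ S := by
          apply hzS
          rw [mem_ball, dist_eq_norm] at hx ⊢
          rw [add_sub_cancel_left, norm_smul, norm_inv, Real.norm_of_nonneg hθpos.le,
            inv_mul_lt_iff₀ hθpos]
          exact hx
        have h2 := hS.convex hx2 h1 (sub_nonneg.2 hθ1.le) hθpos.le (by ring)
        convert h2 using 1
        rw [smul_add, smul_smul, mul_inv_cancel₀ hθpos.ne', one_smul, ← add_assoc, ← hxm]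
        abel
      have hPm : β + D' / 2 ≤ ⟪P, xm⟫ := by
        rw [hxm, inner_add_right, inner_smul_right, inner_smul_right]
        have h1 := (hPb z hzS').1
        have h2 : θ * (k + 1) = 1 / 2 := by rw [hθ]; field_simp
        have h3 : (1 - θ) * (β + D') ≤ (1 - θ) * ⟪P, x2⟫ := by
          have : 0 ≤ 1 - θ := by linarith
          gcongr
        have h4 : θ * (β - k * D') ≤ θ * ⟪P, z⟫ := by gcongr
        have h5 : (1 - θ) * (β + D') + θ * (β - k * D') = β + D' - θ * (k + 1) * D' := by ring
        rw [h2] at h5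
        linarith
      have hpos : ∀ x ∈ ball xm s, 0 < v x ∧ v x ≤ L := by
        intro x hx
        have hxS : x ∈ S := hin (ball_subset_ball (by rw [hs]; nlinarith [mul_pos hθpos hcpos]) hx)
        refine ⟨?_, hvL x hxS⟩
        refine (hv0 x hxS).lt_of_ne' fun h0 => ?_
        have h1 := hKP x hxS h0
        have h2 : xm + (-σ⁻¹) • (x - xm) ∈ S := by
          apply hin
          rw [mem_ball, dist_eq_norm] at hx ⊢
          rw [add_sub_cancel_left, norm_smul, norm_neg, norm_inv, Real.norm_of_nonneg hσpos.le,
            inv_mul_lt_iff₀ hσpos]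
          exact hx
        have h3 := (hPb _ h2).2
        rw [inner_add_right, inner_smul_right, inner_sub_right] at h3
        have h4 : σ * (k + 1) = 1 / 4 := by rw [hσ]; field_simp
        have h5 : σ * (⟪P, xm⟫ + -σ⁻¹ * (⟪P, x⟫ - ⟪P, xm⟫)) =
            σ * ⟪P, xm⟫ - (⟪P, x⟫ - ⟪P, xm⟫) := by field_simp; ring
        have h6 := mul_le_mul_of_nonneg_left h3 hσpos.le
        rw [h5] at h6
        have h7 : σ * (β + D' / 2) ≤ σ * ⟪P, xm⟫ := by gcongr
        have h8 : σ * (β + k * D') = σ * β + (σ * (k + 1)) * D' - σ * D' := by ring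
        rw [h4] at h8
        have h9 : 0 < σ * D' := by positivity
        linarith
      have h1 := hND lam Lam Ω v xm s L hlam.le hS.isOpen_dom hS.gen hspos
        ((ball_subset_ball (by rw [hs]; nlinarith [mul_pos hθpos hcpos])).trans
          (hin.trans (subset_closure.trans hS.subset))) hpos
      have hnq : (0:ℝ) < n - q := by linarith
      have h2 : lam ≤ (4 * A) ^ ((n:ℝ) - q) * M0 ^ ((n:ℝ) - q) / (cnd * s ^ (2 * n)) := by
        rw [le_div_iff₀ (by positivity), ← Real.mul_rpow (by positivity) hM0pos.le]
        calc _ = lam * cnd * s ^ (2 * n) := by ring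
          _ ≤ _ := h1
          _ ≤ _ := by gcongr
      have h3 : L ^ q ≤ (4 * A) ^ q * M0 ^ q := by
        rw [← Real.mul_rpow (by positivity) hM0pos.le]; gcongr
      have h4 : M0 ^ ((n:ℝ) - q) * M0 ^ q = M0 ^ n := by
        rw [← Real.rpow_add hM0pos, ← Real.rpow_natCast]; congr 1; ring
      have h5 : M0 ^ n ≤ ε * X2 * M0 ^ n := by
        refine hM0n.trans ?_
        calc _ ≤ ε * (2 * C1 ^ n * (2 * D ^ 2) ^ n * ratio) *
              (((4 * A) ^ ((n:ℝ) - q) * M0 ^ ((n:ℝ) - q) / (cnd * s ^ (2 * n))) *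
                ((4 * A) ^ q * M0 ^ q)) := by gcongr
          _ = ε * X2 * (M0 ^ ((n:ℝ) - q) * M0 ^ q) := by rw [hX2]; ring
          _ = _ := by rw [h4]
      nlinarith

theorem section_lemma (n : ℕ) {q : ℝ} (hq0 : 0 ≤ q) (hqn : q < n)
    {ratio C1 k : ℝ} (hratio : 0 < ratio) (hC1 : 0 < C1) (hk : 0 < k) :
    ∃ ε : ℝ, 0 < ε ∧ ∀ (lam Lam : ℝ) (Ω : Set (Euc n)) (v : Euc n → ℝ) (S : Set (Euc n))
      (a : ℝ) (p : Euc n) (M0 : ℝ) (y0 u : Euc n) (d W : ℝ),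
      0 < lam → 0 ≤ Lam → Lam ≤ ratio * lam → IsSection n q lam Lam Ω v S a p M0 →
      y0 ∈ S → M0 ≤ C1 * (a + ⟪p, y0⟫ - v y0) → 0 < W → (∀ x ∈ S, ⟪u, x - y0⟫ ≤ d) →
      (∃ x ∈ S, ⟪u, x - y0⟫ ≤ -W) → d ≤ ε * W → IsFat v S a p M0 (tallC n) k → False := by
  obtain ⟨ε, hε, H⟩ := section_normalized n hq0 hqn hratio hC1 hk
  refine ⟨ε, hε, ?_⟩
  intro lam Lam Ω v S a p M0 y0 u d W hlam hLam hLl hS hy0 hM0 hW hud hW' hdW hfat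
  have hSne : (interior S).Nonempty := by rw [hS.isOpen.interior_eq]; exact ⟨y0, hy0⟩
  have hintcl : interior (closure S) = S := by
    rw [hS.convex.interior_closure_eq_interior_of_nonempty_interior hSne, hS.isOpen.interior_eq]
  obtain ⟨T, hT1, z, hT2⟩ := exists_normalization hS.isCompact hS.convex.closure
    (by rw [hintcl]; exact ⟨y0, hy0⟩) (subset_closure hy0)
  set Φ : Euc n ≃ₜ Euc n := T.toHomeomorph.trans (Homeomorph.addLeft y0) with hΦ
  have hΦa : ∀ ξ, Φ ξ = y0 + T ξ := fun ξ => rfl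
  have hΦs : ∀ x, Φ.symm x = T.symm (x - y0) := fun x => by
    rw [Homeomorph.symm_apply_eq, hΦa]; simp
  set S' : Set (Euc n) := Φ ⁻¹' S with hS'
  have hcl : closure S' = Φ ⁻¹' closure S := (Φ.preimage_closure S).symm
  set Ts : Euc n →L[ℝ] Euc n := ContinuousLinearMap.adjoint (T : Euc n →L[ℝ] Euc n) with hTs
  have hTsa : ∀ w ξ, ⟪Ts w, ξ⟫ = ⟪w, T ξ⟫ := fun w ξ => by
    rw [hTs, ContinuousLinearMap.adjoint_inner_left]; rfl
  have hin : ∀ w ξ, ⟪w, y0⟫ + ⟪Ts w, ξ⟫ = ⟪w, Φ ξ⟫ := fun w ξ => by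
    rw [hTsa, hΦa, inner_add_right]
  have hl : ∀ ξ, a + ⟪p, y0⟫ + ⟪Ts p, ξ⟫ = a + ⟪p, Φ ξ⟫ := fun ξ => by rw [← hin]; ring
  have hsurj : ∀ x ∈ S, ∃ ξ ∈ S', Φ ξ = x := fun x hx =>
    ⟨Φ.symm x, by rw [hS', mem_preimage, Φ.apply_symm_apply]; exact hx, Φ.apply_symm_apply x⟩
  have hG := hS.gen.comp_affine hS.isOpen_dom hlam.le hLam y0 T one_pos
  set κ : ℝ := LinearMap.det (T : Euc n →ₗ[ℝ] Euc n) ^ 2 * (1:ℝ) ^ (q - n) with hκ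
  have hκpos : 0 < κ := by
    rw [hκ, Real.one_rpow, mul_one]
    have : LinearMap.det (T : Euc n →ₗ[ℝ] Euc n) ≠ 0 :=
      (LinearEquiv.isUnit_det' T.toLinearEquiv).ne_zero
    positivity
  have hv : (fun ξ => v (y0 + T ξ) / 1) = fun ξ => v (Φ ξ) := by ext; simp [hΦa]
  rw [hv] at hG
  have hsec : IsSection n q (lam * κ) (Lam * κ) {ξ | y0 + T ξ ∈ Ω} (fun ξ => v (Φ ξ)) S'
      (a + ⟪p, y0⟫) (Ts p) M0 :=
    { isOpen_dom := hS.isOpen_dom.preimage Φ.continuous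
      gen := hG
      isOpen := hS.isOpen.preimage Φ.continuous
      convex := by
        intro x hx y hy s t hs ht hst
        have := hS.convex hx hy hs ht hst
        change Φ _ ∈ S
        convert this using 1
        simp only [hΦa, map_add, map_smul, smul_add]
        rw [add_add_add_comm, ← add_smul, hst, one_smul]
      isCompact := by
        rw [hcl, ← Φ.image_symm]
        exact hS.isCompact.image Φ.symm.continuous
      subset := by
        rw [hcl]
        exact fun x hx => hS.subset hx
      lt := fun x hx => by rw [hl]; exact hS.lt _ hx
      bdry := fun x hx hxS => by
        rw [hl]; rw [hcl] at hx; exact hS.bdry _ hx hxS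
      depth := fun x hx => by rw [hl]; exact hS.depth _ hx }
  have hΦ0 : Φ 0 = y0 := by rw [hΦa]; simp
  refine H (lam * κ) (Lam * κ) {ξ | y0 + T ξ ∈ Ω} (fun ξ => v (Φ ξ)) S' (a + ⟪p, y0⟫) (Ts p) M0
    0 (Ts u) z d W (by positivity) (by positivity) (by nlinarith) hsec ?_ ?_ ?_ ?_ hW ?_ ?_ hdW ?_
  · have h1 : ball z (1 / ((n : ℝ) + 1) ^ 2) ⊆ Φ ⁻¹' closure S := hT2
    rw [← hcl] at h1
    have h2 := interior_mono h1
    rw [isOpen_ball.interior_eq, hcl, ← Φ.preimage_interior, hintcl] at h2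
    exact h2
  · intro ξ hξ
    rw [mem_closedBall_zero_iff]
    have := hT1 _ (subset_closure (show Φ ξ ∈ S from hξ))
    rwa [← hΦs, Φ.symm_apply_apply] at this
  · change Φ 0 ∈ S
    rw [hΦ0]; exact hy0
  · rw [hl, hΦ0]; exact hM0
  · intro ξ hξ
    have := hud _ (show Φ ξ ∈ S from hξ)
    rwa [sub_zero, hTsa, ← add_sub_cancel_left y0 (T ξ)]
  · obtain ⟨x, hx, hxW⟩ := hW'
    obtain ⟨ξ, hξ, rfl⟩ := hsurj x hx
    refine ⟨ξ, hξ, ?_⟩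
    rwa [sub_zero, hTsa, ← add_sub_cancel_left y0 (T ξ)]
  · rcases hfat with ⟨x, hx, hxl⟩ | ⟨P, β, D, hD, h1, ⟨x, hx, h2⟩, h3⟩
    · obtain ⟨ξ, hξ, rfl⟩ := hsurj x hx
      exact Or.inl ⟨ξ, hξ, by rw [hl]; exact hxl⟩
    · refine Or.inr ⟨Ts P, β - ⟪P, y0⟫, D, hD, ?_, ?_, ?_⟩
      · intro ξ hξ h0
        have := h1 (Φ ξ) hξ h0
        rw [← hin] at this
        linarith
      · obtain ⟨ξ, hξ, rfl⟩ := hsurj x hx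
        refine ⟨ξ, hξ, ?_⟩
        rw [← hin] at h2
        linarith
      · intro ξ hξ
        have := h3 (Φ ξ) hξ
        rw [← hin] at this
        constructor <;> linarith

/-- A normalized configuration: the part of the coincidence set below the level `⟪φ, x⟫ = 1` is
comparable to a ball, and `0` is one of its lowest points. -/
structure Conf (n : ℕ) (q lam Lam ρ R : ℝ) (Ω : Set (Euc n)) (v : Euc n → ℝ) (φ : Euc n) :
    Prop where
  isOpen : IsOpen Ω
  gen : GenSol n q lam Lam Ω v
  zero_mem : (0 : Euc n) ∈ Ω
  v_zero : v 0 = 0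
  nonneg : ∀ x ∈ Ω, v x = 0 → 0 ≤ ⟪φ, x⟫
  compact : IsCompact {x | x ∈ Ω ∧ v x ≤ 1 ∧ ⟪φ, x⟫ ≤ 1}
  inner_ball : ∃ z : Euc n, ∀ x ∈ ball z ρ, x ∈ Ω ∧ v x = 0 ∧ ⟪φ, x⟫ ≤ 1
  bdd : ∀ x ∈ Ω, v x = 0 → ⟪φ, x⟫ ≤ 1 → ‖x‖ ≤ R
  top : ∃ x ∈ Ω, v x = 0 ∧ ⟪φ, x⟫ = 1

/-- The set where `v` lies below both `1` and an affine function, below the level `τ`. -/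
def cutSet {n : ℕ} (Ω : Set (Euc n)) (v : Euc n → ℝ) (φ : Euc n) (τ a : ℝ) (p : Euc n) :
    Set (Euc n) :=
  {x | x ∈ Ω ∧ v x < 1 ∧ ⟪φ, x⟫ < τ ∧ v x < a + ⟪p, x⟫}

namespace Conf

variable {n : ℕ} {q lam Lam ρ R : ℝ} {Ω : Set (Euc n)} {v : Euc n → ℝ} {φ : Euc n}

theorem convexOn (h : Conf n q lam Lam ρ R Ω v φ) : ConvexOn ℝ Ω v := h.gen.2.1

theorem v_nonneg (h : Conf n q lam Lam ρ R Ω v φ) {x : Euc n} (hx : x ∈ Ω) : 0 ≤ v x :=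
  h.gen.2.2.1 x hx

theorem norm_le (h : Conf n q lam Lam ρ R Ω v φ) (hρ : 0 < ρ) : ρ * ‖φ‖ ≤ 1 := by
  obtain ⟨z, hz⟩ := h.inner_ball
  refine norm_le_of_inner_le hρ fun w hw => ?_
  have h1 := hz z (mem_ball_self hρ)
  have h2 := h.nonneg z h1.1 h1.2.1
  have h3 := (hz (z + w) (by simpa using hw)).2.2
  rw [inner_add_right] at h3
  linarith

theorem one_le_norm (h : Conf n q lam Lam ρ R Ω v φ) : 1 ≤ ‖φ‖ * R := by
  obtain ⟨k, hk, hk0, hk1⟩ := h.top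
  have h1 := h.bdd k hk hk0 hk1.le
  calc 1 = ⟪φ, k⟫ := hk1.symm
    _ ≤ ‖φ‖ * ‖k‖ := real_inner_le_norm _ _
    _ ≤ _ := by gcongr

theorem isOpen_cutSet (h : Conf n q lam Lam ρ R Ω v φ) (τ a : ℝ) (p : Euc n) :
    IsOpen (cutSet Ω v φ τ a p) := by
  have hc : ContinuousOn (fun x => a + ⟪p, x⟫ - v x) Ω :=
    (by fun_prop : Continuous fun x => a + ⟪p, x⟫).continuousOn.sub h.gen.1
  have h1 := h.gen.1.isOpen_inter_preimage h.isOpen (isOpen_Iio (a := (1:ℝ)))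
  have h2 := hc.isOpen_inter_preimage h.isOpen (isOpen_Ioi (a := (0:ℝ)))
  have h3 : IsOpen {x : Euc n | ⟪φ, x⟫ < τ} := isOpen_lt (by fun_prop) continuous_const
  convert (h1.inter h2).inter h3 using 1
  ext x
  simp only [cutSet, mem_ofPred_eq, mem_inter_iff, mem_preimage, mem_Iio, mem_Ioi, sub_pos]
  tauto

theorem convex_cutSet (h : Conf n q lam Lam ρ R Ω v φ) (τ a : ℝ) (p : Euc n) :
    Convex ℝ (cutSet Ω v φ τ a p) := by
  rintro x ⟨hx1, hx2, hx3, hx4⟩ y ⟨hy1, hy2, hy3, hy4⟩ s t hs ht hst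
  have hv := h.convexOn.2 hx1 hy1 hs ht hst
  simp only [smul_eq_mul] at hv
  have key : ∀ {b c d e : ℝ}, b < d → c < e → s * b + t * c < s * d + t * e := by
    intro b c d e hbd hce
    rcases hs.eq_or_lt with rfl | hs'
    · have : t = 1 := by linarith
      subst this; linarith
    · have := mul_lt_mul_of_pos_left hbd hs'
      have := mul_le_mul_of_nonneg_left hce.le ht
      linarith
  refine ⟨h.convexOn.1 hx1 hy1 hs ht hst, ?_, ?_, ?_⟩
  · have := key hx2 hy2
    linarith
  · rw [inner_add_right, inner_smul_right, inner_smul_right]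
    have := key hx3 hy3
    have e : s * τ + t * τ = (s + t) * τ := by ring
    rw [hst] at e; linarith
  · rw [inner_add_right, inner_smul_right, inner_smul_right]
    have := key hx4 hy4
    have e : s * (a + ⟪p, x⟫) + t * (a + ⟪p, y⟫) = (s + t) * a + (s * ⟪p, x⟫ + t * ⟪p, y⟫) := by
      ring
    rw [hst] at e; linarith

theorem closure_cutSet (h : Conf n q lam Lam ρ R Ω v φ) {τ : ℝ} (hτ : τ ≤ 1) (a : ℝ)
    (p : Euc n) {x : Euc n} (hx : x ∈ closure (cutSet Ω v φ τ a p)) :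
    x ∈ Ω ∧ v x ≤ 1 ∧ ⟪φ, x⟫ ≤ τ ∧ v x ≤ a + ⟪p, x⟫ := by
  have h1 : closure (cutSet Ω v φ τ a p) ⊆ {x | x ∈ Ω ∧ v x ≤ 1 ∧ ⟪φ, x⟫ ≤ 1} :=
    closure_minimal (fun y hy => ⟨hy.1, hy.2.1.le, hy.2.2.1.le.trans hτ⟩) h.compact.isClosed
  have h2 : closure (cutSet Ω v φ τ a p) ⊆ {x | ⟪φ, x⟫ ≤ τ} :=
    closure_minimal (fun y hy => hy.2.2.1.le) (isClosed_le (by fun_prop) continuous_const)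
  refine ⟨(h1 hx).1, (h1 hx).2.1, h2 hx, ?_⟩
  have hcont : ContinuousWithinAt (fun y => a + ⟪p, y⟫ - v y) (cutSet Ω v φ τ a p) x :=
    (((by fun_prop : Continuous fun x => a + ⟪p, x⟫).continuousOn.sub h.gen.1) x
      (h1 hx).1).mono fun y hy => hy.1
  have := hcont.mem_closure hx (t := Ici 0) (fun y hy => by
    have := hy.2.2.2
    simp only [mem_Ici, sub_nonneg]; exact this.le)
  rw [isClosed_Ici.closure_eq] at this
  simpa using this

theorem isSection_cutSet (h : Conf n q lam Lam ρ R Ω v φ) {τ : ℝ} (hτ : τ ≤ 1) {a : ℝ}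
    {p : Euc n} {M0 : ℝ}
    (hb : ∀ x ∈ closure (cutSet Ω v φ τ a p), v x < a + ⟪p, x⟫ → v x < 1 ∧ ⟪φ, x⟫ < τ)
    (hd : ∀ x ∈ cutSet Ω v φ τ a p, a + ⟪p, x⟫ - v x ≤ M0) :
    IsSection n q lam Lam Ω v (cutSet Ω v φ τ a p) a p M0 where
  isOpen_dom := h.isOpen
  gen := h.gen
  isOpen := h.isOpen_cutSet _ _ _
  convex := h.convex_cutSet _ _ _
  isCompact := h.compact.of_isClosed_subset isClosed_closure fun x hx =>
    ⟨(h.closure_cutSet hτ a p hx).1, (h.closure_cutSet hτ a p hx).2.1,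
      (h.closure_cutSet hτ a p hx).2.2.1.trans hτ⟩
  subset := fun x hx => (h.closure_cutSet hτ a p hx).1
  lt := fun x hx => hx.2.2.2
  bdry := fun x hx hxS => by
    by_contra hlt
    push Not at hlt
    exact hxS ⟨(h.closure_cutSet hτ a p hx).1, (hb x hx hlt).1, (hb x hx hlt).2, hlt⟩
  depth := hd

end Conf

/-- The exponent of the nondegeneracy estimate. -/
def ndExp (n : ℕ) (q : ℝ) : ℝ := 2 * n / (n - q)

theorem conf_lower_bound (n : ℕ) {q lam ρ : ℝ} (hq0 : 0 ≤ q) (hqn : q < n) (hlam : 0 < lam)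
    (hρ : 0 < ρ) {R1 : ℝ} (hR1 : 0 ≤ R1) :
    ∃ c : ℝ, 0 < c ∧ ∀ (Lam R : ℝ) (Ω : Set (Euc n)) (v : Euc n → ℝ) (φ : Euc n),
      Conf n q lam Lam ρ R Ω v φ → ∀ z, (∀ x ∈ ball z ρ, x ∈ Ω ∧ v x = 0 ∧ ⟪φ, x⟫ ≤ 1) →
      ∀ x ∈ Ω, ⟪φ, x⟫ ≤ 1 → ‖x - z‖ ≤ R1 → ∀ δ, 0 < δ → δ ≤ 1 →
      (∀ k ∈ Ω, v k = 0 → ⟪φ, k⟫ ≤ 1 → δ ≤ ‖k - x‖) → c * δ ^ ndExp n q ≤ v x := by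
  obtain ⟨cnd, hcnd, hND⟩ := nondegeneracy n hq0 hqn
  have hnq : (0:ℝ) < n - q := by linarith
  set D : ℝ := 2 * (R1 + ρ) + 2 with hD
  have hDpos : 0 < D := by positivity
  refine ⟨(lam * cnd * (ρ / D) ^ (2 * n)) ^ (1 / ((n:ℝ) - q)), by positivity, ?_⟩
  intro Lam R Ω v φ hC z hz x hx hφx hxz δ hδ hδ1 hK
  set θ := δ / D with hθ
  have hθpos : 0 < θ := by positivity
  have hθ1 : θ ≤ 1 := by rw [hθ, div_le_one hDpos, hD]; linarith
  have key : ∀ w ∈ ball (x + θ • (z - x)) (θ * ρ), w ∈ Ω ∧ 0 < v w ∧ v w ≤ v x := by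
    intro w hw
    rw [mem_ball, dist_eq_norm] at hw
    set w' := z + θ⁻¹ • (w - (x + θ • (z - x))) with hw'
    have hw'm : w' ∈ ball z ρ := by
      rw [mem_ball, dist_eq_norm, hw', add_sub_cancel_left, norm_smul, norm_inv,
        Real.norm_of_nonneg hθpos.le, inv_mul_lt_iff₀ hθpos]
      exact hw
    obtain ⟨h1, h2, h3⟩ := hz w' hw'm
    have hwe : w = (1 - θ) • x + θ • w' := by
      rw [hw', smul_add, smul_smul, mul_inv_cancel₀ hθpos.ne', one_smul, smul_sub, sub_smul,
        one_smul]
      abel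
    have hwΩ : w ∈ Ω := by
      rw [hwe]; exact hC.convexOn.1 hx h1 (sub_nonneg.2 hθ1) hθpos.le (by ring)
    have hwv : v w ≤ v x := by
      have := hC.convexOn.2 hx h1 (sub_nonneg.2 hθ1) hθpos.le (by ring)
      rw [← hwe, h2] at this
      simp only [smul_eq_mul] at this
      have := mul_nonneg hθpos.le (hC.v_nonneg hx)
      linarith
    refine ⟨hwΩ, (hC.v_nonneg hwΩ).lt_of_ne' fun h0 => ?_, hwv⟩
    have hφw : ⟪φ, w⟫ ≤ 1 := by
      rw [hwe, inner_add_right, inner_smul_right, inner_smul_right]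
      have h4 : (1 - θ) * ⟪φ, x⟫ ≤ (1 - θ) * 1 :=
        mul_le_mul_of_nonneg_left hφx (sub_nonneg.2 hθ1)
      have h5 := mul_le_mul_of_nonneg_left h3 hθpos.le
      linarith
    have h6 := hK w hwΩ h0 hφw
    have h7 : ‖w - x‖ ≤ θ * ρ + θ * R1 := by
      have e : w - x = (w - (x + θ • (z - x))) + θ • (z - x) := by abel
      rw [e]
      refine (norm_add_le _ _).trans ?_
      rw [norm_smul, Real.norm_of_nonneg hθpos.le, norm_sub_rev z x]
      gcongr
    have h8 : θ * ρ + θ * R1 < δ := by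
      have : θ * D = δ := by rw [hθ]; field_simp
      rw [hD] at this
      nlinarith
    linarith
  have hb : ball (x + θ • (z - x)) (θ * ρ) ⊆ Ω := fun w hw => (key w hw).1
  have h1 := hND lam Lam Ω v _ (θ * ρ) (v x) hlam.le hC.isOpen hC.gen (by positivity) hb
    (fun w hw => (key w hw).2)
  have h2 : θ * ρ = (ρ / D) * δ := by rw [hθ]; ring
  rw [h2, mul_pow, ← mul_assoc] at h1
  have h3 := Real.rpow_le_rpow (by positivity) h1 (one_div_pos.2 hnq).le
  rw [← Real.rpow_mul (hC.v_nonneg hx), mul_one_div_cancel hnq.ne', Real.rpow_one,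
    Real.mul_rpow (by positivity) (by positivity)] at h3
  refine le_trans (le_of_eq ?_) h3
  congr 1
  rw [← Real.rpow_natCast, ← Real.rpow_mul hδ.le, ndExp]
  congr 1
  push_cast
  ring

theorem conf_bounded (n : ℕ) {q lam ρ R : ℝ} (hq0 : 0 ≤ q) (hqn : q < n) (hlam : 0 < lam)
    (hρ : 0 < ρ) (hR : 0 < R) :
    ∃ C : ℝ, 1 ≤ C ∧ ∀ (Lam : ℝ) (Ω : Set (Euc n)) (v : Euc n → ℝ) (φ : Euc n),
      Conf n q lam Lam ρ R Ω v φ → ∀ x ∈ Ω, v x ≤ 1 → ⟪φ, x⟫ ≤ 1 → ‖x‖ ≤ C := by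
  obtain ⟨c, hc, H⟩ := conf_lower_bound n hq0 hqn hlam hρ (R1 := 2 * R + 1) (by positivity)
  refine ⟨1 + R + (2 * R + 1) + (2 * R + 1) / c, by
    have : 0 < (2 * R + 1) / c := by positivity
    linarith, ?_⟩
  intro Lam Ω v φ hC x hx hvx hφx
  obtain ⟨z, hz⟩ := hC.inner_ball
  have hz0 := hz z (mem_ball_self hρ)
  have hzR := hC.bdd z hz0.1 hz0.2.1 hz0.2.2
  have hpos : 0 < (2 * R + 1) / c := by positivity
  have hxz : ‖x‖ ≤ ‖x - z‖ + R := by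
    have := norm_add_le (x - z) z
    rw [sub_add_cancel] at this
    linarith
  by_cases hfar : ‖x - z‖ ≤ 2 * R + 1
  · linarith
  push Not at hfar
  set L := ‖x - z‖ with hL
  have hLpos : 0 < L := by linarith
  set τ := (2 * R + 1) / L with hτ
  have hτpos : 0 < τ := by positivity
  have hτ1 : τ ≤ 1 := by rw [hτ, div_le_one hLpos]; exact hfar.le
  set y := (1 - τ) • z + τ • x with hy
  have hyz : ‖y - z‖ = 2 * R + 1 := by
    have : y - z = τ • (x - z) := by rw [hy, sub_smul, one_smul, smul_sub]; abel
    rw [this, norm_smul, Real.norm_of_nonneg hτpos.le, ← hL, hτ]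
    field_simp
  have hyΩ : y ∈ Ω := hC.convexOn.1 hz0.1 hx (sub_nonneg.2 hτ1) hτpos.le (by ring)
  have hyv : v y ≤ τ := by
    have := hC.convexOn.2 hz0.1 hx (sub_nonneg.2 hτ1) hτpos.le (by ring)
    rw [← hy, hz0.2.1] at this
    simp only [smul_eq_mul] at this
    have := mul_le_mul_of_nonneg_left hvx hτpos.le
    linarith
  have hyφ : ⟪φ, y⟫ ≤ 1 := by
    rw [hy, inner_add_right, inner_smul_right, inner_smul_right]
    have h4 : (1 - τ) * ⟪φ, z⟫ ≤ (1 - τ) * 1 :=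
      mul_le_mul_of_nonneg_left hz0.2.2 (sub_nonneg.2 hτ1)
    have h5 := mul_le_mul_of_nonneg_left hφx hτpos.le
    linarith
  have h1 := H Lam R Ω v φ hC z hz y hyΩ hyφ hyz.le 1 one_pos le_rfl (by
    intro k hk hk0 hk1
    have h2 := hC.bdd k hk hk0 hk1
    have h3 := norm_sub_le k z
    have h4 := norm_sub_le (k - y) (k - z)
    rw [sub_sub_sub_cancel_left, norm_sub_rev z y, hyz] at h4
    linarith)
  rw [Real.one_rpow, mul_one] at h1
  have h2 : c ≤ (2 * R + 1) / L := h1.trans hyv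
  have h3 : L ≤ (2 * R + 1) / c := by
    rw [le_div_iff₀ hLpos] at h2
    rw [le_div_iff₀ hc]; linarith
  linarith

theorem conf_upper_bound (n : ℕ) {q lam Lam ρ R : ℝ} (hq0 : 0 ≤ q) (hqn : q < n)
    (hlam : 0 < lam) (hLam : 0 < Lam) (hρ : 0 < ρ) (hR : 0 < R) :
    ∃ d0 : ℝ, 0 < d0 ∧ ∀ (Ω : Set (Euc n)) (v : Euc n → ℝ) (φ : Euc n),
      Conf n q lam Lam ρ R Ω v φ → ∀ y ∈ Ω, v y = 0 → ⟪φ, y⟫ ≤ 1 / 2 →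
      ∀ w : Euc n, ‖w‖ ≤ d0 → y + w ∈ Ω ∧ ⟪φ, y + w⟫ ≤ 1 ∧ v (y + w) ≤ ‖w‖ / d0 := by
  obtain ⟨C, hC1, HC⟩ := conf_bounded n hq0 hqn hlam hρ hR
  have hCpos : 0 < C := by linarith
  set c : ℝ := 1 / (2 * (1 + C / ρ)) with hc
  have hcpos : 0 < c := by positivity
  set D : ℝ := 2 * C + 1 with hD
  have hDpos : 0 < D := by positivity
  set X : ℝ := 2 / D * (2 * D ^ 2) ^ n * Lam with hX
  have hXpos : 0 < X := by positivity
  set d1 : ℝ := min D ((c / 2) ^ n / (2 * X)) with hd1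
  have hd1pos : 0 < d1 := lt_min hDpos (by positivity)
  refine ⟨d1 / 2, by positivity, ?_⟩
  intro Ω v φ hC y hy hy0 hφy
  set S := cutSet Ω v φ 1 c (-(c • φ)) with hS
  have hl : ∀ x, c + ⟪-(c • φ), x⟫ = c * (1 - ⟪φ, x⟫) := fun x => by
    rw [inner_neg_left, inner_smul_left]; simp only [conj_trivial]; ring
  have hφn : ‖φ‖ ≤ 1 / ρ := by rw [le_div_iff₀ hρ, mul_comm]; exact hC.norm_le hρ
  have hlle : ∀ x, ‖x‖ ≤ C → c * (1 - ⟪φ, x⟫) ≤ 1 / 2 := by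
    intro x hx
    have h1 := (abs_le.1 (abs_real_inner_le_norm φ x)).1
    have h2 : ‖φ‖ * ‖x‖ ≤ 1 / ρ * C := by gcongr
    have h3 : c * (1 - ⟪φ, x⟫) ≤ c * (1 + C / ρ) := by
      gcongr
      rw [one_div_mul_eq_div] at h2; linarith
    have h4 : c * (1 + C / ρ) = 1 / 2 := by rw [hc]; field_simp
    linarith
  have hsec : IsSection n q lam Lam Ω v S c (-(c • φ)) 1 := by
    refine hC.isSection_cutSet le_rfl ?_ ?_
    · intro x hx hlt
      have h1 := hC.closure_cutSet le_rfl _ _ hx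
      rw [hl] at hlt
      have h2 := hlle x (HC Lam Ω v φ hC x h1.1 h1.2.1 h1.2.2.1)
      refine ⟨by linarith, ?_⟩
      have h3 := hC.v_nonneg h1.1
      by_contra h4
      push Not at h4
      have : c * (1 - ⟪φ, x⟫) ≤ 0 := mul_nonpos_of_nonneg_of_nonpos hcpos.le (by linarith)
      linarith
    · intro x hx
      rw [hl]
      have h2 := hlle x (HC Lam Ω v φ hC x hx.1 hx.2.1.le hx.2.2.1.le)
      have h3 := hC.v_nonneg hx.1
      linarith
  have hyS : y ∈ S := ⟨hy, by rw [hy0]; norm_num, by linarith, by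
    rw [hl, hy0]; exact mul_pos hcpos (by linarith)⟩
  have hball : ball y d1 ⊆ S := by
    intro x hx
    by_contra hxS
    obtain ⟨f, hf⟩ := geometric_hahn_banach_open_point hsec.convex hsec.isOpen hxS
    set u0 := (InnerProductSpace.toDual ℝ (Euc n)).symm f with hu0
    have hfu : ∀ w, f w = ⟪u0, w⟫ := fun w => by
      rw [hu0, InnerProductSpace.toDual_symm_apply]
    have hxy : f y < f x := hf y hyS
    have hune : 0 < ‖u0‖ := by
      rw [norm_pos_iff]; rintro h0
      rw [hfu, hfu, h0] at hxy; simp at hxy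
    have hxyne : 0 < ‖x - y‖ := by
      rw [norm_pos_iff]; rintro h0
      rw [sub_eq_zero.1 h0] at hxy; exact lt_irrefl _ hxy
    rw [mem_ball, dist_eq_norm] at hx
    have h1 := alexandrov_estimate hq0 hLam.le hC.gen hsec.isOpen hsec.isCompact hsec.subset c
      (-(c • φ)) hsec.bdry hyS (h0 := c / 2) (by positivity) (by
        rw [hl, hy0]
        have : c * (1 / 2) ≤ c * (1 - ⟪φ, y⟫) := by gcongr; linarith
        linarith) (D := D) (d := ‖x - y‖) (L := 1) (fun s hs => by
        rw [mem_ball, dist_eq_norm]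
        have h2 := HC Lam Ω v φ hC s hs.1 hs.2.1.le hs.2.2.1.le
        have h3 := HC Lam Ω v φ hC y hy (by rw [hy0]; norm_num) (by linarith)
        have := norm_sub_le s y
        linarith) (u := ‖u0‖⁻¹ • u0) (by
          rw [norm_smul, norm_inv, norm_norm, inv_mul_cancel₀ hune.ne'])
      hxyne (hx.le.trans (min_le_left _ _)) (fun s hs => by
        rw [inner_smul_left]
        simp only [conj_trivial]
        rw [inv_mul_le_iff₀ hune]
        have h2 := hf s hs
        rw [hfu, hfu] at h2
        refine le_trans ?_ (real_inner_le_norm u0 (x - y))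
        rw [inner_sub_right, inner_sub_right]
        linarith) (fun s hs => hs.2.1.le)
    rw [Real.one_rpow, mul_one] at h1
    have h2 : 2 * ‖x - y‖ / D * (2 * D ^ 2) ^ n * Lam = X * ‖x - y‖ := by rw [hX]; ring
    rw [h2] at h1
    have h3 : ‖x - y‖ < (c / 2) ^ n / (2 * X) := hx.trans_le (min_le_right _ _)
    rw [lt_div_iff₀ (by positivity)] at h3
    have h4 : 0 < (c / 2) ^ n := by positivity
    linarith
  intro w hw
  have hwS : y + w ∈ S := hball (by rw [mem_ball, dist_eq_norm, add_sub_cancel_left]; linarith)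
  refine ⟨hwS.1, hwS.2.2.1.le, ?_⟩
  by_cases hw0 : w = 0
  · simp [hw0, hy0]
  have hwpos : 0 < ‖w‖ := norm_pos_iff.2 hw0
  set t := ‖w‖ / (d1 / 2) with ht
  have htpos : 0 < t := by positivity
  have ht1 : t ≤ 1 := by rw [ht, div_le_one (by positivity)]; exact hw
  have hw' : y + t⁻¹ • w ∈ S := hball (by
    rw [mem_ball, dist_eq_norm, add_sub_cancel_left, norm_smul, norm_inv,
      Real.norm_of_nonneg htpos.le, ht]
    field_simp
    linarith)
  have := hC.convexOn.2 hy hw'.1 (sub_nonneg.2 ht1) htpos.le (by ring)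
  have e : (1 - t) • y + t • (y + t⁻¹ • w) = y + w := by
    rw [smul_add, smul_smul, mul_inv_cancel₀ htpos.ne', one_smul, sub_smul, one_smul]; abel
  rw [e, hy0] at this
  simp only [smul_eq_mul] at this
  have h5 := mul_le_mul_of_nonneg_left hw'.2.1.le htpos.le
  linarith

set_option maxHeartbeats 2000000 in
theorem conf_rigidity (n : ℕ) {q lam Lam ρ R : ℝ} (hq0 : 0 ≤ q) (hqn : q < n)
    (hlam : 0 < lam) (hLam : 0 < Lam) (hρ : 0 < ρ) (hR : 0 < R) {B δ1 : ℝ} (hB : 1 ≤ B)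
    (hδ1 : 0 < δ1) :
    ∃ ε : ℝ, 0 < ε ∧ ∀ (Ω : Set (Euc n)) (v : Euc n → ℝ) (φ y P Q a : Euc n),
      Conf n q lam Lam ρ R Ω v φ → y ∈ Ω → v y = 0 → ⟪φ, y⟫ ≤ 1 / 2 → ‖P‖ ≤ B → ‖Q‖ ≤ B →
      1 ≤ B * ‖P‖ →
      (∀ x ∈ Ω, v x = 0 → ⟪φ, x⟫ ≤ 1 → ⟪P, x - y⟫ ≤ ε ∧ ⟪Q, x - y⟫ ≤ ε) →
      a ∈ Ω → v a = 0 → ⟪φ, a⟫ ≤ 1 → -ε ≤ ⟪P, a - y⟫ → ⟪Q, a - y⟫ ≤ -1 →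
      (∀ x ∈ Ω, v x ≤ 1 → ⟪φ, x⟫ ≤ 1 → -(1 / 2) ≤ ⟪Q, x - y⟫ → -δ1 ≤ ⟪P, x - y⟫ →
        ⟪φ, x⟫ ≤ 3 / 4) → False := by
  obtain ⟨C, hC1, HC⟩ := conf_bounded n hq0 hqn hlam hρ hR
  obtain ⟨d0, hd0, HU⟩ := conf_upper_bound n hq0 hqn hlam hLam hρ hR
  have hCpos : 0 < C := by linarith
  have hBpos : 0 < B := by linarith
  obtain ⟨c, hc, HL⟩ := conf_lower_bound n hq0 hqn hlam hρ (R1 := 2 * C) (by positivity)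
  obtain ⟨ε1, hε1, HS⟩ := section_lemma n hq0 hqn (ratio := Lam / lam) (C1 := 3) (k := 14)
    (by positivity) (by norm_num) (by norm_num)
  obtain ⟨W, hWpos, hWBC⟩ : ∃ W : ℝ, 0 < W ∧ W * (16 * B * C) = 1 :=
    ⟨1 / (16 * B * C), by positivity, by field_simp⟩
  have hW1 : W ≤ 1 / 16 := by nlinarith [mul_le_mul hB hC1 zero_le_one hBpos.le]
  obtain ⟨m, hm, hm1, hm2, hm3⟩ :
      ∃ m : ℝ, 0 < m ∧ 8 * m ≤ 1 ∧ 24 * m ≤ δ1 ∧ 4 * m ≤ ε1 * W := by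
    refine ⟨min (1 / 8) (min (δ1 / 24) (ε1 * W / 4)), by positivity, ?_, ?_, ?_⟩
    · have := min_le_left (1 / 8) (min (δ1 / 24) (ε1 * W / 4)); linarith
    · have := (min_le_right (1 / 8) (min (δ1 / 24) (ε1 * W / 4))).trans (min_le_left _ _)
      linarith
    · have := (min_le_right (1 / 8) (min (δ1 / 24) (ε1 * W / 4))).trans (min_le_right _ _)
      linarith
  obtain ⟨δ, hδ, hδm⟩ : ∃ δ : ℝ, 0 < δ ∧ B * δ = m := ⟨m / B, by positivity, by field_simp⟩
  have hδ1' : δ ≤ 1 := by nlinarith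
  set E : ℝ := 2 + 8 * B * C with hE
  have hEpos : 0 < E := by positivity
  obtain ⟨h, hh, hh1, hh2⟩ : ∃ h : ℝ, 0 < h ∧ 4 * h ≤ 1 ∧ h * E < c * δ ^ ndExp n q := by
    have hX : 0 < c * δ ^ ndExp n q := by positivity
    refine ⟨min (1 / 4) (c * δ ^ ndExp n q / (2 * E)), by positivity, ?_, ?_⟩
    · have := min_le_left (1 / 4) (c * δ ^ ndExp n q / (2 * E)); linarith
    · have h1 := min_le_right (1 / 4) (c * δ ^ ndExp n q / (2 * E))
      rw [le_div_iff₀ (by positivity)] at h1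
      linarith
  obtain ⟨t, ht, ht1, ht2⟩ : ∃ t : ℝ, 0 < t ∧ 8 * (t * B ^ 2) ≤ 1 ∧ 4 * (t * B) ≤ d0 := by
    refine ⟨min (1 / (8 * B ^ 2)) (d0 / (4 * B)), by positivity, ?_, ?_⟩
    · have := min_le_left (1 / (8 * B ^ 2)) (d0 / (4 * B))
      rw [le_div_iff₀ (by positivity)] at this; linarith
    · have := min_le_right (1 / (8 * B ^ 2)) (d0 / (4 * B))
      rw [le_div_iff₀ (by positivity)] at this; linarith
  set c1 : ℝ := t / B ^ 2 with hc1
  have hc1pos : 0 < c1 := by positivity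
  obtain ⟨ε, hε, hεm, hεc⟩ : ∃ ε : ℝ, 0 < ε ∧ ε ≤ m ∧ 6 * ε ≤ c1 * h := by
    refine ⟨min m (c1 * h / 6), by positivity, min_le_left _ _, ?_⟩
    have := min_le_right m (c1 * h / 6); linarith
  refine ⟨ε, hε, ?_⟩
  intro Ω v φ y P Q a hC hy hy0 hφy hPB hQB hPB' hK ha ha0 hφa hPa hQa hloc
  have hHC := HC Lam Ω v φ hC
  have hyC : ‖y‖ ≤ C := hHC y hy (by rw [hy0]; norm_num) (by linarith)
  have haC : ‖a‖ ≤ C := hHC a ha (by rw [ha0]; norm_num) hφa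
  have hinn : ∀ (F : Euc n), ‖F‖ ≤ B → ∀ x, ‖x‖ ≤ C → |⟪F, x - y⟫| ≤ B * (2 * C) := by
    intro F hF x hx
    refine (abs_real_inner_le_norm _ _).trans ?_
    have := norm_sub_le x y
    gcongr
    linarith
  set p : ℝ → Euc n := fun s => h • (s • P + (4:ℝ) • Q) with hp
  set b : ℝ → ℝ := fun s => h - ⟪p s, y⟫ with hb
  have hl : ∀ s x, b s + ⟪p s, x⟫ = h * (1 + s * ⟪P, x - y⟫ + 4 * ⟪Q, x - y⟫) := by
    intro s x
    simp only [hb, hp, inner_smul_left, inner_add_left, inner_sub_right, conj_trivial]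
    ring
  set S : ℝ → Set (Euc n) := fun s => cutSet Ω v φ 1 (b s) (p s) with hS
  have hyS : ∀ s, y ∈ S s := fun s => ⟨hy, by rw [hy0]; norm_num, by linarith, by
    rw [hl, hy0]; simp; exact hh⟩
  -- an inner point
  set w : Euc n := (t * h) • P with hw
  have hτ : 0 < t * h := by positivity
  have hwn : ‖w‖ ≤ t * h * B := by
    rw [hw, norm_smul, Real.norm_of_nonneg hτ.le]; gcongr
  have htB : t * h * B ≤ d0 / 4 * h := by nlinarith
  have hw2 := HU Ω v φ hC y hy hy0 hφy ((2:ℝ) • w) (by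
    rw [norm_smul, Real.norm_of_nonneg (by norm_num)]; nlinarith)
  have hw1 := HU Ω v φ hC y hy hy0 hφy w (by nlinarith)
  have hPw : c1 * h ≤ ⟪P, w⟫ := by
    rw [hw, inner_smul_right, real_inner_self_eq_norm_sq]
    have h1 : 1 ≤ B ^ 2 * ‖P‖ ^ 2 := by rw [← mul_pow]; exact one_le_pow₀ hPB'
    have h2 : c1 * h * (B ^ 2 * ‖P‖ ^ 2) = t * h * ‖P‖ ^ 2 := by rw [hc1]; field_simp
    rw [← h2]
    exact le_mul_of_one_le_right (by positivity) h1
  have hwS : ∀ s, 0 ≤ s → y + w ∈ S s := by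
    intro s hs
    have hvw : v (y + w) ≤ h / 4 := by
      refine hw1.2.2.trans ?_
      rw [div_le_iff₀ hd0]; linarith
    refine ⟨hw1.1, by linarith, ?_, ?_⟩
    · have h1 := hw2.2.1
      rw [inner_add_right, inner_smul_right] at h1
      rw [inner_add_right]; linarith
    · rw [hl, add_sub_cancel_left]
      have h1 := (abs_le.1 (abs_real_inner_le_norm Q w)).1
      have h2 : ‖Q‖ * ‖w‖ ≤ B * (t * h * B) := by gcongr
      have h3 : B * (t * h * B) ≤ h / 8 := by
        calc B * (t * h * B) = (t * B ^ 2) * h := by ring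
          _ ≤ 1 / 8 * h := by gcongr; linarith
          _ = h / 8 := by ring
      have h4 : 0 ≤ s * ⟪P, w⟫ := mul_nonneg hs ((by positivity : 0 ≤ c1 * h).trans hPw)
      have h5 : h * (1 / 2) ≤ h * (1 + s * ⟪P, w⟫ + 4 * ⟪Q, w⟫) := by
        gcongr
        linarith
      linarith
  -- choice of the slope
  have hAs : ∀ s, 0 ≤ s → (∀ x ∈ S s, s * ⟪P, x - y⟫ ≤ 1) → s * (c1 * h) ≤ 1 := by
    intro s hs hA
    have := hA _ (hwS s hs)
    rw [add_sub_cancel_left] at this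
    exact (mul_le_mul_of_nonneg_left hPw hs).trans this
  obtain ⟨s, hspos, hA, hnA⟩ : ∃ s, 0 < s ∧ (∀ x ∈ S s, s * ⟪P, x - y⟫ ≤ 1) ∧
      ∃ x ∈ S (2 * s), 1 < 2 * s * ⟪P, x - y⟫ := by
    by_contra hcon
    push Not at hcon
    set s0 : ℝ := 1 / (B * (2 * C)) with hs0
    have hs0pos : 0 < s0 := by positivity
    have hall : ∀ j : ℕ, ∀ x ∈ S (2 ^ j * s0), 2 ^ j * s0 * ⟪P, x - y⟫ ≤ 1 := by
      intro j
      induction j with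
      | zero =>
        intro x hx
        rw [pow_zero, one_mul] at hx ⊢
        have h1 := (abs_le.1 (hinn P hPB x (hHC x hx.1 hx.2.1.le hx.2.2.1.le))).2
        calc s0 * ⟪P, x - y⟫ ≤ s0 * (B * (2 * C)) := by gcongr
          _ = 1 := by rw [hs0]; field_simp
      | succ j ih =>
        have := hcon (2 ^ j * s0) (by positivity) ih
        rwa [← mul_assoc, ← pow_succ'] at this
    obtain ⟨j, hj⟩ := pow_unbounded_of_one_lt (1 / (s0 * (c1 * h))) (one_lt_two : (1:ℝ) < 2)
    rw [div_lt_iff₀ (by positivity)] at hj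
    have := hAs _ (by positivity) (hall j)
    linarith
  have hsc := hAs s hspos.le hA
  obtain ⟨x2, hx2, hx2P⟩ : ∃ x ∈ S s, 1 ≤ 3 * s * ⟪P, x - y⟫ := by
    obtain ⟨x, hx, hxP⟩ := hnA
    have hsP : 1 / 2 < s * ⟪P, x - y⟫ := by linarith
    set X := s * ⟪P, x - y⟫ with hX
    set θ := 1 / (1 + X) with hθ
    have hθpos : 0 < θ := by positivity
    have hθ1 : θ ≤ 1 := by rw [hθ, div_le_one (by positivity)]; linarith
    have hθX : θ * (1 + X) = 1 := by rw [hθ]; field_simp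
    have hmem := hC.convexOn.1 hy hx.1 (sub_nonneg.2 hθ1) hθpos.le (by ring)
    have hval := hC.convexOn.2 hy hx.1 (sub_nonneg.2 hθ1) hθpos.le (by ring)
    simp only [smul_eq_mul] at hval
    rw [hy0, mul_zero, zero_add] at hval
    have hxy : (1 - θ) • y + θ • x - y = θ • (x - y) := by
      rw [sub_smul, one_smul, smul_sub]; abel
    refine ⟨(1 - θ) • y + θ • x, ⟨hmem, ?_, ?_, ?_⟩, ?_⟩
    · have := hx.2.1
      have := mul_lt_mul_of_pos_left this hθpos
      linarith
    · rw [inner_add_right, inner_smul_right, inner_smul_right]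
      have h1 := mul_lt_mul_of_pos_left hx.2.2.1 hθpos
      have h2 : (1 - θ) * ⟪φ, y⟫ ≤ (1 - θ) * 1 :=
        mul_le_mul_of_nonneg_left (by linarith) (sub_nonneg.2 hθ1)
      linarith
    · rw [hl, hxy, inner_smul_right, inner_smul_right]
      have h1 := hx.2.2.2
      rw [hl] at h1
      have h2 := mul_lt_mul_of_pos_left h1 hθpos
      have h3 : θ * (h * (1 + 2 * s * ⟪P, x - y⟫ + 4 * ⟪Q, x - y⟫)) =
          h * (1 + s * (θ * ⟪P, x - y⟫) + 4 * (θ * ⟪Q, x - y⟫)) := by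
        have : θ * (1 + s * ⟪P, x - y⟫) = 1 := hθX
        linear_combination h * this
      linarith
    · rw [hxy, inner_smul_right]
      have : 3 * s * (θ * ⟪P, x - y⟫) = 3 * (θ * X) := by rw [hX]; ring
      rw [this]
      have h1 : θ * (1 + X) ≤ θ * (3 * X) := by gcongr; linarith
      linarith
  -- estimates on the closure of the section
  obtain ⟨z, hz⟩ := hC.inner_ball
  have hz0 := hz z (mem_ball_self hρ)
  have hzC : ‖z‖ ≤ C := hHC z hz0.1 (by rw [hz0.2.1]; norm_num) hz0.2.2
  have hclA : ∀ x ∈ closure (S s), s * ⟪P, x - y⟫ ≤ 1 := fun x hx =>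
    closure_minimal (t := {x | s * ⟪P, x - y⟫ ≤ 1}) hA
      (isClosed_le (by fun_prop) continuous_const) hx
  have hcl : ∀ x ∈ closure (S s), ⟪P, x - y⟫ ≤ 2 * m ∧ ⟪Q, x - y⟫ ≤ 2 * m := by
    intro x hx
    obtain ⟨h1, h2, h3, h4⟩ := hC.closure_cutSet le_rfl _ _ hx
    have hxC := hHC x h1 h2 h3
    rw [hl] at h4
    have hQ := (abs_le.1 (hinn Q hQB x hxC)).2
    have hvx : v x < c * δ ^ ndExp n q := by
      refine lt_of_le_of_lt (h4.trans ?_) hh2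
      gcongr
      rw [hE]
      have := hclA x hx
      linarith
    have : ∃ k ∈ Ω, v k = 0 ∧ ⟪φ, k⟫ ≤ 1 ∧ ‖k - x‖ < δ := by
      by_contra hcon
      push Not at hcon
      have := HL Lam R Ω v φ hC z hz x h1 h3 (by
        have := norm_sub_le x z; linarith) δ hδ hδ1' hcon
      linarith
    obtain ⟨k, hk, hk0, hkφ, hkx⟩ := this
    have hgen : ∀ F : Euc n, ‖F‖ ≤ B → ⟪F, k - y⟫ ≤ ε → ⟪F, x - y⟫ ≤ 2 * m := by
      intro F hF hFk
      have e : x - y = (k - y) - (k - x) := by abel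
      rw [e, inner_sub_right]
      have h5 := (abs_le.1 (abs_real_inner_le_norm F (k - x))).1
      have h6 : ‖F‖ * ‖k - x‖ ≤ B * δ := by gcongr
      linarith
    exact ⟨hgen P hPB (hK k hk hk0 hkφ).1, hgen Q hQB (hK k hk hk0 hkφ).2⟩
  have hl3 : ∀ x ∈ closure (S s), b s + ⟪p s, x⟫ ≤ 3 * h := by
    intro x hx
    rw [hl]
    have h1 := hclA x hx
    have h2 := (hcl x hx).2
    calc _ ≤ h * 3 := by gcongr; linarith
      _ = _ := by ring
  have hlow : ∀ x ∈ closure (S s), -2 ≤ s * ⟪P, x - y⟫ ∧ -(1 / 2) ≤ ⟪Q, x - y⟫ := by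
    intro x hx
    obtain ⟨h1, h2, h3, h4⟩ := hC.closure_cutSet le_rfl _ _ hx
    have h5 := hC.v_nonneg h1
    rw [hl] at h4
    have h6 : 0 ≤ 1 + s * ⟪P, x - y⟫ + 4 * ⟪Q, x - y⟫ :=
      nonneg_of_mul_nonneg_right (h5.trans h4) hh
    have h7 := hclA x hx
    have h8 := (hcl x hx).2
    constructor <;> linarith
  have hsec : IsSection n q lam Lam Ω v (S s) (b s) (p s) (3 * h) := by
    refine hC.isSection_cutSet le_rfl ?_ ?_
    · intro x hx hlt
      obtain ⟨h1, h2, h3, h4⟩ := hC.closure_cutSet le_rfl _ _ hx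
      have h5 := hl3 x hx
      refine ⟨by linarith, ?_⟩
      have h6 := hloc x h1 h2 h3 (hlow x hx).2 (by
        have h7 := (hlow x hx).1
        have h8 := (hcl x2 (subset_closure hx2)).1
        have h9 : 1 ≤ 3 * s * (2 * m) := hx2P.trans (by gcongr)
        by_contra hcon
        push Not at hcon
        have : s * ⟪P, x - y⟫ < s * (-δ1) := by gcongr
        nlinarith)
      linarith
    · intro x hx
      have := hl3 x (subset_closure hx)
      have := hC.v_nonneg hx.1
      linarith
  set D : ℝ := 1 / (6 * s) with hD
  have hDpos : 0 < D := by positivity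
  have hDs : D * s = 1 / 6 := by rw [hD]; field_simp
  have hεs : 6 * (ε * s) ≤ 1 := by nlinarith
  have hεD : ε ≤ D := by rw [hD, le_div_iff₀ (by positivity)]; linarith
  refine HS lam Lam Ω v (S s) (b s) (p s) (3 * h) y Q (2 * m) W hlam hLam.le (by
    rw [div_mul_cancel₀ _ hlam.ne']) hsec (hyS s) (by rw [hl, hy0]; simp) hWpos
    (fun x hx => (hcl x (subset_closure hx)).2) ?_ (by linarith) (Or.inr ?_)
  · have hW0 : W ≤ 1 := by linarith
    have hmem := hC.convexOn.1 hy ha (sub_nonneg.2 hW0) hWpos.le (by ring)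
    have hval := hC.convexOn.2 hy ha (sub_nonneg.2 hW0) hWpos.le (by ring)
    simp only [smul_eq_mul] at hval
    rw [hy0, ha0, mul_zero, mul_zero, zero_add] at hval
    have hxy : (1 - W) • y + W • a - y = W • (a - y) := by
      rw [sub_smul, one_smul, smul_sub]; abel
    refine ⟨(1 - W) • y + W • a, ⟨hmem, by linarith, ?_, ?_⟩, ?_⟩
    · rw [inner_add_right, inner_smul_right, inner_smul_right]
      have h1 := mul_le_mul_of_nonneg_left hφa hWpos.le
      have h2 : (1 - W) * ⟪φ, y⟫ ≤ (1 - W) * (1 / 2) :=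
        mul_le_mul_of_nonneg_left hφy (sub_nonneg.2 hW0)
      linarith
    · rw [hl, hxy, inner_smul_right, inner_smul_right]
      refine lt_of_le_of_lt hval (mul_pos hh ?_)
      have h1 := (abs_le.1 (hinn Q hQB a haC)).1
      have h2 := mul_le_mul_of_nonneg_left h1 hWpos.le
      have h3 : s * W * (-ε) ≤ s * W * ⟪P, a - y⟫ := by gcongr
      have h4 : s * W * ε ≤ W := by nlinarith
      linarith
    · rw [hxy, inner_smul_right]
      have := mul_le_mul_of_nonneg_left hQa hWpos.le
      linarith
  · refine ⟨P, ⟪P, y⟫ + ε, D, hDpos, ?_, ⟨x2, hx2, ?_⟩, ?_⟩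
    · intro x hx hx0
      have := (hK x hx.1 hx0 hx.2.2.1.le).1
      rw [inner_sub_right] at this
      linarith
    · have : 2 * D ≤ ⟪P, x2 - y⟫ := by
        have : 2 * D = 1 / (3 * s) := by rw [hD]; field_simp; norm_num
        rw [this, div_le_iff₀ (by positivity)]; linarith
      rw [inner_sub_right] at this
      linarith
    · intro x hx
      have h1 := (hlow x (subset_closure hx)).1
      have h2 := hclA x (subset_closure hx)
      have h3 : ⟪P, x - y⟫ ≤ 6 * D := by
        have : s * ⟪P, x - y⟫ ≤ s * (6 * D) := by linarith
        exact le_of_mul_le_mul_left this hspos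
      have h4 : -(12 * D) ≤ ⟪P, x - y⟫ := by
        have : s * (-(12 * D)) ≤ s * ⟪P, x - y⟫ := by linarith
        exact le_of_mul_le_mul_left this hspos
      rw [inner_sub_right] at h3 h4
      constructor <;> linarith

theorem exists_rpow_eq {θ a : ℝ} (hθ : 0 < θ) (hθ1 : θ < 1) (ha : 0 < a) (ha1 : a < 1) :
    ∃ γ : ℝ, 0 < γ ∧ θ ^ γ = a ∧ (θ < a → γ < 1) := by
  refine ⟨Real.logb θ a, Real.logb_pos_of_base_lt_one hθ hθ1 ha ha1,
    Real.rpow_logb hθ hθ1.ne ha, fun h => ?_⟩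
  rw [Real.logb_lt_iff_lt_rpow_of_base_lt_one hθ hθ1 ha, Real.rpow_one]
  exact h

theorem iterate_upper {f : ℝ → ℝ} {θ γ : ℝ} (hθ : 0 < θ) (hθ1 : θ < 1) (hγ : 0 ≤ γ)
    (hf1 : 0 ≤ f 1) (hmono : ∀ s t, 0 < s → s ≤ t → t ≤ 1 → f s ≤ f t)
    (hstep : ∀ t, 0 < t → t ≤ 1 → f (θ * t) ≤ θ ^ γ * f t) {t : ℝ} (ht : 0 < t) (ht1 : t ≤ 1) :
    f t ≤ (θ ^ γ)⁻¹ * t ^ γ * f 1 := by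
  obtain ⟨j, hj1, hj2⟩ := exists_nat_pow_near_of_lt_one ht ht1 hθ hθ1
  have hall : ∀ j : ℕ, f (θ ^ j) ≤ (θ ^ γ) ^ j * f 1 := by
    intro j
    induction j with
    | zero => simp
    | succ j ih =>
      have h1 := hstep (θ ^ j) (by positivity) (pow_le_one₀ hθ.le hθ1.le)
      rw [pow_succ', pow_succ', mul_assoc]
      exact h1.trans (mul_le_mul_of_nonneg_left ih (by positivity))
  have h1 := (hmono t (θ ^ j) ht hj2 (pow_le_one₀ hθ.le hθ1.le)).trans (hall j)
  refine h1.trans ?_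
  gcongr
  rw [← Real.rpow_natCast, ← Real.rpow_mul hθ.le, mul_comm γ, Real.rpow_mul hθ.le,
    Real.rpow_natCast, ← div_eq_inv_mul, le_div_iff₀ (by positivity),
    ← Real.mul_rpow (by positivity) hθ.le, ← pow_succ]
  gcongr

theorem iterate_lower {f : ℝ → ℝ} {θ γ : ℝ} (hθ : 0 < θ) (hθ1 : θ < 1) (hγ : 0 ≤ γ)
    (hf1 : 0 ≤ f 1) (hmono : ∀ s t, 0 < s → s ≤ t → t ≤ 1 → f s ≤ f t)
    (hstep : ∀ t, 0 < t → t ≤ 1 → θ ^ γ * f t ≤ f (θ * t)) {t : ℝ} (ht : 0 < t) (ht1 : t ≤ 1) :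
    θ ^ γ * t ^ γ * f 1 ≤ f t := by
  obtain ⟨j, hj1, hj2⟩ := exists_nat_pow_near_of_lt_one ht ht1 hθ hθ1
  have hall : ∀ j : ℕ, (θ ^ γ) ^ j * f 1 ≤ f (θ ^ j) := by
    intro j
    induction j with
    | zero => simp
    | succ j ih =>
      have h1 := hstep (θ ^ j) (by positivity) (pow_le_one₀ hθ.le hθ1.le)
      rw [pow_succ', pow_succ', mul_assoc]
      exact (mul_le_mul_of_nonneg_left ih (by positivity)).trans h1
  have h1 := (hall (j + 1)).trans (hmono (θ ^ (j + 1)) t (by positivity) hj1.le ht1)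
  refine le_trans ?_ h1
  gcongr
  rw [pow_succ', ← Real.rpow_natCast, ← Real.rpow_mul hθ.le γ, mul_comm γ, Real.rpow_mul hθ.le,
    Real.rpow_natCast]
  gcongr

theorem conf_corner (n : ℕ) {q lam Lam ρ R : ℝ} (hq0 : 0 ≤ q) (hqn : q < n)
    (hlam : 0 < lam) (hLam : 0 < Lam) (hρ : 0 < ρ) (hR : 0 < R) :
    ∃ ε : ℝ, 0 < ε ∧ ∀ (Ω : Set (Euc n)) (v : Euc n → ℝ) (φ P a x1 x2 : Euc n),
      Conf n q lam Lam ρ R Ω v φ → a ∈ Ω → v a = 0 → ⟪φ, a⟫ = 1 → 0 ≤ ⟪P, a⟫ →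
      (∀ x ∈ Ω, v x = 0 → ⟪φ, x⟫ ≤ 1 → ⟪P, x⟫ ≤ ε) →
      x1 ∈ Ω → v x1 = 0 → ⟪φ, x1⟫ ≤ 1 → x2 ∈ Ω → v x2 = 0 → ⟪φ, x2⟫ ≤ 1 →
      1 ≤ ⟪P, x1 - x2⟫ → False := by
  have hB : 1 ≤ 1 + 1 / ρ := by have : 0 < 1 / ρ := by positivity
                                linarith
  obtain ⟨ε, hε, H⟩ := conf_rigidity n hq0 hqn hlam hLam hρ hR hB one_pos
  refine ⟨ε / (2 * R), by positivity, ?_⟩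
  intro Ω v φ P a x1 x2 hC ha ha0 haφ hPa hP hx1 hx10 hx1φ hx2 hx20 hx2φ hosc
  have hP1 : 1 ≤ ‖P‖ * (2 * R) := by
    refine hosc.trans ((real_inner_le_norm _ _).trans ?_)
    have := norm_sub_le x1 x2
    have := hC.bdd x1 hx1 hx10 hx1φ
    have := hC.bdd x2 hx2 hx20 hx2φ
    gcongr; linarith
  have hPpos : 0 < ‖P‖ := by
    by_contra h
    have : ‖P‖ = 0 := le_antisymm (not_lt.1 h) (norm_nonneg _)
    rw [this] at hP1; linarith
  have hPn : ‖‖P‖⁻¹ • P‖ = 1 := by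
    rw [norm_smul, norm_inv, norm_norm, inv_mul_cancel₀ hPpos.ne']
  have hinn : ∀ x : Euc n, ⟪‖P‖⁻¹ • P, x⟫ = ‖P‖⁻¹ * ⟪P, x⟫ := fun x => by
    rw [inner_smul_left]; simp
  refine H Ω v φ 0 (‖P‖⁻¹ • P) (-φ) a hC hC.zero_mem hC.v_zero (by simp) (by rw [hPn]; exact hB)
    ?_ (by rw [hPn]; linarith) ?_ ha ha0 haφ.le ?_ ?_ ?_
  · rw [norm_neg]
    have := hC.norm_le hρ
    rw [mul_comm, ← le_div_iff₀ hρ] at this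
    linarith
  · intro x hx hx0 hxφ
    rw [sub_zero, hinn, inner_neg_left]
    refine ⟨?_, by have := hC.nonneg x hx hx0; linarith⟩
    rw [inv_mul_le_iff₀ hPpos]
    refine (hP x hx hx0 hxφ).trans ?_
    rw [div_le_iff₀ (by positivity)]
    nlinarith
  · rw [sub_zero, hinn]
    have : 0 ≤ ‖P‖⁻¹ * ⟪P, a⟫ := by positivity
    linarith
  · rw [sub_zero, inner_neg_left, haφ]
  · intro x hx hvx hxφ hQ _
    rw [sub_zero, inner_neg_left] at hQ
    linarith

theorem conf_flat (n : ℕ) {q lam Lam ρ R : ℝ} (hq0 : 0 ≤ q) (hqn : q < n)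
    (hlam : 0 < lam) (hLam : 0 < Lam) (hρ : 0 < ρ) (hR : 0 < R) {C1 : ℝ} (hC1 : 0 < C1) :
    ∃ ε : ℝ, 0 < ε ∧ ∀ (Ω : Set (Euc n)) (v : Euc n → ℝ) (φ Q y : Euc n),
      Conf n q lam Lam ρ R Ω v φ → y ∈ Ω → v y = 0 → ⟪φ, y⟫ ≤ ε → 1 ≤ ⟪Q, y⟫ →
      (∀ x ∈ Ω, v x = 0 → ⟪φ, x⟫ ≤ 1 → ⟪Q, x⟫ ≤ ⟪Q, y⟫ + ε) →
      (∀ x1 ∈ Ω, v x1 = 0 → ⟪φ, x1⟫ ≤ 1 → ∀ x2 ∈ Ω, v x2 = 0 → ⟪φ, x2⟫ ≤ 1 →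
        ⟪Q, x1 - x2⟫ ≤ C1) → False := by
  have h1 : 0 < 1 / ρ := by positivity
  have h2 : 0 < C1 / ρ := by positivity
  obtain ⟨ε, hε, H⟩ := conf_rigidity n hq0 hqn hlam hLam hρ hR
    (B := 1 + 1 / ρ + C1 / ρ + R) (δ1 := 1 / 4) (by linarith) (by norm_num)
  refine ⟨min ε (1 / 4), by positivity, ?_⟩
  intro Ω v φ Q y hC hy hy0 hyφ hQy hQ hosc
  have hm1 := min_le_left ε (1 / 4)
  have hm2 := min_le_right ε (1 / 4)
  have hφn := hC.norm_le hρ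
  rw [mul_comm, ← le_div_iff₀ hρ] at hφn
  have hQn : ‖Q‖ ≤ C1 / ρ := by
    rw [le_div_iff₀ hρ, mul_comm]
    obtain ⟨z, hz⟩ := hC.inner_ball
    refine norm_le_of_inner_le hρ fun w hw => ?_
    have h1 := hz z (mem_ball_self hρ)
    have h3 := hz (z + w) (by simpa using hw)
    have := hosc _ h3.1 h3.2.1 h3.2.2 z h1.1 h1.2.1 h1.2.2
    rwa [add_sub_cancel_left] at this
  refine H Ω v φ y (-φ) Q 0 hC hy hy0 (by linarith) (by rw [norm_neg]; linarith) (by linarith)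
    ?_ ?_ hC.zero_mem hC.v_zero (by simp) ?_ ?_ ?_
  · rw [norm_neg]
    have := hC.one_le_norm
    nlinarith [norm_nonneg φ]
  · intro x hx hx0 hxφ
    have h3 := hC.nonneg x hx hx0
    have h4 := hQ x hx hx0 hxφ
    rw [inner_neg_left, inner_sub_right, inner_sub_right]
    constructor <;> linarith
  · have := hC.nonneg y hy hy0
    rw [inner_neg_left, zero_sub, inner_neg_right]; linarith
  · rw [zero_sub, inner_neg_right]; linarith
  · intro x hx hvx hxφ _ hP
    rw [inner_neg_left, inner_sub_right] at hP
    linarith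

theorem conf_renorm (n : ℕ) (hn : 0 < n) {q lam Lam ρ R : ℝ} (hqn : q < n)
    (hlam : 0 < lam) (hLam : 0 < Lam) (hρ : 0 < ρ) (hR : 0 < R) :
    ∃ κ : ℝ, 0 < κ ∧ ∀ (Ω : Set (Euc n)) (v : Euc n → ℝ) (φ : Euc n),
      Conf n q lam Lam ρ R Ω v φ → ∀ t : ℝ, 0 < t → t ≤ 1 →
      ∃ (T : Euc n ≃L[ℝ] Euc n) (h : ℝ) (φ' : Euc n), 0 < h ∧ (∀ ξ, ⟪φ', ξ⟫ = ⟪φ, T ξ⟫ / t) ∧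
        Conf n q (lam * κ) (Lam * κ) (1 / ((n : ℝ) + 1) ^ 2) n {ξ | T ξ ∈ Ω}
          (fun ξ => v (T ξ) / h) φ' := by
  set c : ℝ := 1 / ((n : ℝ) + 1) ^ 2 with hc
  have hcpos : 0 < c := by positivity
  have hnq : (0:ℝ) < n - q := by linarith
  set Cd : ℝ := (R / c) ^ n with hCd
  have hCdpos : 0 < Cd := by positivity
  refine ⟨Cd ^ 2, by positivity, ?_⟩
  intro Ω v φ hC t ht ht1
  set D : Set (Euc n) := {x | x ∈ Ω ∧ v x = 0 ∧ ⟪φ, x⟫ ≤ t} with hD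
  have hclosed : ∀ b ≤ (1:ℝ), IsCompact {x | x ∈ Ω ∧ v x ≤ b ∧ ⟪φ, x⟫ ≤ t} := by
    intro b hb
    have h1 : ContinuousOn v {x | x ∈ Ω ∧ v x ≤ 1 ∧ ⟪φ, x⟫ ≤ 1} := hC.gen.1.mono fun x hx => hx.1
    have h2 := h1.preimage_isClosed_of_isClosed hC.compact.isClosed (isClosed_Iic (a := b))
    have h3 : IsClosed {x : Euc n | ⟪φ, x⟫ ≤ t} := isClosed_le (by fun_prop) continuous_const
    refine hC.compact.of_isClosed_subset (?_ : IsClosed _) fun x hx =>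
      ⟨hx.1, hx.2.1.trans hb, hx.2.2.trans ht1⟩
    convert h2.inter h3 using 1
    ext x
    simp only [mem_ofPred_eq, mem_inter_iff, mem_preimage, mem_Iic]
    constructor
    · rintro ⟨h4, h5, h6⟩
      exact ⟨⟨⟨h4, h5.trans hb, h6.trans ht1⟩, h5⟩, h6⟩
    · rintro ⟨⟨⟨h4, _, _⟩, h5⟩, h6⟩
      exact ⟨h4, h5, h6⟩
  have hDe : D = {x | x ∈ Ω ∧ v x ≤ 0 ∧ ⟪φ, x⟫ ≤ t} := by
    ext x
    simp only [hD, mem_ofPred_eq]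
    constructor
    · rintro ⟨h1, h2, h3⟩; exact ⟨h1, h2.le, h3⟩
    · rintro ⟨h1, h2, h3⟩; exact ⟨h1, le_antisymm h2 (hC.v_nonneg h1), h3⟩
  have hDcpt : IsCompact D := by rw [hDe]; exact hclosed 0 zero_le_one
  have hDconv : Convex ℝ D := by
    rw [hDe]
    intro x hx y hy s t' hs ht' hst
    refine ⟨hC.convexOn.1 hx.1 hy.1 hs ht' hst, ?_, ?_⟩
    · have := hC.convexOn.2 hx.1 hy.1 hs ht' hst
      simp only [smul_eq_mul] at this
      have := mul_nonpos_of_nonneg_of_nonpos hs hx.2.1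
      have := mul_nonpos_of_nonneg_of_nonpos ht' hy.2.1
      linarith
    · rw [inner_add_right, inner_smul_right, inner_smul_right]
      have h1 := mul_le_mul_of_nonneg_left hx.2.2 hs
      have h2 := mul_le_mul_of_nonneg_left hy.2.2 ht'
      have h3 : s * t + t' * t = (s + t') * t := by ring
      rw [hst] at h3; linarith
  have hscale : ∀ x ∈ Ω, v x = 0 → ⟪φ, x⟫ ≤ 1 → t • x ∈ D := by
    intro x hx hx0 hxφ
    have h1 := hC.convexOn.1 hC.zero_mem hx (sub_nonneg.2 ht1) ht.le (by ring)
    have h2 := hC.convexOn.2 hC.zero_mem hx (sub_nonneg.2 ht1) ht.le (by ring)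
    rw [smul_zero, zero_add] at h1 h2
    rw [hC.v_zero, hx0] at h2
    simp only [smul_zero, add_zero] at h2
    refine ⟨h1, le_antisymm h2 (hC.v_nonneg h1), ?_⟩
    rw [inner_smul_right]
    have := mul_le_mul_of_nonneg_left hxφ ht.le
    linarith
  have hDint : (interior D).Nonempty := by
    obtain ⟨z, hz⟩ := hC.inner_ball
    refine ⟨t • z, mem_interior.2 ⟨ball (t • z) (t * ρ), ?_, isOpen_ball,
      mem_ball_self (by positivity)⟩⟩
    intro x hx
    have h1 : t⁻¹ • x ∈ ball z ρ := by
      rw [mem_ball, dist_eq_norm] at hx ⊢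
      have e : t⁻¹ • x - z = t⁻¹ • (x - t • z) := by
        rw [smul_sub, smul_smul, inv_mul_cancel₀ ht.ne', one_smul]
      rw [e, norm_smul, norm_inv, Real.norm_of_nonneg ht.le, inv_mul_lt_iff₀ ht]
      exact hx
    obtain ⟨h2, h3, h4⟩ := hz _ h1
    have := hscale _ h2 h3 h4
    rwa [smul_smul, mul_inv_cancel₀ ht.ne', one_smul] at this
  have h0D : (0 : Euc n) ∈ D := ⟨hC.zero_mem, hC.v_zero, by simpa using ht.le⟩
  obtain ⟨T, hT1, ζ, hT2⟩ := exists_normalization hDcpt hDconv hDint h0D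
  set d : ℝ := |LinearMap.det (T : Euc n →ₗ[ℝ] Euc n)| with hd
  have hdpos : 0 < d := abs_pos.2 (LinearEquiv.isUnit_det' T.toLinearEquiv).ne_zero
  have hdC : d ≤ Cd := by
    have h1 : (T : Euc n →ₗ[ℝ] Euc n) '' ball ζ c ⊆ closedBall 0 R := by
      rintro _ ⟨ξ, hξ, rfl⟩
      have := hT2 hξ
      simp only [zero_add, mem_ofPred_eq] at this
      rw [mem_closedBall_zero_iff]
      exact hC.bdd _ this.1 this.2.1 (this.2.2.trans ht1)
    have h2 := measure_mono (μ := volume) h1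
    rw [Measure.addHaar_image_linearMap, Measure.addHaar_closedBall _ _ hR.le,
      Measure.addHaar_ball_of_pos _ _ hcpos, finrank_euclideanSpace, Fintype.card_fin,
      ← mul_assoc, ← ENNReal.ofReal_mul (abs_nonneg _)] at h2
    have h3 : volume (ball (0 : Euc n) 1) ≠ 0 := (measure_ball_pos _ _ one_pos).ne'
    have h4 : volume (ball (0 : Euc n) 1) ≠ ⊤ := measure_ball_lt_top.ne
    rw [ENNReal.mul_le_mul_iff_left h3 h4, ENNReal.ofReal_le_ofReal_iff (by positivity)] at h2
    rw [hCd, div_pow, le_div_iff₀ (by positivity)]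
    exact h2
  set h : ℝ := (d / Cd) ^ (2 / ((n:ℝ) - q)) with hh
  have hhpos : 0 < h := by positivity
  have hh1 : h ≤ 1 := Real.rpow_le_one (by positivity) ((div_le_one hCdpos).2 hdC) (by positivity)
  have hκ : LinearMap.det (T : Euc n →ₗ[ℝ] Euc n) ^ 2 * h ^ (q - n) = Cd ^ 2 := by
    rw [← sq_abs, ← hd, hh, ← Real.rpow_mul (by positivity)]
    have : 2 / ((n:ℝ) - q) * (q - n) = -2 := by field_simp; ring
    rw [this, Real.rpow_neg (by positivity)]
    norm_num
    field_simp
  have hG := hC.gen.comp_affine hC.isOpen hlam.le hLam.le 0 T hhpos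
  simp only [zero_add, hκ] at hG
  set φ' : Euc n := t⁻¹ • ContinuousLinearMap.adjoint (T : Euc n →L[ℝ] Euc n) φ with hφ'
  have hφ'a : ∀ ξ, ⟪φ', ξ⟫ = ⟪φ, T ξ⟫ / t := fun ξ => by
    rw [hφ', inner_smul_left, ContinuousLinearMap.adjoint_inner_left, div_eq_inv_mul]; simp
  have hv0 : ∀ ξ, v (T ξ) / h = 0 ↔ v (T ξ) = 0 := fun ξ => by
    rw [div_eq_zero_iff]; simp [hhpos.ne']
  refine ⟨T, h, φ', hhpos, hφ'a, ?_⟩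
  refine ⟨hC.isOpen.preimage T.continuous, hG, by simpa using hC.zero_mem, by simp [hC.v_zero],
    ?_, ?_, ⟨ζ, ?_⟩, ?_, ?_⟩
  · intro ξ hξ hξ0
    rw [hφ'a]
    exact div_nonneg (hC.nonneg _ hξ ((hv0 ξ).1 hξ0)) ht.le
  · have h1 := hclosed h hh1
    have h2 := h1.image T.symm.continuous
    convert h2 using 1
    ext ξ
    simp only [mem_ofPred_eq, mem_image, hφ'a, div_le_one hhpos, div_le_one ht]
    constructor
    · rintro h3
      exact ⟨T ξ, h3, T.symm_apply_apply ξ⟩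
    · rintro ⟨x, h3, rfl⟩
      simpa using h3
  · intro ξ hξ
    have := hT2 hξ
    simp only [zero_add, mem_ofPred_eq] at this
    refine ⟨this.1, (hv0 ξ).2 this.2.1, ?_⟩
    rw [hφ'a, div_le_one ht]
    exact this.2.2
  · intro ξ hξ hξ0 hξφ
    rw [hφ'a, div_le_one ht] at hξφ
    have := hT1 (T ξ) ⟨hξ, (hv0 ξ).1 hξ0, hξφ⟩
    simpa using this
  · obtain ⟨k, hk, hk0, hkφ⟩ := hC.top
    have h1 := hscale k hk hk0 hkφ.le
    refine ⟨T.symm (t • k), by simpa using h1.1, by simp [h1.2.1], ?_⟩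
    rw [hφ'a, T.apply_symm_apply, inner_smul_right, hkφ]
    field_simp

theorem conf_corner_scaled (n : ℕ) (hn : 0 < n) {q lam Lam ρ R : ℝ} (hq0 : 0 ≤ q) (hqn : q < n)
    (hlam : 0 < lam) (hLam : 0 < Lam) (hρ : 0 < ρ) (hR : 0 < R) :
    ∃ ε : ℝ, 0 < ε ∧ ∀ (Ω : Set (Euc n)) (v : Euc n → ℝ) (φ P a x1 x2 : Euc n) (t ω : ℝ),
      Conf n q lam Lam ρ R Ω v φ → 0 < t → t ≤ 1 → 0 < ω →
      a ∈ Ω → v a = 0 → ⟪φ, a⟫ = t → 0 ≤ ⟪P, a⟫ →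
      (∀ x ∈ Ω, v x = 0 → ⟪φ, x⟫ ≤ t → ⟪P, x⟫ ≤ ε * ω) →
      x1 ∈ Ω → v x1 = 0 → ⟪φ, x1⟫ ≤ t → x2 ∈ Ω → v x2 = 0 → ⟪φ, x2⟫ ≤ t →
      ω ≤ ⟪P, x1 - x2⟫ → False := by
  obtain ⟨κ, hκ, H⟩ := conf_renorm n hn (q := q) hqn hlam hLam hρ hR
  obtain ⟨ε, hε, H1⟩ := conf_corner n (q := q) (lam := lam * κ) (Lam := Lam * κ)
    (ρ := 1 / ((n : ℝ) + 1) ^ 2) (R := n) hq0 hqn (by positivity) (by positivity) (by positivity)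
    (by positivity)
  refine ⟨ε, hε, ?_⟩
  intro Ω v φ P a x1 x2 t ω hC ht ht1 hω ha ha0 haφ hPa hP hx1 hx10 hx1φ hx2 hx20 hx2φ hosc
  obtain ⟨T, h, φ', hh, hφ', hC'⟩ := H Ω v φ hC t ht ht1
  have hv0 : ∀ ξ, v (T ξ) / h = 0 ↔ v (T ξ) = 0 := fun ξ => by
    rw [div_eq_zero_iff]; simp [hh.ne']
  set P' : Euc n := ω⁻¹ • ContinuousLinearMap.adjoint (T : Euc n →L[ℝ] Euc n) P with hP'
  have hP'a : ∀ ξ, ⟪P', ξ⟫ = ⟪P, T ξ⟫ / ω := fun ξ => by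
    rw [hP', inner_smul_left, ContinuousLinearMap.adjoint_inner_left, div_eq_inv_mul]; simp
  refine H1 _ _ φ' P' (T.symm a) (T.symm x1) (T.symm x2) hC' (by simpa using ha)
    ((hv0 _).2 (by simpa using ha0)) (by rw [hφ', T.apply_symm_apply, haφ, div_self ht.ne'])
    (by rw [hP'a, T.apply_symm_apply]; positivity) ?_
    (by simpa using hx1) ((hv0 _).2 (by simpa using hx10))
    (by rw [hφ', T.apply_symm_apply, div_le_one ht]; exact hx1φ)
    (by simpa using hx2) ((hv0 _).2 (by simpa using hx20))
    (by rw [hφ', T.apply_symm_apply, div_le_one ht]; exact hx2φ) ?_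
  · intro ξ hξ hξ0 hξφ
    rw [hφ', div_le_one ht] at hξφ
    rw [hP'a, div_le_iff₀ hω]
    exact hP _ hξ ((hv0 _).1 hξ0) hξφ
  · rw [← map_sub, hP'a, T.apply_symm_apply, le_div_iff₀ hω, one_mul]
    exact hosc

theorem conf_flat_scaled (n : ℕ) (hn : 0 < n) {q lam Lam ρ R : ℝ} (hq0 : 0 ≤ q) (hqn : q < n)
    (hlam : 0 < lam) (hLam : 0 < Lam) (hρ : 0 < ρ) (hR : 0 < R) {C1 : ℝ} (hC1 : 0 < C1) :
    ∃ ε : ℝ, 0 < ε ∧ ∀ (Ω : Set (Euc n)) (v : Euc n → ℝ) (φ Q y : Euc n) (t ω : ℝ),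
      Conf n q lam Lam ρ R Ω v φ → 0 < t → t ≤ 1 → 0 < ω → y ∈ Ω → v y = 0 →
      ⟪φ, y⟫ ≤ ε * t → ω ≤ ⟪Q, y⟫ →
      (∀ x ∈ Ω, v x = 0 → ⟪φ, x⟫ ≤ t → ⟪Q, x⟫ ≤ ⟪Q, y⟫ + ε * ω) →
      (∀ x1 ∈ Ω, v x1 = 0 → ⟪φ, x1⟫ ≤ t → ∀ x2 ∈ Ω, v x2 = 0 → ⟪φ, x2⟫ ≤ t →
        ⟪Q, x1 - x2⟫ ≤ C1 * ω) → False := by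
  obtain ⟨κ, hκ, H⟩ := conf_renorm n hn (q := q) hqn hlam hLam hρ hR
  obtain ⟨ε, hε, H1⟩ := conf_flat n (q := q) (lam := lam * κ) (Lam := Lam * κ)
    (ρ := 1 / ((n : ℝ) + 1) ^ 2) (R := n) hq0 hqn (by positivity) (by positivity) (by positivity)
    (by positivity) hC1
  refine ⟨ε, hε, ?_⟩
  intro Ω v φ Q y t ω hC ht ht1 hω hy hy0 hyφ hQy hQ hosc
  obtain ⟨T, h, φ', hh, hφ', hC'⟩ := H Ω v φ hC t ht ht1
  have hv0 : ∀ ξ, v (T ξ) / h = 0 ↔ v (T ξ) = 0 := fun ξ => by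
    rw [div_eq_zero_iff]; simp [hh.ne']
  set Q' : Euc n := ω⁻¹ • ContinuousLinearMap.adjoint (T : Euc n →L[ℝ] Euc n) Q with hQ'
  have hQ'a : ∀ ξ, ⟪Q', ξ⟫ = ⟪Q, T ξ⟫ / ω := fun ξ => by
    rw [hQ', inner_smul_left, ContinuousLinearMap.adjoint_inner_left, div_eq_inv_mul]; simp
  refine H1 _ _ φ' Q' (T.symm y) hC' (by simpa using hy)
    ((hv0 _).2 (by simpa using hy0))
    (by rw [hφ', T.apply_symm_apply, div_le_iff₀ ht]; exact hyφ)
    (by rw [hQ'a, T.apply_symm_apply, le_div_iff₀ hω, one_mul]; exact hQy) ?_ ?_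
  · intro ξ hξ hξ0 hξφ
    rw [hφ', div_le_one ht] at hξφ
    rw [hQ'a, hQ'a, T.apply_symm_apply, div_le_iff₀ hω, add_mul, div_mul_cancel₀ _ hω.ne']
    exact hQ _ hξ ((hv0 _).1 hξ0) hξφ
  · intro ξ hξ hξ0 hξφ η hη hη0 hηφ
    rw [hφ', div_le_one ht] at hξφ hηφ
    rw [hQ'a, map_sub, div_le_iff₀ hω]
    exact hosc _ hξ ((hv0 _).1 hξ0) hξφ _ hη ((hv0 _).1 hη0) hηφ

/-- A normalized configuration whose coincidence set is an epigraph in the direction `φ` below the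
level `1`. -/
structure EpiConf (n : ℕ) (q lam Lam ρ R : ℝ) (Ω : Set (Euc n)) (v : Euc n → ℝ) (φ : Euc n) :
    Prop extends Conf n q lam Lam ρ R Ω v φ where
  unit : ‖φ‖ = 1
  epi : ∀ x ∈ Ω, v x = 0 → ∀ s, ⟪φ, x⟫ ≤ s → s ≤ 1 →
    x + (s - ⟪φ, x⟫) • φ ∈ Ω ∧ v (x + (s - ⟪φ, x⟫) • φ) = 0

/-- The part of the coincidence set below the level `t`. -/
def lowerPart {n : ℕ} (Ω : Set (Euc n)) (v : Euc n → ℝ) (φ : Euc n) (t : ℝ) : Set (Euc n) :=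
  {x | x ∈ Ω ∧ v x = 0 ∧ ⟪φ, x⟫ ≤ t}

/-- The support function of the part of the coincidence set below the level `t`. -/
def supp {n : ℕ} (Ω : Set (Euc n)) (v : Euc n → ℝ) (φ e : Euc n) (t : ℝ) : ℝ :=
  sSup ((fun x => ⟪e, x⟫) '' lowerPart Ω v φ t)

namespace Conf

variable {n : ℕ} {q lam Lam ρ R : ℝ} {Ω : Set (Euc n)} {v : Euc n → ℝ} {φ : Euc n}

theorem isCompact_lowerPart (h : Conf n q lam Lam ρ R Ω v φ) {t : ℝ} (ht1 : t ≤ 1) :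
    IsCompact (lowerPart Ω v φ t) := by
  have h1 : ContinuousOn v {x | x ∈ Ω ∧ v x ≤ 1 ∧ ⟪φ, x⟫ ≤ 1} := h.gen.1.mono fun x hx => hx.1
  have h2 := h1.preimage_isClosed_of_isClosed h.compact.isClosed (isClosed_singleton (x := (0:ℝ)))
  have h3 : IsClosed {x : Euc n | ⟪φ, x⟫ ≤ t} := isClosed_le (by fun_prop) continuous_const
  refine h.compact.of_isClosed_subset (?_ : IsClosed _) fun x hx =>
    ⟨hx.1, by rw [hx.2.1]; exact zero_le_one, hx.2.2.trans ht1⟩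
  convert h2.inter h3 using 1
  ext x
  simp only [lowerPart, mem_ofPred_eq, mem_inter_iff, mem_preimage, mem_singleton_iff]
  constructor
  · rintro ⟨h4, h5, h6⟩
    exact ⟨⟨⟨h4, by rw [h5]; exact zero_le_one, h6.trans ht1⟩, h5⟩, h6⟩
  · rintro ⟨⟨⟨h4, _, _⟩, h5⟩, h6⟩
    exact ⟨h4, h5, h6⟩

theorem convex_coin (h : Conf n q lam Lam ρ R Ω v φ) {x y : Euc n} (hx : x ∈ Ω) (hx0 : v x = 0)
    (hy : y ∈ Ω) (hy0 : v y = 0) {s t : ℝ} (hs : 0 ≤ s) (ht : 0 ≤ t) (hst : s + t = 1) :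
    s • x + t • y ∈ Ω ∧ v (s • x + t • y) = 0 := by
  have h1 := h.convexOn.1 hx hy hs ht hst
  have h2 := h.convexOn.2 hx hy hs ht hst
  rw [hx0, hy0] at h2
  simp only [smul_zero, add_zero] at h2
  exact ⟨h1, le_antisymm h2 (h.v_nonneg h1)⟩

theorem convex_lowerPart (h : Conf n q lam Lam ρ R Ω v φ) (t : ℝ) :
    Convex ℝ (lowerPart Ω v φ t) := by
  intro x hx y hy a b ha hb hab
  obtain ⟨h1, h2⟩ := h.convex_coin hx.1 hx.2.1 hy.1 hy.2.1 ha hb hab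
  refine ⟨h1, h2, ?_⟩
  rw [inner_add_right, inner_smul_right, inner_smul_right]
  have h3 := mul_le_mul_of_nonneg_left hx.2.2 ha
  have h4 := mul_le_mul_of_nonneg_left hy.2.2 hb
  have h5 : a * t + b * t = (a + b) * t := by ring
  rw [hab] at h5; linarith

theorem zero_mem_lowerPart (h : Conf n q lam Lam ρ R Ω v φ) {t : ℝ} (ht : 0 ≤ t) :
    (0 : Euc n) ∈ lowerPart Ω v φ t :=
  ⟨h.zero_mem, h.v_zero, by simpa using ht⟩

theorem le_supp (h : Conf n q lam Lam ρ R Ω v φ) (e : Euc n) {t : ℝ} (ht1 : t ≤ 1) {x : Euc n}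
    (hx : x ∈ lowerPart Ω v φ t) : ⟪e, x⟫ ≤ supp Ω v φ e t :=
  le_csSup ((h.isCompact_lowerPart ht1).image (by fun_prop)).bddAbove ⟨x, hx, rfl⟩

theorem exists_eq_supp (h : Conf n q lam Lam ρ R Ω v φ) (e : Euc n) {t : ℝ} (ht : 0 ≤ t)
    (ht1 : t ≤ 1) : ∃ x ∈ lowerPart Ω v φ t, ⟪e, x⟫ = supp Ω v φ e t :=
  ((h.isCompact_lowerPart ht1).image (by fun_prop : Continuous fun x => ⟪e, x⟫)).sSup_mem
    ⟨_, 0, h.zero_mem_lowerPart ht, rfl⟩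

theorem supp_nonneg (h : Conf n q lam Lam ρ R Ω v φ) (e : Euc n) {t : ℝ} (ht : 0 ≤ t)
    (ht1 : t ≤ 1) : 0 ≤ supp Ω v φ e t := by
  have := h.le_supp e ht1 (h.zero_mem_lowerPart ht)
  simpa using this

theorem supp_mono (h : Conf n q lam Lam ρ R Ω v φ) (e : Euc n) {s t : ℝ} (hs : 0 ≤ s)
    (hst : s ≤ t) (ht1 : t ≤ 1) : supp Ω v φ e s ≤ supp Ω v φ e t := by
  obtain ⟨x, hx, hxe⟩ := h.exists_eq_supp e hs (hst.trans ht1)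
  rw [← hxe]
  exact h.le_supp e ht1 ⟨hx.1, hx.2.1, hx.2.2.trans hst⟩

theorem le_supp_one (h : Conf n q lam Lam ρ R Ω v φ) (hρ : 0 < ρ) (e : Euc n) :
    ρ * ‖e‖ ≤ supp Ω v φ e 1 + supp Ω v φ (-e) 1 := by
  obtain ⟨z, hz⟩ := h.inner_ball
  refine norm_le_of_inner_le hρ fun w hw => ?_
  have h1 := h.le_supp (-e) le_rfl (hz z (mem_ball_self hρ))
  have h2 := h.le_supp e le_rfl (hz (z + w) (by simpa using hw))
  rw [inner_neg_left] at h1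
  rw [inner_add_right] at h2
  linarith

theorem supp_one_le (h : Conf n q lam Lam ρ R Ω v φ) (e : Euc n) :
    supp Ω v φ e 1 ≤ ‖e‖ * R := by
  obtain ⟨x, hx, hxe⟩ := h.exists_eq_supp e zero_le_one le_rfl
  rw [← hxe]
  refine (real_inner_le_norm _ _).trans ?_
  have := h.bdd x hx.1 hx.2.1 hx.2.2
  gcongr

end Conf

theorem EpiConf.exists_top_eq_supp {n : ℕ} {q lam Lam ρ R : ℝ} {Ω : Set (Euc n)} {v : Euc n → ℝ}
    {φ : Euc n} (h : EpiConf n q lam Lam ρ R Ω v φ) {e : Euc n} (he : ⟪e, φ⟫ = 0) {t : ℝ}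
    (ht : 0 ≤ t) (ht1 : t ≤ 1) :
    ∃ x ∈ lowerPart Ω v φ t, ⟪φ, x⟫ = t ∧ ⟪e, x⟫ = supp Ω v φ e t := by
  obtain ⟨x, hx, hxe⟩ := h.exists_eq_supp e ht ht1
  obtain ⟨h1, h2⟩ := h.epi x hx.1 hx.2.1 t hx.2.2 ht1
  have h3 : ⟪φ, x + (t - ⟪φ, x⟫) • φ⟫ = t := by
    rw [inner_add_right, inner_smul_right, real_inner_self_eq_norm_sq, h.unit]; ring
  refine ⟨_, ⟨h1, h2, h3.le⟩, h3, ?_⟩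
  rw [inner_add_right, inner_smul_right, he, hxe]; ring

set_option maxHeartbeats 2000000 in
theorem epiConf_half (n : ℕ) (hn : 0 < n) {q lam Lam ρ R : ℝ} (hq0 : 0 ≤ q) (hqn : q < n)
    (hlam : 0 < lam) (hLam : 0 < Lam) (hρ : 0 < ρ) (hR : 0 < R) :
    ∃ ε : ℝ, 0 < ε ∧ ε < 1 ∧ ∀ (Ω : Set (Euc n)) (v : Euc n → ℝ) (φ e : Euc n) (t : ℝ),
      EpiConf n q lam Lam ρ R Ω v φ → ⟪e, φ⟫ = 0 → 0 < t → t ≤ 1 →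
      supp Ω v φ e t / 2 + ε / 2 * (supp Ω v φ e t + supp Ω v φ (-e) t) ≤
        supp Ω v φ e (t / 2) := by
  obtain ⟨ε0, hε0, H⟩ := conf_corner_scaled n hn hq0 hqn hlam hLam hρ hR
  obtain ⟨ε, hε, hεε0, hε1⟩ : ∃ ε : ℝ, 0 < ε ∧ ε ≤ ε0 ∧ ε < 1 :=
    ⟨min ε0 (1 / 2), by positivity, min_le_left _ _, (min_le_right _ _).trans_lt (by norm_num)⟩
  refine ⟨ε, hε, hε1, ?_⟩
  intro Ω v φ e t hC he ht ht1
  by_contra hcon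
  push Not at hcon
  have hC' := hC.toConf
  set m := supp Ω v φ e t with hm
  set m' := supp Ω v φ (-e) t with hm'
  set mh := supp Ω v φ e (t / 2) with hmh
  have hm0 : 0 ≤ m := hC'.supp_nonneg e ht.le ht1
  have hm'0 : 0 ≤ m' := hC'.supp_nonneg (-e) ht.le ht1
  have hmh0 : 0 ≤ mh := hC'.supp_nonneg e (by positivity) (by linarith)
  obtain ⟨a, ha, haφ, hae⟩ := hC.exists_top_eq_supp he ht.le ht1
  obtain ⟨b, hb, hbφ, hbe⟩ := hC.exists_top_eq_supp (e := -e) (by rw [inner_neg_left, he, neg_zero])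
    ht.le ht1
  rw [← hm] at hae
  rw [← hm', inner_neg_left] at hbe
  set W := m + m' with hW
  have hWpos : 0 < W := by
    by_contra h
    have h1 : W = 0 := le_antisymm (not_lt.1 h) (by positivity)
    rw [h1] at hcon
    linarith
  set P : Euc n := e - (m / t) • φ with hP
  have hPa : ∀ x, ⟪P, x⟫ = ⟪e, x⟫ - m / t * ⟪φ, x⟫ := fun x => by
    rw [hP, inner_sub_left, inner_smul_left]; simp
  have hmt : m / t * t = m := by field_simp
  refine H Ω v φ P a a b t W hC' ht ht1 hWpos ha.1 ha.2.1 haφ ?_ ?_ ha.1 ha.2.1 ha.2.2 hb.1 hb.2.1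
    hb.2.2 ?_
  · rw [hPa, hae, haφ, hmt]; linarith
  · intro x hx hx0 hxφ
    rw [hPa]
    refine le_trans ?_ (mul_le_mul_of_nonneg_right hεε0 hWpos.le)
    have hs0 := hC'.nonneg x hx hx0
    set s := ⟪φ, x⟫ with hs
    set k := m / t with hk
    have hk0 : 0 ≤ k := by positivity
    rcases le_total s (t / 2) with hst | hst
    · have hts : 0 < t - s := by linarith
      set μ := (t / 2) / (t - s) with hμ
      have hμts : μ * (t - s) = t / 2 := by rw [hμ]; field_simp
      have hμ2 : 1 / 2 ≤ μ := by rw [hμ, le_div_iff₀ hts]; linarith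
      have hμ1 : μ ≤ 1 := by rw [hμ, div_le_one hts]; linarith
      obtain ⟨h1, h2⟩ := hC'.convex_coin hx hx0 ha.1 ha.2.1 (by linarith : 0 ≤ μ)
        (sub_nonneg.2 hμ1) (by ring)
      have h3 : ⟪φ, μ • x + (1 - μ) • a⟫ = t / 2 := by
        rw [inner_add_right, inner_smul_right, inner_smul_right, haφ, ← hs]
        linarith
      have h4 := hC'.le_supp e (by linarith) (⟨h1, h2, h3.le⟩ : _ ∈ lowerPart Ω v φ (t / 2))
      rw [inner_add_right, inner_smul_right, inner_smul_right, hae] at h4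
      have h5 : μ * (⟪e, x⟫ - k * s) ≤ ε / 2 * W := by
        have : μ * (k * s) = k * (μ * s) := by ring
        have h6 : μ * s = μ * t - t / 2 := by linarith
        have h7 : k * (μ * s) = μ * m - m / 2 := by
          rw [h6]; linear_combination (μ - 1 / 2) * hmt
        linarith
      by_contra h8
      push Not at h8
      have h9 : 0 < ε * W := by positivity
      nlinarith
    · have hspos : 0 < s := by linarith
      set μ := (t / 2) / s with hμ
      have hμs : μ * s = t / 2 := by rw [hμ]; field_simp
      have hμ2 : 1 / 2 ≤ μ := by rw [hμ, le_div_iff₀ hspos]; linarith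
      have hμ1 : μ ≤ 1 := by rw [hμ, div_le_one hspos]; linarith
      obtain ⟨h1, h2⟩ := hC'.convex_coin hx hx0 hC'.zero_mem hC'.v_zero (by linarith : 0 ≤ μ)
        (sub_nonneg.2 hμ1) (by ring)
      have h3 : ⟪φ, μ • x + (1 - μ) • (0 : Euc n)⟫ = t / 2 := by
        rw [inner_add_right, inner_smul_right, smul_zero, inner_zero_right, ← hs]
        linarith
      have h4 := hC'.le_supp e (by linarith) (⟨h1, h2, h3.le⟩ : _ ∈ lowerPart Ω v φ (t / 2))
      rw [inner_add_right, inner_smul_right, smul_zero, inner_zero_right] at h4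
      have h5 : μ * (⟪e, x⟫ - k * s) ≤ ε / 2 * W := by
        have h7 : μ * (k * s) = m / 2 := by
          linear_combination k * hμs + hmt / 2
        linarith
      by_contra h8
      push Not at h8
      have h9 : 0 < ε * W := by positivity
      nlinarith
  · rw [inner_sub_right, hPa, hPa, hae, haφ, hbφ]; linarith

theorem epiConf_inner (n : ℕ) (hn : 0 < n) {q lam Lam ρ R : ℝ} (hq0 : 0 ≤ q) (hqn : q < n)
    (hlam : 0 < lam) (hLam : 0 < Lam) (hρ : 0 < ρ) (hR : 0 < R) :
    ∃ c γ : ℝ, 0 < c ∧ 0 < γ ∧ γ < 1 ∧ ∀ (Ω : Set (Euc n)) (v : Euc n → ℝ) (φ : Euc n),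
      EpiConf n q lam Lam ρ R Ω v φ → ∀ t x, 0 < t → t ≤ 1 → ⟪φ, x⟫ = 0 → ‖x‖ ≤ c * t ^ γ →
      x + t • φ ∈ Ω ∧ v (x + t • φ) = 0 := by
  obtain ⟨ε, hε, hε1, H⟩ := epiConf_half n hn hq0 hqn hlam hLam hρ hR
  obtain ⟨γ, hγ, hγe, hγ1⟩ := exists_rpow_eq (θ := 1 / 2) (a := (1 + ε) / 2) (by norm_num)
    (by norm_num) (by positivity) (by linarith)
  refine ⟨(1 / 2) ^ γ * (ε * ρ / 2), γ, by positivity, hγ, hγ1 (by linarith), ?_⟩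
  intro Ω v φ hC t x ht ht1 hxφ hx
  have hC' := hC.toConf
  have hlow : ∀ e : Euc n, ⟪e, φ⟫ = 0 →
      (1 / 2) ^ γ * (ε * ρ / 2) * t ^ γ * ‖e‖ ≤ supp Ω v φ e t := by
    intro e he
    have hstep : ∀ s, 0 < s → s ≤ 1 → (1 / 2 : ℝ) ^ γ * supp Ω v φ e s ≤
        supp Ω v φ e (1 / 2 * s) := by
      intro s hs hs1
      have h1 := H Ω v φ e s hC he hs hs1
      have h2 := hC'.supp_nonneg (-e) hs.le hs1
      have h3 : 0 ≤ ε / 2 * supp Ω v φ (-e) s := by positivity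
      rw [hγe, show 1 / 2 * s = s / 2 by ring]
      linarith
    have h1 := iterate_lower (f := supp Ω v φ e) (θ := 1 / 2) (γ := γ) (by norm_num)
      (by norm_num) hγ.le (hC'.supp_nonneg e zero_le_one le_rfl)
      (fun s t hs hst ht => hC'.supp_mono e hs.le hst ht) hstep ht ht1
    have h2 : ε * ρ / 2 * ‖e‖ ≤ supp Ω v φ e 1 := by
      have h3 := H Ω v φ e 1 hC he one_pos le_rfl
      have h4 := hC'.supp_mono e (s := 1 / 2) (t := 1) (by norm_num) (by norm_num) le_rfl
      have h5 := hC'.le_supp_one hρ e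
      have h6 := mul_le_mul_of_nonneg_left h5 hε.le
      have h7 := hC'.supp_nonneg e zero_le_one le_rfl
      linarith
    refine le_trans ?_ h1
    calc _ = (1 / 2) ^ γ * t ^ γ * (ε * ρ / 2 * ‖e‖) := by ring
      _ ≤ _ := by gcongr
  by_contra hcon
  have hnm : x + t • φ ∉ lowerPart Ω v φ t := fun h => hcon ⟨h.1, h.2.1⟩
  obtain ⟨f, u, hf1, hf2⟩ := geometric_hahn_banach_closed_point (hC'.convex_lowerPart t)
    (hC'.isCompact_lowerPart ht1).isClosed hnm
  set u0 := (InnerProductSpace.toDual ℝ (Euc n)).symm f with hu0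
  have hfu : ∀ w, f w = ⟪u0, w⟫ := fun w => by
    rw [hu0, InnerProductSpace.toDual_symm_apply]
  have hφφ : ⟪φ, φ⟫ = 1 := by rw [real_inner_self_eq_norm_sq, hC.unit]; norm_num
  set e := u0 - ⟪u0, φ⟫ • φ with he
  have hea : ∀ w, ⟪e, w⟫ = ⟪u0, w⟫ - ⟪u0, φ⟫ * ⟪φ, w⟫ := fun w => by
    rw [he, inner_sub_left, inner_smul_left]; simp
  have heφ : ⟪e, φ⟫ = 0 := by rw [hea, hφφ]; ring
  obtain ⟨a, ha, haφ, hae⟩ := hC.exists_top_eq_supp heφ ht.le ht1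
  have h1 := (hf1 a ha).trans hf2
  rw [hfu, hfu, inner_add_right, inner_smul_right] at h1
  have h2 := hlow e heφ
  rw [← hae, hea, haφ] at h2
  have h3 := real_inner_le_norm e x
  rw [hea, hxφ] at h3
  have h4 : ‖e‖ * ‖x‖ ≤ ‖e‖ * ((1 / 2) ^ γ * (ε * ρ / 2) * t ^ γ) := by gcongr
  linarith

theorem epiConf_outer (n : ℕ) (hn : 0 < n) {q lam Lam ρ R : ℝ} (hq0 : 0 ≤ q) (hqn : q < n)
    (hlam : 0 < lam) (hLam : 0 < Lam) (hρ : 0 < ρ) (hR : 0 < R) :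
    ∃ C γ : ℝ, 0 < C ∧ 0 < γ ∧ ∀ (Ω : Set (Euc n)) (v : Euc n → ℝ) (φ : Euc n),
      EpiConf n q lam Lam ρ R Ω v φ → ∀ t x, 0 < t → t ≤ 1 → x ∈ lowerPart Ω v φ t →
      ‖x - ⟪φ, x⟫ • φ‖ ≤ C * t ^ γ := by
  obtain ⟨ε, hε, hε1, H⟩ := epiConf_half n hn hq0 hqn hlam hLam hρ hR
  obtain ⟨ε1, hposε, H1⟩ := conf_flat_scaled n hn hq0 hqn hlam hLam hρ hR (C1 := 4 / ε)
    (by positivity)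
  obtain ⟨η, hη, hηh, hη1⟩ : ∃ η : ℝ, 0 < η ∧ η ≤ 1 / 2 ∧ 2 * η ≤ ε1 :=
    ⟨min (1 / 2) (ε1 / 2), by positivity, min_le_left _ _, by
      have := min_le_right (1 / 2) (ε1 / 2); linarith⟩
  obtain ⟨γ, hγ, hγe, -⟩ := exists_rpow_eq (θ := η) (a := 1 - η) hη
    (by linarith) (by linarith) (by linarith)
  refine ⟨(η ^ γ)⁻¹ * R, γ, by positivity, hγ, ?_⟩
  intro Ω v φ hC t x ht ht1 hx
  have hC' := hC.toConf
  have hφφ : ⟪φ, φ⟫ = 1 := by rw [real_inner_self_eq_norm_sq, hC.unit]; norm_num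
  set e := x - ⟪φ, x⟫ • φ with he
  have heφ : ⟪e, φ⟫ = 0 := by
    rw [he, inner_sub_left, inner_smul_left, hφφ, real_inner_comm]; simp
  have hee : ⟪e, x⟫ = ‖e‖ * ‖e‖ := by
    have : x = e + ⟪φ, x⟫ • φ := by rw [he]; abel
    conv_lhs => rw [this]
    rw [inner_add_right, inner_smul_right, heφ, real_inner_self_eq_norm_mul_norm]; ring
  have hstep : ∀ s, 0 < s → s ≤ 1 → supp Ω v φ e (η * s) ≤ η ^ γ * supp Ω v φ e s := by
    intro s hs hs1
    rw [hγe]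
    by_contra hcon
    push Not at hcon
    have hηs : η * s ≤ s := by nlinarith
    set m := supp Ω v φ e s with hm
    have hm0 : 0 ≤ m := hC'.supp_nonneg e hs.le hs1
    have hmpos : 0 < m := by
      refine hm0.lt_of_ne fun h0 => ?_
      have := hC'.supp_mono e (by positivity) hηs hs1
      rw [← hm, ← h0] at this
      rw [← h0] at hcon
      linarith
    obtain ⟨y, hy, hye⟩ := hC'.exists_eq_supp e (by positivity : 0 ≤ η * s) (hηs.trans hs1)
    refine H1 Ω v φ e y s (m / 2) hC' hs hs1 (by positivity) hy.1 hy.2.1 ?_ ?_ ?_ ?_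
    · refine hy.2.2.trans ?_
      gcongr; linarith
    · rw [hye]; nlinarith
    · intro w hw hw0 hwφ
      have h1 := hC'.le_supp e hs1 (⟨hw, hw0, hwφ⟩ : w ∈ lowerPart Ω v φ s)
      rw [hye]
      nlinarith
    · intro x1 hx1 hx10 hx1φ x2 hx2 hx20 hx2φ
      have h1 := hC'.le_supp e hs1 (⟨hx1, hx10, hx1φ⟩ : x1 ∈ lowerPart Ω v φ s)
      have h2 := hC'.le_supp (-e) hs1 (⟨hx2, hx20, hx2φ⟩ : x2 ∈ lowerPart Ω v φ s)
      have h3 := H Ω v φ e s hC heφ hs hs1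
      have h4 := hC'.supp_mono e (s := s / 2) (t := s) (by positivity) (by linarith) hs1
      rw [inner_neg_left] at h2
      rw [inner_sub_right]
      have h5 : 4 / ε * (m / 2) = 2 * m / ε := by ring
      rw [h5, le_div_iff₀ hε]
      have h6 := mul_le_mul_of_nonneg_left (add_le_add h1 h2) hε.le
      have h7 := hC'.supp_nonneg (-e) hs.le hs1
      nlinarith
  have h1 := iterate_upper (f := supp Ω v φ e) hη (by linarith) hγ.le
    (hC'.supp_nonneg e zero_le_one le_rfl)
    (fun s t hs hst ht => hC'.supp_mono e hs.le hst ht) hstep ht ht1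
  have h2 := hC'.le_supp e ht1 hx
  rw [hee] at h2
  have h3 := hC'.supp_one_le e
  have h4 : ‖e‖ * ‖e‖ ≤ ((η ^ γ)⁻¹ * R * t ^ γ) * ‖e‖ := by
    refine h2.trans (h1.trans ?_)
    calc _ ≤ (η ^ γ)⁻¹ * t ^ γ * (‖e‖ * R) := by gcongr
      _ = _ := by ring
  rcases (norm_nonneg e).eq_or_lt with h0 | h0
  · rw [← h0]; positivity
  · exact le_of_mul_le_mul_right h4 h0

/-- Subgradients near the origin point in the direction `-φ` and hence the supporting affine
functions are very negative at the level `1 / 2`. -/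
theorem epiConf_slope (n : ℕ) (hn : 0 < n) {q lam Lam ρ R : ℝ} (hq0 : 0 ≤ q) (hqn : q < n)
    (hlam : 0 < lam) (hLam : 0 < Lam) (hρ : 0 < ρ) (hR : 0 < R) {C0 : ℝ} (hC0 : 0 < C0) :
    ∃ c : ℝ, 0 < c ∧ ∀ (Ω : Set (Euc n)) (v : Euc n → ℝ) (φ : Euc n),
      EpiConf n q lam Lam ρ R Ω v φ → ∀ x ∈ Ω, ∀ p, ‖x‖ ≤ c → p ∈ subgrad Ω v x →
      ∀ y, ‖y‖ ≤ C0 → ⟪φ, y⟫ = 1 / 2 → v x + ⟪p, y - x⟫ ≤ -(‖p‖ / 4) := by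
  obtain ⟨c, γ, hc, hγ, hγ1, H⟩ := epiConf_inner n hn hq0 hqn hlam hLam hρ hR
  set ε : ℝ := 1 / (16 * (C0 + 1)) with hε
  have hεpos : 0 < ε := by positivity
  have hεC : ε * C0 ≤ 1 / 16 := by
    rw [hε, div_mul_eq_mul_div, div_le_div_iff₀ (by positivity) (by norm_num)]; linarith
  have hε16 : ε ≤ 1 / 16 := by
    rw [hε]; exact one_div_le_one_div_of_le (by norm_num) (by linarith)
  obtain ⟨t, ht, ht1, htt⟩ : ∃ t : ℝ, 0 < t ∧ t ≤ 1 ∧ t ≤ t ^ γ * (c * ε / 2) := by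
    set t0 := min 1 (c * ε / 2) with ht0
    have ht0pos : 0 < t0 := by positivity
    have hg : 0 < 1 - γ := by linarith
    have h1 : (t0 ^ (1 / (1 - γ))) ^ (1 - γ) = t0 := by
      rw [← Real.rpow_mul ht0pos.le, one_div_mul_cancel hg.ne', Real.rpow_one]
    refine ⟨t0 ^ (1 / (1 - γ)), by positivity,
      Real.rpow_le_one ht0pos.le (min_le_left _ _) (by positivity), ?_⟩
    set t := t0 ^ (1 / (1 - γ)) with ht
    have htpos : 0 < t := by positivity
    calc t = t ^ γ * t ^ (1 - γ) := by rw [← Real.rpow_add htpos]; simp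
      _ ≤ t ^ γ * (c * ε / 2) := by
        rw [h1]; exact mul_le_mul_of_nonneg_left (min_le_right _ _) (by positivity)
  set s := c * t ^ γ with hs
  have hspos : 0 < s := by positivity
  refine ⟨min (1 / 16) (s * ε / 2), by positivity, ?_⟩
  intro Ω v φ hC x hxΩ p hx hp y hy hyφ
  have hx1 := hx.trans (min_le_left _ _)
  have hx2 := hx.trans (min_le_right _ _)
  have hφφ : ⟪φ, φ⟫ = 1 := by rw [real_inner_self_eq_norm_sq, hC.unit]; norm_num
  have hK : ∀ k ∈ Ω, v k = 0 → v x + ⟪p, k⟫ - ⟪p, x⟫ ≤ 0 := by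
    intro k hk hk0
    have := hp k hk
    rw [hk0, inner_sub_right] at this
    linarith
  have hP0 : 0 ≤ ‖p‖ := norm_nonneg p
  have hpx : |⟪p, x⟫| ≤ ‖p‖ * ‖x‖ := abs_real_inner_le_norm p x
  have hpx' := abs_le.1 hpx
  have hpx1 : ‖p‖ * ‖x‖ ≤ ‖p‖ * (1 / 16) := by gcongr
  have hpx2 : ‖p‖ * ‖x‖ ≤ ‖p‖ * (s * ε / 2) := by gcongr
  have hv0 : v x ≤ ⟪p, x⟫ := by
    have := hK 0 hC.zero_mem hC.v_zero
    rw [inner_zero_right] at this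
    linarith
  have hvx : 0 ≤ v x := hC.v_nonneg hxΩ
  set a := -⟪p, φ⟫ with ha
  set b := p + a • φ with hb
  have hpb : p = b - a • φ := by rw [hb]; abel
  have hbφ : ⟪b, φ⟫ = 0 := by rw [hb, inner_add_left, inner_smul_left, hφφ]; simp [ha]
  have hapos : a ≤ ‖p‖ := by
    have := abs_le.1 (abs_real_inner_le_norm p φ)
    rw [hC.unit] at this
    linarith
  have haneg : -(‖p‖ * (1 / 16)) ≤ a := by
    have := H Ω v φ hC 1 0 one_pos le_rfl (by simp) (by simpa using by positivity)
    have h2 := hK _ this.1 this.2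
    simp only [one_smul, zero_add] at h2
    linarith
  have hbn : ‖b‖ ≤ ε * ‖p‖ := by
    rcases eq_or_ne b 0 with h0 | h0
    · rw [h0, norm_zero]; positivity
    · have hb0 : 0 < ‖b‖ := norm_pos_iff.2 h0
      have h1 := H Ω v φ hC t ((s / ‖b‖) • b) ht ht1
        (by rw [inner_smul_right, real_inner_comm, hbφ, mul_zero])
        (by rw [norm_smul, Real.norm_of_nonneg (by positivity), div_mul_cancel₀ _ hb0.ne'])
      have h2 := hK _ h1.1 h1.2
      have h3 : ⟪p, (s / ‖b‖) • b + t • φ⟫ = s * ‖b‖ - t * a := by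
        rw [inner_add_right, inner_smul_right, inner_smul_right]
        have : ⟪p, b⟫ = ‖b‖ ^ 2 := by
          rw [← real_inner_self_eq_norm_sq]
          nth_rewrite 1 [hpb]
          rw [inner_sub_left, inner_smul_left, real_inner_comm b φ, hbφ]; simp
        rw [this, ha]
        field_simp
        ring
      rw [h3] at h2
      have h4 : t * a ≤ t * ‖p‖ := by gcongr
      have h5 : t * ‖p‖ ≤ s * ε / 2 * ‖p‖ := by
        refine mul_le_mul_of_nonneg_right (htt.trans (le_of_eq ?_)) hP0
        rw [hs]; ring
      have h6 : s * ‖b‖ ≤ s * (ε * ‖p‖) := by linarith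
      exact le_of_mul_le_mul_left h6 hspos
  have hbn' : ‖b‖ ≤ 1 / 16 * ‖p‖ := hbn.trans (by gcongr)
  have hpn : ‖p‖ ≤ ‖b‖ + |a| := by
    calc ‖p‖ = ‖b - a • φ‖ := by rw [← hpb]
      _ ≤ ‖b‖ + ‖a • φ‖ := norm_sub_le _ _
      _ = ‖b‖ + |a| := by rw [norm_smul, hC.unit, mul_one, Real.norm_eq_abs]
  have ha15 : 15 / 16 * ‖p‖ ≤ a := by
    rcases abs_cases a with h | h <;> linarith [h.1, h.2]
  have hby : ⟪b, y⟫ ≤ 1 / 16 * ‖p‖ := by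
    calc ⟪b, y⟫ ≤ ‖b‖ * ‖y‖ := real_inner_le_norm _ _
      _ ≤ (ε * ‖p‖) * C0 := by gcongr
      _ = (ε * C0) * ‖p‖ := by ring
      _ ≤ _ := by gcongr
  have hpy : ⟪p, y⟫ = ⟪b, y⟫ - a * (1 / 2) := by
    nth_rewrite 1 [hpb]
    rw [inner_sub_left, inner_smul_left, hyφ]; simp
  rw [inner_sub_right, hpy]
  linarith

set_option maxHeartbeats 2000000 in
theorem epiConf_decay (n : ℕ) (hn : 0 < n) {q lam Lam ρ R : ℝ} (hq0 : 0 ≤ q) (hqn : q < n)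
    (hlam : 0 < lam) (hLam : 0 < Lam) (hρ : 0 < ρ) (hR : 0 < R) :
    ∃ η N c : ℝ, 0 < η ∧ η < 1 ∧ 1 < N ∧ 0 < c ∧
      ∀ (Ω : Set (Euc n)) (v : Euc n → ℝ) (φ : Euc n),
      EpiConf n q lam Lam ρ R Ω v φ → ∀ x z p, ‖x‖ ≤ c → ‖z‖ ≤ c → p ∈ subgrad Ω v x →
      ‖p‖ ≤ c → (v x = 0 ∧ p = 0 ∨ v (x + z) - v x - ⟪p, z⟫ ≤ v x) →
      v (x + N⁻¹ • z) - v x - N⁻¹ * ⟪p, z⟫ ≤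
        (1 - η) / N * (v (x + z) - v x - ⟪p, z⟫) := by
  obtain ⟨ε, hε, HS⟩ := section_lemma n hq0 hqn (ratio := Lam / lam) (C1 := 2) (k := 4)
    (by positivity) two_pos (by norm_num)
  obtain ⟨C0, hC01, HB⟩ := conf_bounded n hq0 hqn hlam hρ hR
  obtain ⟨c1, hc1, HL⟩ := epiConf_slope n hn hq0 hqn hlam hLam hρ hR
    (C0 := C0) (by linarith)
  obtain ⟨d0, hd0, HU⟩ := conf_upper_bound n hq0 hqn hlam hLam hρ hR
  have hT := tallC_pos n
  obtain ⟨η, hη, hη1, hη2, hη3⟩ : ∃ η : ℝ, 0 < η ∧ η ≤ 1 / 32 ∧ 512 * η ≤ ε ∧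
      tallC n * (8 * η) ≤ 1 := by
    refine ⟨min (1 / 32) (min (ε / 512) (1 / (8 * tallC n))), by positivity, min_le_left _ _,
      ?_, ?_⟩
    · have := (min_le_right (1 / 32) (min (ε / 512) (1 / (8 * tallC n)))).trans (min_le_left _ _)
      linarith
    · have := (min_le_right (1 / 32) (min (ε / 512) (1 / (8 * tallC n)))).trans (min_le_right _ _)
      rw [le_div_iff₀ (by positivity)] at this
      linarith
  obtain ⟨m, hm, hm1, hm2⟩ : ∃ m : ℝ, 0 < m ∧ m ≤ 1 / 8 ∧ 32 * m ≤ ε :=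
    ⟨min (1 / 8) (ε / 32), by positivity, min_le_left _ _, by
      have := min_le_right (1 / 8) (ε / 32); linarith⟩
  obtain ⟨c, hc, hcc1, hcd, hc8, hcs⟩ : ∃ c : ℝ, 0 < c ∧ 2 * c ≤ c1 ∧ 2 * c ≤ d0 ∧ c ≤ 1 / 9 ∧
      c * (4 / d0 + C0 + 3) ≤ 1 / 2 := by
    refine ⟨min (min (c1 / 2) (d0 / 2)) (min (1 / 9) (1 / (2 * (4 / d0 + C0 + 3)))), ?_, ?_, ?_,
      ?_, ?_⟩
    · positivity
    · have := (min_le_left (min (c1 / 2) (d0 / 2))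
        (min (1 / 9) (1 / (2 * (4 / d0 + C0 + 3))))).trans (min_le_left _ _)
      linarith
    · have := (min_le_left (min (c1 / 2) (d0 / 2))
        (min (1 / 9) (1 / (2 * (4 / d0 + C0 + 3))))).trans (min_le_right _ _)
      linarith
    · exact (min_le_right _ _).trans (min_le_left _ _)
    · have := (min_le_right (min (c1 / 2) (d0 / 2))
        (min (1 / 9) (1 / (2 * (4 / d0 + C0 + 3))))).trans (min_le_right _ _)
      rw [le_div_iff₀ (by positivity)] at this
      linarith
  have hc0 : 2 * c / d0 ≤ 1 / 4 := by
    have h1 : 0 ≤ c * (C0 + 3) := by positivity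
    have h2 : c * (4 / d0 + C0 + 3) = 2 * (2 * c / d0) + c * (C0 + 3) := by ring
    linarith
  refine ⟨η, m⁻¹, c, hη, by linarith, (one_lt_inv₀ hm).2 (by linarith), hc, ?_⟩
  intro Ω v φ hC x z p hx hz hp hpc halt
  have hC' := hC.toConf
  rw [inv_inv, div_inv_eq_mul]
  -- basic facts on a neighbourhood of the origin
  have hsmall : ∀ y : Euc n, ‖y‖ ≤ 2 * c → y ∈ Ω ∧ v y ≤ 2 * c / d0 ∧ ⟪φ, y⟫ < 1 / 2 := by
    intro y hy
    obtain ⟨h1, -, h3⟩ := HU Ω v φ hC' 0 hC.zero_mem hC.v_zero (by simp) y (hy.trans hcd)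
    rw [zero_add] at h1 h3
    refine ⟨h1, h3.trans (by gcongr), ?_⟩
    have := real_inner_le_norm φ y
    rw [hC.unit] at this
    linarith
  have hseg : ∀ s : ℝ, 0 ≤ s → s ≤ 1 → ‖x + s • z‖ ≤ 2 * c := by
    intro s hs hs1
    calc ‖x + s • z‖ ≤ ‖x‖ + s * ‖z‖ := by
          refine (norm_add_le _ _).trans (by rw [norm_smul, Real.norm_of_nonneg hs])
      _ ≤ ‖x‖ + 1 * ‖z‖ := by gcongr
      _ ≤ 2 * c := by linarith
  have hxΩ : x ∈ Ω := (hsmall x (by linarith)).1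
  by_contra hcon
  push Not at hcon
  set G1 := v (x + z) - v x - ⟪p, z⟫ with hG1
  have hconv := hC'.convexOn
  have hgs : ∀ s : ℝ, 0 ≤ s → s ≤ 1 → v (x + s • z) ≤ v x + s * ⟪p, z⟫ + s * G1 := by
    intro s hs hs1
    have h1 := hconv.2 hxΩ (hsmall (x + z) (by simpa using hseg 1 zero_le_one le_rfl)).1
      (sub_nonneg.2 hs1) hs (by ring)
    have h2 : (1 - s) • x + s • (x + z) = x + s • z := by module
    rw [h2] at h1
    simp only [smul_eq_mul] at h1
    have : v (x + z) = G1 + v x + ⟪p, z⟫ := by rw [hG1]; ring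
    rw [this] at h1
    linarith
  set x' := x + m • z with hx'
  have hx'n : ‖x'‖ ≤ 2 * c := hseg m hm.le (by linarith)
  have hx'Ω : x' ∈ Ω := (hsmall x' hx'n).1
  obtain ⟨p', hp'⟩ := exists_mem_subgrad hC.isOpen hC.gen.1 hconv hx'Ω
  set g := v x' - v x - m * ⟪p, z⟫ with hg
  have hgm : g ≤ m * G1 := by
    have := hgs m hm.le (by linarith)
    rw [hg]; linarith
  have hG1pos : 0 < G1 := by
    have h1 : 0 < η * m * G1 := by nlinarith
    exact pos_of_mul_pos_right h1 (by positivity)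
  set A : Euc n → ℝ := fun y => (v x' + ⟪p', y - x'⟫) - (v x + ⟪p, y - x⟫) with hA
  set β := ⟪p', z⟫ - ⟪p, z⟫ with hβ
  have hAs : ∀ s : ℝ, A (x + s • z) = g + (s - m) * β := by
    intro s
    simp only [hA]
    rw [show x + s • z - x' = (s - m) • z by rw [hx']; module, add_sub_cancel_left,
      inner_smul_right, inner_smul_right, hg, hβ]
    ring
  have hAle : ∀ y ∈ Ω, A y ≤ v y - (v x + ⟪p, y - x⟫) := fun y hy => by
    have := hp' y hy
    simp only [hA]; linarith
  have hA0 : A x ≤ 0 := by simpa using hAle x hxΩ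
  have hA0' : A x = g - m * β := by
    have := hAs 0
    rw [zero_smul, add_zero] at this
    rw [this]; ring
  have hA1 : g + (1 - m) * β ≤ G1 := by
    have h1 := hAle (x + z) (hsmall (x + z) (by simpa using hseg 1 zero_le_one le_rfl)).1
    have h2 := hAs 1
    rw [one_smul] at h2
    rw [h2, add_sub_cancel_left] at h1
    rw [hG1]; linarith
  have hAx' : A x' = g := by simpa [hx'] using hAs m
  have hβlow : (1 - η) * G1 ≤ β := by
    have : m * ((1 - η) * G1) ≤ m * β := by linarith
    exact le_of_mul_le_mul_left this hm
  have hAxlow : -(2 * η * G1) ≤ A x := by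
    rw [hA0']
    have h2 : (1 - m) * (β - G1 - 2 * η * G1) ≤ 0 := by nlinarith
    have h3 : β - G1 - 2 * η * G1 ≤ 0 := nonpos_of_mul_nonpos_right h2 (by linarith)
    have h4 : m * β ≤ m * (G1 + 2 * η * G1) := by gcongr; linarith
    have h5 : 0 ≤ η * G1 := by positivity
    have h6 : m * (η * G1) ≤ 1 / 8 * (η * G1) := by gcongr
    nlinarith
  have hηG : 0 < η * G1 := by positivity
  set κ := 16 * η with hκ
  set hh := 8 * η * G1 with hhh
  set al := (v x - ⟪p, x⟫) + (1 - κ) * ((v x' - ⟪p', x'⟫) - (v x - ⟪p, x⟫)) + hh with hal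
  set pl := p + (1 - κ) • (p' - p) with hpl
  have hl : ∀ y, al + ⟪pl, y⟫ = (v x + ⟪p, y - x⟫) + (1 - κ) * A y + hh := by
    intro y
    simp only [hal, hpl, hA, inner_add_left, inner_smul_left, inner_sub_left, inner_sub_right]
    simp
    ring
  have hlow : ∀ y ∈ Ω, v x + ⟪p, y - x⟫ ≤ v y := fun y hy => hp y hy
  set S := cutSet Ω v φ (1 / 2) al pl with hS
  have hAlt : ∀ y ∈ Ω, v y < al + ⟪pl, y⟫ → A y < G1 / 2 := by
    intro y hy hlt
    rw [hl] at hlt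
    have h1 := hAle y hy
    have h2 : κ * A y < hh := by linarith
    have h3 : (16 * η) * (A y) < (16 * η) * (G1 / 2) := by
      rw [hκ, hhh] at h2; linarith
    exact lt_of_mul_lt_mul_left h3 (by positivity)
  have hAgt : ∀ y ∈ Ω, v y < al + ⟪pl, y⟫ → -(2 * hh) < A y := by
    intro y hy hlt
    rw [hl] at hlt
    have h1 := hlow y hy
    have h2 : 0 < (1 - κ) * A y + hh := by linarith
    by_contra h3
    push Not at h3
    have h4 : (1 - κ) * A y ≤ 1 / 2 * A y := by
      refine mul_le_mul_of_nonpos_right (by rw [hκ]; linarith) ?_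
      linarith
    linarith
  have hdepth : ∀ y ∈ S, al + ⟪pl, y⟫ - v y ≤ hh := by
    intro y hy
    rw [hl]
    have h1 := hAle y hy.1
    have h2 := hlow y hy.1
    have h3 := mul_nonneg (by rw [hκ]; linarith : 0 ≤ 1 - κ) (sub_nonneg.2 h1)
    have h4 := mul_nonneg (by positivity : 0 ≤ κ) (sub_nonneg.2 h2)
    nlinarith
  have hvx4 : v x ≤ 1 / 4 := ((hsmall x (by linarith)).2.1).trans hc0
  have hvx0 : 0 ≤ v x := hC'.v_nonneg hxΩ
  have hG1le : G1 ≤ 2 * c / d0 + c * c := by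
    have h1 := (hsmall (x + z) (by simpa using hseg 1 zero_le_one le_rfl)).2.1
    have h2 := abs_le.1 (abs_real_inner_le_norm p z)
    have h3 : ‖p‖ * ‖z‖ ≤ c * c := by gcongr
    rw [hG1]; linarith
  have hsec : IsSection n q lam Lam Ω v S al pl hh := by
    refine hC'.isSection_cutSet (by norm_num) ?_ hdepth
    intro y hy hlt
    obtain ⟨h1, h2, h3, h4⟩ := hC'.closure_cutSet (by norm_num) _ _ hy
    have hyn := HB Lam Ω v φ hC' y h1 h2 (by linarith)
    constructor
    · have h5 := hAlt y h1 hlt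
      rw [hl] at hlt
      have h6 := abs_le.1 (abs_real_inner_le_norm p (y - x))
      have h7 : ‖p‖ * ‖y - x‖ ≤ c * (C0 + 1) := by
        have := norm_sub_le y x
        gcongr
        linarith
      have h8 : (1 - κ) * A y ≤ G1 / 2 := by
        rcases le_total 0 (A y) with h | h
        · have : κ * A y ≥ 0 := by positivity
          linarith
        · have := mul_nonpos_of_nonneg_of_nonpos (by rw [hκ]; linarith : 0 ≤ 1 - κ) h
          linarith
      have h9 : hh ≤ G1 / 2 := by rw [hhh]; nlinarith
      have h10 : v x ≤ 2 * c / d0 := (hsmall x (by linarith)).2.1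
      have h11 : c * c ≤ c * 1 := by gcongr; linarith
      have h12 : c * (4 / d0 + C0 + 3) = 2 * (2 * c / d0) + c * (C0 + 3) := by ring
      linarith
    · refine lt_of_le_of_ne h3 fun h5 => ?_
      have h6 := HL Ω v φ hC x hxΩ p (by linarith) hp y hyn h5
      have h7 := HL Ω v φ hC x' hx'Ω p' (by linarith) hp' y hyn h5
      rw [hl] at hlt
      have h8 : (v x + ⟪p, y - x⟫) + (1 - κ) * A y =
          κ * (v x + ⟪p, y - x⟫) + (1 - κ) * (v x' + ⟪p', y - x'⟫) := by
        simp only [hA]; ring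
      have h9 : κ * (v x + ⟪p, y - x⟫) ≤ κ * (-(‖p‖ / 4)) := by gcongr
      have h10 : (1 - κ) * (v x' + ⟪p', y - x'⟫) ≤ κ * (-(‖p'‖ / 4)) := by
        have : (1 - κ) * (v x' + ⟪p', y - x'⟫) ≤ (1 - κ) * (-(‖p'‖ / 4)) := by
          gcongr; rw [hκ]; linarith
        have h11 : 0 ≤ (1 - 2 * κ) * ‖p'‖ := mul_nonneg (by rw [hκ]; linarith) (norm_nonneg _)
        linarith
      have h11 : G1 / 2 ≤ (‖p‖ + ‖p'‖) * c := by
        have e1 := abs_le.1 (abs_real_inner_le_norm p z)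
        have e2 := abs_le.1 (abs_real_inner_le_norm p' z)
        have e3 : ‖p‖ * ‖z‖ ≤ ‖p‖ * c := by gcongr
        have e4 : ‖p'‖ * ‖z‖ ≤ ‖p'‖ * c := by gcongr
        have e5 : β ≤ ‖p‖ * ‖z‖ + ‖p'‖ * ‖z‖ := by rw [hβ]; linarith
        nlinarith
      have h12 : G1 / 2 ≤ (‖p‖ + ‖p'‖) * (1 / 9) :=
        h11.trans (by gcongr)
      have h13 := hC'.v_nonneg h1
      have h14 : κ * (9 / 2 * G1) ≤ κ * (‖p‖ + ‖p'‖) := by gcongr; linarith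
      rw [h8] at hlt
      have h15 : hh = κ * G1 / 2 := by rw [hhh, hκ]; ring
      have h16 : 0 < κ * G1 := by positivity
      linarith
  have hx'S : x' ∈ S := by
    obtain ⟨h1, h2, h3⟩ := hsmall x' hx'n
    refine ⟨h1, by linarith, h3, ?_⟩
    rw [hl, hAx', hx', add_sub_cancel_left, inner_smul_right, ← hx']
    have : v x' = g + v x + m * ⟪p, z⟫ := by rw [hg]; ring
    rw [this, hκ, hhh]
    have : η * g ≤ η * (1 / 8 * G1) := by gcongr; exact hgm.trans (by gcongr)
    linarith
  have hx'd : hh ≤ 2 * (al + ⟪pl, x'⟫ - v x') := by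
    rw [hl, hAx', hx', add_sub_cancel_left, inner_smul_right, ← hx']
    have : v x' = g + v x + m * ⟪p, z⟫ := by rw [hg]; ring
    rw [this, hκ, hhh]
    have : η * g ≤ η * (1 / 8 * G1) := by gcongr; exact hgm.trans (by gcongr)
    linarith
  set x1 := x + (1 / 4 : ℝ) • z with hx1
  have hAx1 : A x1 = g + (1 / 4 - m) * β := hAs _
  have hAx1' : A x1 = A x + 1 / 4 * β := by rw [hAx1, hA0']; ring
  have hv1 := hgs (1 / 4) (by norm_num) (by norm_num)
  rw [← hx1] at hv1
  have hx1n := hsmall x1 (hseg _ (by norm_num) (by norm_num))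
  have hinx1 : ⟪p, x1 - x⟫ = 1 / 4 * ⟪p, z⟫ := by
    rw [hx1, add_sub_cancel_left, inner_smul_right]
  have hAx1low : G1 / 4 - 9 / 4 * (η * G1) ≤ A x1 := by
    rw [hAx1']; linarith
  have hx1S : x1 ∈ S := by
    refine ⟨hx1n.1, by linarith, hx1n.2.2, ?_⟩
    rw [hl, hinx1]
    have h1 := hAle x1 hx1n.1
    rw [hinx1] at h1
    have h2 : A x1 ≤ G1 / 4 := by linarith
    have h3 : η * A x1 ≤ η * (G1 / 4) := by gcongr
    rw [hκ, hhh]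
    linarith
  refine HS lam Lam Ω v S al pl hh x' (-(p' - p)) (2 * hh + m * G1) (G1 / 16) hlam hLam.le
    (by rw [div_mul_cancel₀ _ hlam.ne']) hsec hx'S hx'd (by positivity) ?_ ?_ ?_ ?_
  · intro y hy
    have h1 : ⟪-(p' - p), y - x'⟫ = -(A y - A x') := by
      simp only [hA, inner_neg_left, inner_sub_left, inner_sub_right]; ring
    rw [h1, hAx']
    have := hAgt y hy.1 hy.2.2.2
    linarith
  · refine ⟨x1, hx1S, ?_⟩
    have h1 : ⟪-(p' - p), x1 - x'⟫ = -(A x1 - A x') := by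
      simp only [hA, inner_neg_left, inner_sub_left, inner_sub_right]; ring
    rw [h1, hAx', hAx1]
    have : 1 / 8 * (1 / 2 * G1) ≤ (1 / 4 - m) * β := by
      have : 1 / 2 * G1 ≤ (1 - η) * G1 := by gcongr; linarith
      gcongr <;> linarith
    linarith
  · have h1 : 512 * η * G1 ≤ ε * G1 := by gcongr
    have h2 : 32 * m * G1 ≤ ε * G1 := by gcongr
    rw [hhh]; linarith
  · rcases halt with ⟨hv, hp0⟩ | hle
    · right
      have hAy : ∀ y, A y = v x' + ⟪p', y⟫ - ⟪p', x'⟫ := fun y => by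
        simp only [hA, hv, hp0, inner_zero_left, inner_sub_right]; ring
      refine ⟨p', ⟪p', x'⟫ - v x', G1 / 8, by positivity, ?_, ⟨x1, hx1S, ?_⟩, ?_⟩
      · intro y hy hy0
        have h1 := hp' y hy.1
        rw [hy0, inner_sub_right] at h1
        linarith
      · have h1 := hAy x1
        have : η * G1 ≤ 1 / 32 * G1 := by gcongr
        linarith
      · intro y hy
        have h1 := hAlt y hy.1 hy.2.2.2
        have h2 := hAgt y hy.1 hy.2.2.2
        have h3 : η * G1 ≤ 1 / 32 * G1 := by gcongr
        rw [hAy] at h1 h2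
        rw [hhh] at h2
        constructor <;> linarith
    · left
      refine ⟨x, ⟨hxΩ, by linarith, (hsmall x (by linarith)).2.2, ?_⟩, ?_⟩
      · rw [hl, sub_self, inner_zero_right]
        have : (1 - κ) * (-(2 * η * G1)) ≤ (1 - κ) * A x := by
          gcongr; rw [hκ]; linarith
        have h5 : 0 ≤ κ * (2 * η * G1) := by positivity
        rw [hhh]; linarith
      · rw [hl, sub_self, inner_zero_right]
        have : (1 - κ) * (-(2 * η * G1)) ≤ (1 - κ) * A x := by
          gcongr; rw [hκ]; linarith
        have h5 : 0 ≤ κ * (2 * η * G1) := by positivity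
        have h6 : tallC n * (8 * η) * G1 ≤ 1 * G1 := by gcongr
        rw [hhh] at *; linarith

theorem epiConf_iterate (n : ℕ) (hn : 0 < n) {q lam Lam ρ R : ℝ} (hq0 : 0 ≤ q) (hqn : q < n)
    (hlam : 0 < lam) (hLam : 0 < Lam) (hρ : 0 < ρ) (hR : 0 < R) :
    ∃ C α c : ℝ, 0 < C ∧ 0 < α ∧ 0 < c ∧ ∀ (Ω : Set (Euc n)) (v : Euc n → ℝ) (φ : Euc n),
      EpiConf n q lam Lam ρ R Ω v φ → ∀ x z p, ‖x‖ ≤ c → ‖z‖ ≤ c → p ∈ subgrad Ω v x →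
      ‖p‖ ≤ c → (v x = 0 ∧ p = 0 ∨ v (x + z) - v x - ⟪p, z⟫ ≤ v x) →
      ∀ t : ℝ, 0 < t → t ≤ 1 →
      v (x + t • z) - v x - t * ⟪p, z⟫ ≤
        C * t ^ (1 + α) * (v (x + z) - v x - ⟪p, z⟫) := by
  obtain ⟨η, N, c, hη, hη1, hN, hc, H⟩ := epiConf_decay n hn hq0 hqn hlam hLam hρ hR
  obtain ⟨d0, hd0, HU⟩ := conf_upper_bound n hq0 hqn hlam hLam hρ hR
  have hN0 : 0 < N := by linarith
  have hθ : 0 < N⁻¹ := by positivity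
  have hθ1 : N⁻¹ < 1 := inv_lt_one_of_one_lt₀ hN
  have ha : 0 < (1 - η) / N := div_pos (by linarith) hN0
  have haθ : (1 - η) / N < N⁻¹ := by
    rw [div_eq_mul_inv]; exact mul_lt_of_lt_one_left hθ (by linarith)
  obtain ⟨γ, hγ, hγe, -⟩ := exists_rpow_eq hθ hθ1 ha (haθ.trans hθ1)
  have hγ1 : 1 < γ := by
    rw [← Real.rpow_lt_rpow_left_iff_of_base_lt_one hθ hθ1, Real.rpow_one, hγe]; exact haθ
  refine ⟨(N⁻¹ ^ γ)⁻¹, γ - 1, min c (d0 / 2), by positivity, by linarith, by positivity, ?_⟩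
  intro Ω v φ hC x z p hx hz hp hpc halt t ht ht1
  have hC' := hC.toConf
  rw [add_sub_cancel]
  have hΩ : ∀ s : ℝ, 0 ≤ s → s ≤ 1 → x + s • z ∈ Ω := by
    intro s hs hs1
    have := (HU Ω v φ hC' 0 hC.zero_mem hC.v_zero (by simp) (x + s • z) ?_).1
    · rwa [zero_add] at this
    · have h1 := hx.trans (min_le_right _ _)
      have h2 := hz.trans (min_le_right _ _)
      calc ‖x + s • z‖ ≤ ‖x‖ + s * ‖z‖ := by
            refine (norm_add_le _ _).trans (by rw [norm_smul, Real.norm_of_nonneg hs])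
        _ ≤ ‖x‖ + 1 * ‖z‖ := by gcongr
        _ ≤ d0 := by linarith
  set f : ℝ → ℝ := fun s => v (x + s • z) - v x - s * ⟪p, z⟫ with hf
  have hf1 : f 1 = v (x + z) - v x - ⟪p, z⟫ := by simp [hf]
  have hf0 : ∀ s : ℝ, 0 ≤ s → s ≤ 1 → 0 ≤ f s := by
    intro s hs hs1
    have := hp _ (hΩ s hs hs1)
    rw [add_sub_cancel_left, inner_smul_right] at this
    simp only [hf]; linarith
  have hmono : ∀ s t, 0 < s → s ≤ t → t ≤ 1 → f s ≤ f t := by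
    intro s t hs hst ht1
    have ht : 0 < t := hs.trans_le hst
    have h0 : x ∈ Ω := by simpa using hΩ 0 le_rfl zero_le_one
    have hdiv : s / t ≤ 1 := (div_le_one ht).2 hst
    have h1 := hC'.convexOn.2 h0 (hΩ t ht.le ht1) (sub_nonneg.2 hdiv)
      (by positivity : 0 ≤ s / t) (by ring)
    have h2 : (1 - s / t) • x + (s / t) • (x + t • z) = x + s • z := by
      have : s / t * t = s := by field_simp
      rw [smul_add, smul_smul, this]; module
    rw [h2] at h1
    simp only [smul_eq_mul] at h1
    have h3 : f s ≤ s / t * f t := by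
      simp only [hf]
      have : s / t * (t * ⟪p, z⟫) = s * ⟪p, z⟫ := by field_simp
      linarith
    have h4 := mul_le_mul_of_nonneg_right hdiv (hf0 t ht.le ht1)
    linarith
  have hstep : ∀ s, 0 < s → s ≤ 1 → f (N⁻¹ * s) ≤ N⁻¹ ^ γ * f s := by
    intro s hs hs1
    have h1 := H Ω v φ hC x (s • z) p (hx.trans (min_le_left _ _)) ?_ hp
      (hpc.trans (min_le_left _ _)) ?_
    · rw [inner_smul_right, smul_smul] at h1
      rw [hγe]
      simp only [hf]
      linarith
    · rw [norm_smul, Real.norm_of_nonneg hs.le]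
      calc s * ‖z‖ ≤ 1 * ‖z‖ := by gcongr
        _ ≤ c := by rw [one_mul]; exact hz.trans (min_le_left _ _)
    · refine halt.imp_right fun h => ?_
      rw [inner_smul_right]
      have := hmono s 1 hs hs1 le_rfl
      rw [hf1] at this
      exact this.trans h
  have := iterate_upper (f := f) hθ hθ1 hγ.le (hf0 1 zero_le_one le_rfl) hmono hstep ht ht1
  rw [hf1] at this
  exact this

theorem epiConf_growth (n : ℕ) (hn : 0 < n) {q lam Lam ρ R : ℝ} (hq0 : 0 ≤ q) (hqn : q < n)
    (hlam : 0 < lam) (hLam : 0 < Lam) (hρ : 0 < ρ) (hR : 0 < R) :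
    ∃ C α c : ℝ, 0 < C ∧ 0 < α ∧ 0 < c ∧ ∀ (Ω : Set (Euc n)) (v : Euc n → ℝ) (φ : Euc n),
      EpiConf n q lam Lam ρ R Ω v φ → ∀ x z, ‖x‖ ≤ c → ‖z‖ ≤ c → v x = 0 →
      v (x + z) ≤ C * ‖z‖ ^ (1 + α) := by
  obtain ⟨C, α, c, hCpos, hα, hc, H⟩ := epiConf_iterate n hn hq0 hqn hlam hLam hρ hR
  obtain ⟨d0, hd0, HU⟩ := conf_upper_bound n hq0 hqn hlam hLam hρ hR
  obtain ⟨b, hb, hbc, hbd⟩ : ∃ b : ℝ, 0 < b ∧ b ≤ c ∧ 2 * b ≤ d0 :=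
    ⟨min c (d0 / 2), by positivity, min_le_left _ _, by
      have := min_le_right c (d0 / 2); linarith⟩
  refine ⟨C * (1 / b) ^ (1 + α), α, b, by positivity, hα, hb, ?_⟩
  intro Ω v φ hC x z hx hz hx0
  have hC' := hC.toConf
  have hv : ∀ y : Euc n, ‖y‖ ≤ d0 → y ∈ Ω ∧ v y ≤ 1 := by
    intro y hy
    obtain ⟨h1, -, h3⟩ := HU Ω v φ hC' 0 hC.zero_mem hC.v_zero (by simp) y hy
    rw [zero_add] at h1 h3
    exact ⟨h1, h3.trans ((div_le_one hd0).2 hy)⟩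
  rcases eq_or_ne z 0 with rfl | hz0
  · rw [add_zero, hx0]; positivity
  have hzn : 0 < ‖z‖ := norm_pos_iff.2 hz0
  have h0 : (0 : Euc n) ∈ subgrad Ω v x := fun y hy => by
    rw [hx0, inner_zero_left, add_zero]; exact hC'.v_nonneg hy
  have hz1 : ‖(b / ‖z‖) • z‖ = b := by
    rw [norm_smul, Real.norm_of_nonneg (by positivity), div_mul_cancel₀ _ hzn.ne']
  have h1 := H Ω v φ hC x ((b / ‖z‖) • z) 0 (hx.trans hbc) (hz1.le.trans hbc) h0
    (by rw [norm_zero]; exact hc.le) (Or.inl ⟨hx0, rfl⟩) (‖z‖ / b) (by positivity)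
    ((div_le_one hb).2 hz)
  have h2 : (‖z‖ / b) • (b / ‖z‖) • z = z := by
    rw [smul_smul, show ‖z‖ / b * (b / ‖z‖) = 1 by field_simp, one_smul]
  rw [h2, hx0, inner_zero_left] at h1
  have h3 := (hv (x + (b / ‖z‖) • z) ((norm_add_le _ _).trans (by rw [hz1]; linarith))).2
  calc v (x + z) ≤ C * (‖z‖ / b) ^ (1 + α) * v (x + (b / ‖z‖) • z) := by simpa using h1
    _ ≤ C * (‖z‖ / b) ^ (1 + α) * 1 := by gcongr
    _ = _ := by rw [div_eq_mul_one_div, Real.mul_rpow hzn.le (by positivity)]; ring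

theorem epiConf_norm_subgrad_le (n : ℕ) (hn : 0 < n) {q lam Lam ρ R : ℝ} (hq0 : 0 ≤ q)
    (hqn : q < n) (hlam : 0 < lam) (hLam : 0 < Lam) (hρ : 0 < ρ) (hR : 0 < R) :
    ∃ C α c : ℝ, 0 < C ∧ 0 < α ∧ 0 < c ∧ ∀ (Ω : Set (Euc n)) (v : Euc n → ℝ) (φ : Euc n),
      EpiConf n q lam Lam ρ R Ω v φ → ∀ x k p r, x ∈ Ω → ‖k‖ ≤ c → v k = 0 →
      p ∈ subgrad Ω v x → 0 < r → r ≤ c → ‖x - k‖ ≤ r → ‖p‖ ≤ C * r ^ α := by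
  obtain ⟨C, α, c, hCpos, hα, hc, H⟩ := epiConf_growth n hn hq0 hqn hlam hLam hρ hR
  obtain ⟨d0, hd0, HU⟩ := conf_upper_bound n hq0 hqn hlam hLam hρ hR
  obtain ⟨b, hb, hbc, hbd⟩ : ∃ b : ℝ, 0 < b ∧ 2 * b ≤ c ∧ 3 * b ≤ d0 :=
    ⟨min (c / 2) (d0 / 3), by positivity, by
      have := min_le_left (c / 2) (d0 / 3); linarith, by
      have := min_le_right (c / 2) (d0 / 3); linarith⟩
  refine ⟨C * 2 ^ (1 + α), α, b, by positivity, hα, hb, ?_⟩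
  intro Ω v φ hC x k p r hx hk hk0 hp hr hrb hxk
  have hC' := hC.toConf
  have h1 : r * ‖p‖ ≤ C * (2 * r) ^ (1 + α) := by
    refine norm_le_of_inner_le hr fun w hw => ?_
    have hn1 : ‖x - k + w‖ ≤ 2 * r := (norm_add_le _ _).trans (by linarith)
    have hkw : k + (x - k + w) = x + w := by abel
    have hxw : ‖x + w‖ ≤ d0 := by
      rw [← hkw]; exact (norm_add_le _ _).trans (by linarith)
    have h2 := (HU Ω v φ hC' 0 hC.zero_mem hC.v_zero (by simp) (x + w) hxw).1
    rw [zero_add] at h2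
    have h3 := hp _ h2
    have h4 := H Ω v φ hC k (x - k + w) (by linarith) (by linarith) hk0
    rw [hkw] at h4
    rw [add_sub_cancel_left] at h3
    have h5 := hC'.v_nonneg hx
    calc ⟪p, w⟫ ≤ C * ‖x - k + w‖ ^ (1 + α) := by linarith
      _ ≤ _ := by gcongr
  have h2 : C * (2 * r) ^ (1 + α) = r * (C * 2 ^ (1 + α) * r ^ α) := by
    rw [Real.mul_rpow (by norm_num) hr.le, Real.rpow_add hr, Real.rpow_one]; ring
  rw [h2] at h1
  exact le_of_mul_le_mul_left h1 hr

theorem exists_pos_mul_rpow_le {C α ε : ℝ} (hC : 0 < C) (hα : 0 < α) (hε : 0 < ε) :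
    ∃ c : ℝ, 0 < c ∧ C * c ^ α ≤ ε := by
  refine ⟨(ε / C) ^ (1 / α), by positivity, ?_⟩
  rw [← Real.rpow_mul (by positivity), one_div_mul_cancel hα.ne', Real.rpow_one]
  exact (mul_div_cancel₀ _ hC.ne').le

theorem epiConf_small_slope (n : ℕ) (hn : 0 < n) {q lam Lam ρ R : ℝ} (hq0 : 0 ≤ q)
    (hqn : q < n) (hlam : 0 < lam) (hLam : 0 < Lam) (hρ : 0 < ρ) (hR : 0 < R) {ε : ℝ}
    (hε : 0 < ε) :
    ∃ c : ℝ, 0 < c ∧ ∀ (Ω : Set (Euc n)) (v : Euc n → ℝ) (φ : Euc n),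
      EpiConf n q lam Lam ρ R Ω v φ → ∀ x p, x ∈ Ω → ‖x‖ ≤ c → p ∈ subgrad Ω v x → ‖p‖ ≤ ε := by
  obtain ⟨C, α, c, hCpos, hα, hc, H⟩ := epiConf_norm_subgrad_le n hn hq0 hqn hlam hLam hρ hR
  obtain ⟨b, hb, hbε⟩ := exists_pos_mul_rpow_le hCpos hα hε
  refine ⟨min b c, by positivity, ?_⟩
  intro Ω v φ hC x p hx hxc hp
  refine (H Ω v φ hC x 0 p (min b c) hx (by simpa using hc.le) hC.v_zero hp (by positivity)
    (min_le_right _ _) (by simpa using hxc)).trans (le_trans ?_ hbε)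
  gcongr
  exact min_le_left _ _

theorem ndExp_pos {n : ℕ} (hn : 0 < n) {q : ℝ} (hqn : q < n) : 0 < ndExp n q := by
  have : (0 : ℝ) < n - q := by linarith
  have : (0 : ℝ) < n := by exact_mod_cast hn
  unfold ndExp; positivity

theorem epiConf_lower_bound (n : ℕ) {q lam Lam ρ R : ℝ} (hq0 : 0 ≤ q)
    (hqn : q < n) (hlam : 0 < lam) (hρ : 0 < ρ) (hR : 0 < R) :
    ∃ c : ℝ, 0 < c ∧ ∀ (Ω : Set (Euc n)) (v : Euc n → ℝ) (φ : Euc n),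
      EpiConf n q lam Lam ρ R Ω v φ → ∀ x ∈ Ω, ‖x‖ ≤ 1 → ∀ δ, 0 < δ → δ ≤ 1 →
      (∀ k ∈ Ω, v k = 0 → ⟪φ, k⟫ ≤ 1 → δ ≤ ‖k - x‖) → c * δ ^ ndExp n q ≤ v x := by
  obtain ⟨c, hc, H⟩ := conf_lower_bound n hq0 hqn hlam hρ (R1 := 1 + R) (by positivity)
  refine ⟨c, hc, ?_⟩
  intro Ω v φ hC x hx hx1 δ hδ hδ1 hk
  obtain ⟨z, hz⟩ := hC.inner_ball
  have hzz := hz z (mem_ball_self hρ)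
  have hzR := hC.bdd z hzz.1 hzz.2.1 hzz.2.2
  refine H Lam R Ω v φ hC.toConf z hz x hx ?_ ((norm_sub_le _ _).trans (by linarith)) δ hδ hδ1 hk
  have := real_inner_le_norm φ x
  rw [hC.unit] at this
  linarith

theorem epiConf_exists_nearest {n : ℕ} {q lam Lam ρ R : ℝ} {Ω : Set (Euc n)} {v : Euc n → ℝ}
    {φ : Euc n} (hC : Conf n q lam Lam ρ R Ω v φ) (x : Euc n) :
    ∃ k ∈ Ω, v k = 0 ∧ ⟪φ, k⟫ ≤ 1 ∧ ‖x - k‖ ≤ ‖x‖ ∧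
      ∀ k' ∈ Ω, v k' = 0 → ⟪φ, k'⟫ ≤ 1 → ‖x - k‖ ≤ ‖k' - x‖ := by
  have h0 := hC.zero_mem_lowerPart (zero_le_one : (0:ℝ) ≤ 1)
  obtain ⟨k, hk, hmin⟩ := (hC.isCompact_lowerPart le_rfl).exists_isMinOn ⟨0, h0⟩
    (by fun_prop : ContinuousOn (fun k => ‖x - k‖) _)
  refine ⟨k, hk.1, hk.2.1, hk.2.2, by simpa using hmin h0, fun k' h1 h2 h3 => ?_⟩
  rw [norm_sub_rev k' x]
  exact hmin (show k' ∈ lowerPart Ω v φ 1 from ⟨h1, h2, h3⟩)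

set_option maxHeartbeats 1000000 in
theorem epiConf_c1alpha (n : ℕ) (hn : 0 < n) {q lam Lam ρ R : ℝ} (hq0 : 0 ≤ q)
    (hqn : q < n) (hlam : 0 < lam) (hLam : 0 < Lam) (hρ : 0 < ρ) (hR : 0 < R) :
    ∃ C α c : ℝ, 0 < C ∧ 0 < α ∧ 0 < c ∧ ∀ (Ω : Set (Euc n)) (v : Euc n → ℝ) (φ : Euc n),
      EpiConf n q lam Lam ρ R Ω v φ → ∀ x z p, ‖x‖ ≤ c → ‖z‖ ≤ c → p ∈ subgrad Ω v x →
      v (x + z) - v x - ⟪p, z⟫ ≤ C * ‖z‖ ^ (1 + α) := by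
  obtain ⟨C1, α1, b1, hC1, hα1, hb1, H1⟩ := epiConf_iterate n hn hq0 hqn hlam hLam hρ hR
  obtain ⟨C3, α3, b3, hC3, hα3, hb3, H3⟩ :=
    epiConf_norm_subgrad_le n hn hq0 hqn hlam hLam hρ hR
  obtain ⟨b4, hb4, H4⟩ := epiConf_small_slope n hn hq0 hqn hlam hLam hρ hR hb1
  obtain ⟨c1, hc1, H5⟩ := epiConf_lower_bound n hq0 hqn hlam (Lam := Lam) hρ hR
  obtain ⟨d0, hd0, HU⟩ := conf_upper_bound n hq0 hqn hlam hLam hρ hR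
  set M := ndExp n q with hM
  have hMpos : 0 < M := ndExp_pos hn hqn
  set B := M + 1 with hB
  have hB1 : 1 ≤ B := by linarith
  set C' := 2 * C3 * 2 ^ α3 with hC'def
  have hC'pos : 0 < C' := by positivity
  obtain ⟨c, hc, hcb1, hcb3, hcb4, hcd, hc1', hcC⟩ : ∃ c : ℝ, 0 < c ∧ c ≤ b1 ∧ 2 * c ≤ b3 ∧
      c ≤ b4 ∧ 2 * c ≤ d0 ∧ c ≤ 1 / 2 ∧ C' * c ≤ c1 := by
    refine ⟨min (min b1 (b3 / 2)) (min (min b4 (d0 / 2)) (min (1 / 2) (c1 / C'))),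
      by positivity, ?_, ?_, ?_, ?_, ?_, ?_⟩
    · exact (min_le_left _ _).trans (min_le_left _ _)
    · have := (min_le_left (min b1 (b3 / 2)) (min (min b4 (d0 / 2)) (min (1 / 2) (c1 / C')))).trans
        (min_le_right _ _)
      linarith
    · exact (min_le_right _ _).trans ((min_le_left _ _).trans (min_le_left _ _))
    · have := (min_le_right (min b1 (b3 / 2)) (min (min b4 (d0 / 2)) (min (1 / 2) (c1 / C')))).trans
        ((min_le_left _ _).trans (min_le_right _ _))
      linarith
    · exact (min_le_right _ _).trans ((min_le_right _ _).trans (min_le_left _ _))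
    · have := (min_le_right (min b1 (b3 / 2)) (min (min b4 (d0 / 2)) (min (1 / 2) (c1 / C')))).trans
        ((min_le_right _ _).trans (min_le_right _ _))
      rw [le_div_iff₀ hC'pos] at this
      linarith
  refine ⟨max C' (C1 * C'), min α1 (α3 / B), c, by positivity, by positivity, hc, ?_⟩
  intro Ω v φ hC x z p hx hz hp
  have hC' := hC.toConf
  set α := min α1 (α3 / B) with hα
  have hα0 : 0 < α := by positivity
  have hαα1 : α ≤ α1 := min_le_left _ _
  have hαα3 : α ≤ α3 / B := min_le_right _ _
  rcases eq_or_ne z 0 with rfl | hz0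
  · rw [add_zero, inner_zero_right, sub_self, sub_zero]; positivity
  have hΩ : ∀ y : Euc n, ‖y‖ ≤ d0 → y ∈ Ω := by
    intro y hy
    have := (HU Ω v φ hC' 0 hC.zero_mem hC.v_zero (by simp) y hy).1
    rwa [zero_add] at this
  obtain ⟨k, hkΩ, hk0, hkφ, hkx, hkmin⟩ := epiConf_exists_nearest hC' x
  set d := ‖x - k‖ with hd
  have hd0' : 0 ≤ d := norm_nonneg _
  have hdc : d ≤ c := hkx.trans hx
  have hxΩ : x ∈ Ω := hΩ x (by linarith)
  have hkn : ‖k‖ ≤ b3 := by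
    calc ‖k‖ = ‖x - (x - k)‖ := by rw [sub_sub_cancel]
      _ ≤ ‖x‖ + d := norm_sub_le _ _
      _ ≤ b3 := by linarith
  have hbig : ∀ z : Euc n, z ≠ 0 → ‖z‖ ≤ c → v (x + z) - v x - ⟪p, z⟫ ≤
      2 * C3 * (d + ‖z‖) ^ α3 * ‖z‖ := by
    intro z hz0 hz
    have hzn : 0 < ‖z‖ := norm_pos_iff.2 hz0
    have hyΩ : x + z ∈ Ω := hΩ _ ((norm_add_le _ _).trans (by linarith))
    obtain ⟨p', hp'⟩ := exists_mem_subgrad hC.isOpen hC.gen.1 hC'.convexOn hyΩ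
    have h1 := H3 Ω v φ hC x k p (d + ‖z‖) hxΩ hkn hk0 hp (by positivity) (by linarith)
      (by linarith)
    have h2 := H3 Ω v φ hC (x + z) k p' (d + ‖z‖) hyΩ hkn hk0 hp' (by positivity) (by linarith)
      (by rw [add_sub_right_comm]; exact norm_add_le _ _)
    have h3 := hp' x hxΩ
    have h4 : ⟪p', x - (x + z)⟫ = -⟪p', z⟫ := by
      rw [sub_add_cancel_left, inner_neg_right]
    rw [h4] at h3
    have h5 := real_inner_le_norm p' z
    have h6 := (abs_le.1 (abs_real_inner_le_norm p z)).1
    have h7 : ‖p'‖ * ‖z‖ ≤ C3 * (d + ‖z‖) ^ α3 * ‖z‖ := by gcongr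
    have h8 : ‖p‖ * ‖z‖ ≤ C3 * (d + ‖z‖) ^ α3 * ‖z‖ := by gcongr
    linarith
  have hfar : ∀ z : Euc n, z ≠ 0 → ‖z‖ ≤ c → d ^ B ≤ ‖z‖ → v (x + z) - v x - ⟪p, z⟫ ≤
      C' * ‖z‖ ^ (1 + α) := by
    intro z hz0 hz hdz
    have hzn : 0 < ‖z‖ := norm_pos_iff.2 hz0
    have hz1 : ‖z‖ ≤ 1 := by linarith
    have hB0 : 0 < B := by linarith
    have h1 : d ≤ ‖z‖ ^ (1 / B) := by
      calc d = (d ^ B) ^ (1 / B) := by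
            rw [← Real.rpow_mul hd0', mul_one_div_cancel hB0.ne', Real.rpow_one]
        _ ≤ _ := by gcongr
    have h2 : ‖z‖ ≤ ‖z‖ ^ (1 / B) := by
      refine Real.self_le_rpow_of_le_one hzn.le hz1 ?_
      rw [div_le_one hB0]; exact hB1
    have h3 : (d + ‖z‖) ^ α3 ≤ 2 ^ α3 * ‖z‖ ^ (α3 / B) := by
      calc (d + ‖z‖) ^ α3 ≤ (2 * ‖z‖ ^ (1 / B)) ^ α3 := by gcongr; linarith
        _ = 2 ^ α3 * ‖z‖ ^ (α3 / B) := by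
          rw [Real.mul_rpow (by norm_num) (by positivity), ← Real.rpow_mul hzn.le,
            one_div_mul_eq_div]
    have h4 : ‖z‖ ^ (α3 / B) ≤ ‖z‖ ^ α := Real.rpow_le_rpow_of_exponent_ge hzn hz1 hαα3
    calc v (x + z) - v x - ⟪p, z⟫ ≤ 2 * C3 * (d + ‖z‖) ^ α3 * ‖z‖ := hbig z hz0 hz
      _ ≤ 2 * C3 * (2 ^ α3 * ‖z‖ ^ α) * ‖z‖ := by gcongr; exact h3.trans (by gcongr)
      _ = C' * ‖z‖ ^ (1 + α) := by
        rw [Real.rpow_add hzn, Real.rpow_one]; ring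
  have hzn : 0 < ‖z‖ := norm_pos_iff.2 hz0
  rcases le_or_gt (d ^ B) ‖z‖ with hdz | hdz
  · exact (hfar z hz0 hz hdz).trans (by gcongr; exact le_max_left _ _)
  · set s0 := d ^ B with hs0
    have hs0pos : 0 < s0 := hzn.trans hdz
    have hdpos : 0 < d := by
      refine hd0'.lt_of_ne fun h => ?_
      rw [hs0, ← h, Real.zero_rpow (by linarith)] at hs0pos
      exact lt_irrefl _ hs0pos
    have hd1 : d ≤ 1 := by linarith
    have hs0d : s0 ≤ d := Real.rpow_le_self_of_le_one hd0' hd1 hB1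
    set z0 := (s0 / ‖z‖) • z with hz0def
    have hz0n : ‖z0‖ = s0 := by
      rw [hz0def, norm_smul, Real.norm_of_nonneg (by positivity), div_mul_cancel₀ _ hzn.ne']
    have hz0ne : z0 ≠ 0 := by rw [← norm_pos_iff, hz0n]; exact hs0pos
    have hz0c : ‖z0‖ ≤ c := by rw [hz0n]; linarith
    have hvx := H5 Ω v φ hC x hxΩ (by linarith) d hdpos hd1 hkmin
    have h1 : v (x + z0) - v x - ⟪p, z0⟫ ≤ v x := by
      refine (hbig z0 hz0ne hz0c).trans (le_trans ?_ hvx)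
      rw [hz0n]
      have hα3' : d ^ α3 ≤ 1 := Real.rpow_le_one hd0' hd1 hα3.le
      calc 2 * C3 * (d + s0) ^ α3 * s0 ≤ 2 * C3 * (2 * d) ^ α3 * s0 := by gcongr; linarith
        _ = C' * d ^ α3 * d * d ^ M := by
          rw [Real.mul_rpow (by norm_num) hd0', hs0, hB, Real.rpow_add hdpos, Real.rpow_one]; ring
        _ ≤ C' * 1 * c * d ^ M := by gcongr
        _ ≤ c1 * d ^ M := by rw [mul_one]; gcongr
    have h2 := H1 Ω v φ hC x z0 p (by linarith) (by linarith) hp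
      (H4 Ω v φ hC x p hxΩ (by linarith) hp) (Or.inr h1) (‖z‖ / s0) (by positivity)
      ((div_le_one hs0pos).2 hdz.le)
    have h3 : (‖z‖ / s0) • z0 = z := by
      rw [hz0def, smul_smul, show ‖z‖ / s0 * (s0 / ‖z‖) = 1 by field_simp, one_smul]
    rw [← inner_smul_right, h3] at h2
    have h4 := hfar z0 hz0ne hz0c hz0n.ge
    rw [hz0n] at h4
    have h5 : (‖z‖ / s0) ^ (1 + α1) ≤ (‖z‖ / s0) ^ (1 + α) :=
      Real.rpow_le_rpow_of_exponent_ge (by positivity) ((div_le_one hs0pos).2 hdz.le)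
        (by linarith)
    calc v (x + z) - v x - ⟪p, z⟫ ≤ C1 * (‖z‖ / s0) ^ (1 + α1) * (C' * s0 ^ (1 + α)) :=
          h2.trans (by gcongr)
      _ ≤ C1 * (‖z‖ / s0) ^ (1 + α) * (C' * s0 ^ (1 + α)) := by gcongr
      _ = C1 * C' * ‖z‖ ^ (1 + α) := by
        rw [Real.div_rpow hzn.le hs0pos.le]; field_simp
      _ ≤ _ := by gcongr; exact le_max_right _ _

theorem hasFDerivAt_of_rpow_bound {n : ℕ} {v : Euc n → ℝ} {x p : Euc n} {C α c : ℝ} (hC : 0 < C)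
    (hα : 0 < α) (hc : 0 < c)
    (h : ∀ z : Euc n, ‖z‖ ≤ c → |v (x + z) - v x - ⟪p, z⟫| ≤ C * ‖z‖ ^ (1 + α)) :
    HasFDerivAt v (innerSL ℝ p) x := by
  rw [hasFDerivAt_iff_isLittleO_nhds_zero, Asymptotics.isLittleO_iff]
  intro ε hε
  obtain ⟨b, hb, hbε⟩ := exists_pos_mul_rpow_le hC hα hε
  filter_upwards [ball_mem_nhds (0 : Euc n) (lt_min hb hc)] with z hz
  rw [mem_ball_zero_iff, lt_min_iff] at hz
  rw [innerSL_apply_apply, Real.norm_eq_abs]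
  rcases eq_or_ne z 0 with rfl | hz0
  · simp
  have hzn : 0 < ‖z‖ := norm_pos_iff.2 hz0
  refine (h z hz.2.le).trans ?_
  rw [Real.rpow_add hzn, Real.rpow_one]
  calc C * (‖z‖ * ‖z‖ ^ α) = C * ‖z‖ ^ α * ‖z‖ := by ring
    _ ≤ C * b ^ α * ‖z‖ := by gcongr; exact hz.1.le
    _ ≤ ε * ‖z‖ := by gcongr

theorem epiConf_hasFDerivAt (n : ℕ) (hn : 0 < n) {q lam Lam ρ R : ℝ} (hq0 : 0 ≤ q)
    (hqn : q < n) (hlam : 0 < lam) (hLam : 0 < Lam) (hρ : 0 < ρ) (hR : 0 < R) :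
    ∃ C α c : ℝ, 0 < C ∧ 0 < α ∧ 0 < c ∧ ∀ (Ω : Set (Euc n)) (v : Euc n → ℝ) (φ : Euc n),
      EpiConf n q lam Lam ρ R Ω v φ →
      (∀ x p, ‖x‖ ≤ c → p ∈ subgrad Ω v x → HasFDerivAt v (innerSL ℝ p) x) ∧
      ∀ x y p p', ‖x‖ ≤ c → ‖y‖ ≤ c → p ∈ subgrad Ω v x → p' ∈ subgrad Ω v y →
        ‖p - p'‖ ≤ C * ‖x - y‖ ^ α := by
  obtain ⟨C, α, c, hC, hα, hc, H⟩ := epiConf_c1alpha n hn hq0 hqn hlam hLam hρ hR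
  obtain ⟨d0, hd0, HU⟩ := conf_upper_bound n hq0 hqn hlam hLam hρ hR
  obtain ⟨b, hb, hbc, hbd⟩ : ∃ b : ℝ, 0 < b ∧ 4 * b ≤ c ∧ 4 * b ≤ d0 :=
    ⟨min (c / 4) (d0 / 4), by positivity, by
      have := min_le_left (c / 4) (d0 / 4); linarith, by
      have := min_le_right (c / 4) (d0 / 4); linarith⟩
  refine ⟨C * 2 ^ (1 + α), α, b, by positivity, hα, hb, ?_⟩
  intro Ω v φ hE
  have hE' := hE.toConf
  have hΩ : ∀ y : Euc n, ‖y‖ ≤ d0 → y ∈ Ω := by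
    intro y hy
    have := (HU Ω v φ hE' 0 hE.zero_mem hE.v_zero (by simp) y hy).1
    rwa [zero_add] at this
  constructor
  · intro x p hx hp
    refine hasFDerivAt_of_rpow_bound hC hα hb fun z hz => ?_
    rw [abs_of_nonneg]
    · exact H Ω v φ hE x z p (by linarith) (by linarith) hp
    · have := hp (x + z) (hΩ _ ((norm_add_le _ _).trans (by linarith)))
      rw [add_sub_cancel_left] at this
      linarith
  · intro x y p p' hx hy hp hp'
    rcases eq_or_ne x y with rfl | hxy
    · have h1 := hE'
      have hxΩ := hΩ x (by linarith)
      have h2 : HasFDerivAt v (innerSL ℝ p) x := by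
        refine hasFDerivAt_of_rpow_bound hC hα hb fun z hz => ?_
        rw [abs_of_nonneg]
        · exact H Ω v φ hE x z p (by linarith) (by linarith) hp
        · have := hp (x + z) (hΩ _ ((norm_add_le _ _).trans (by linarith)))
          rw [add_sub_cancel_left] at this
          linarith
      have h3 : HasFDerivAt v (innerSL ℝ p') x := by
        refine hasFDerivAt_of_rpow_bound hC hα hb fun z hz => ?_
        rw [abs_of_nonneg]
        · exact H Ω v φ hE x z p' (by linarith) (by linarith) hp'
        · have := hp' (x + z) (hΩ _ ((norm_add_le _ _).trans (by linarith)))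
          rw [add_sub_cancel_left] at this
          linarith
      have h4 := h2.unique h3
      have h5 : ‖p - p'‖ = 0 := by
        rw [← innerSL_apply_norm (𝕜 := ℝ), map_sub, h4, sub_self, norm_zero]
      rw [h5]; positivity
    set r := ‖x - y‖ with hr
    have hrpos : 0 < r := norm_pos_iff.2 (sub_ne_zero.2 hxy)
    have hr2 : r ≤ 2 * b := (norm_sub_le _ _).trans (by linarith)
    have h1 : r * ‖p' - p‖ ≤ C * (2 * r) ^ (1 + α) := by
      refine norm_le_of_inner_le hrpos fun w hw => ?_
      have hn1 : ‖y - x + w‖ ≤ 2 * r := (norm_add_le _ _).trans (by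
        rw [norm_sub_rev, ← hr]; linarith)
      have hkw : x + (y - x + w) = y + w := by abel
      have hyw : ‖y + w‖ ≤ d0 := (norm_add_le _ _).trans (by linarith)
      have h3 := hp' _ (hΩ _ hyw)
      have h4 := H Ω v φ hE x (y - x + w) p (by linarith) (by linarith) hp
      have h5 := hp y (hΩ _ (by linarith))
      have h6 : C * ‖y - x + w‖ ^ (1 + α) ≤ C * (2 * r) ^ (1 + α) := by gcongr
      rw [hkw, inner_add_right] at h4
      rw [add_sub_cancel_left] at h3
      rw [inner_sub_left]
      linarith
    have h2 : C * (2 * r) ^ (1 + α) = r * (C * 2 ^ (1 + α) * r ^ α) := by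
      rw [Real.mul_rpow (by norm_num) hrpos.le, Real.rpow_add hrpos, Real.rpow_one]; ring
    rw [h2] at h1
    rw [norm_sub_rev]
    exact le_of_mul_le_mul_left h1 hrpos

set_option maxHeartbeats 1000000 in
theorem epiConf_strict (n : ℕ) (hn : 0 < n) {q lam Lam ρ R : ℝ} (hq0 : 0 ≤ q) (hqn : q < n)
    (hlam : 0 < lam) (hLam : 0 < Lam) (hρ : 0 < ρ) (hR : 0 < R) :
    ∃ c : ℝ, 0 < c ∧ ∀ (Ω : Set (Euc n)) (v : Euc n → ℝ) (φ : Euc n),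
      EpiConf n q lam Lam ρ R Ω v φ → ∀ x ∈ Ω, ‖x‖ ≤ c → 0 < v x → ∀ p ∈ subgrad Ω v x,
      ∀ y ∈ Ω, y ≠ x → v x + ⟪p, y - x⟫ < v y := by
  obtain ⟨ε0, hε0, HS⟩ := section_lemma n hq0 hqn (ratio := Lam / lam) (C1 := 2) (k := 1)
    (by positivity) two_pos (by norm_num)
  obtain ⟨C0, hC01, HB⟩ := conf_bounded n hq0 hqn hlam hρ hR
  obtain ⟨c1, hc1, HL⟩ := epiConf_slope n hn hq0 hqn hlam hLam hρ hR
    (C0 := C0) (by linarith)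
  obtain ⟨d0, hd0, HU⟩ := conf_upper_bound n hq0 hqn hlam hLam hρ hR
  obtain ⟨c2, hc2, HP⟩ := epiConf_small_slope n hn hq0 hqn hlam hLam hρ hR
    (ε := 1 / (4 * (C0 + 1))) (by positivity)
  have hT := tallC_pos n
  obtain ⟨ε, hε, hε2, hεε0⟩ : ∃ ε : ℝ, 0 < ε ∧ ε ≤ 2 ∧ ε ≤ ε0 :=
    ⟨min 2 ε0, by positivity, min_le_left _ _, min_le_right _ _⟩
  obtain ⟨c, hc, hcc1, hcc2, hcd, hc8⟩ : ∃ c : ℝ, 0 < c ∧ c ≤ c1 ∧ c ≤ c2 ∧ 4 * c ≤ d0 ∧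
      c ≤ 1 / 8 := by
    refine ⟨min (min c1 c2) (min (d0 / 4) (1 / 8)), by positivity,
      (min_le_left _ _).trans (min_le_left _ _), (min_le_left _ _).trans (min_le_right _ _), ?_,
      (min_le_right _ _).trans (min_le_right _ _)⟩
    have := (min_le_right (min c1 c2) (min (d0 / 4) (1 / 8))).trans (min_le_left _ _)
    linarith
  refine ⟨c, hc, ?_⟩
  intro Ω v φ hC x hxΩ hx hvx p hp y hy hyx
  by_contra hcon
  push Not at hcon
  have hC' := hC.toConf
  have hconv := hC'.convexOn
  have hsmall : ∀ y : Euc n, ‖y‖ ≤ 2 * c → y ∈ Ω ∧ v y ≤ 1 / 2 ∧ ⟪φ, y⟫ < 1 / 2 := by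
    intro y hy
    obtain ⟨h1, -, h3⟩ := HU Ω v φ hC' 0 hC.zero_mem hC.v_zero (by simp) y (by linarith)
    rw [zero_add] at h1 h3
    refine ⟨h1, h3.trans ((div_le_iff₀ hd0).2 (by linarith)), ?_⟩
    have := real_inner_le_norm φ y
    rw [hC.unit] at this
    linarith
  -- a contact point near `x`
  obtain ⟨e, he0, hec, hev⟩ : ∃ e : Euc n, e ≠ 0 ∧ ‖e‖ ≤ c ∧ v (x + e) ≤ v x + ⟪p, e⟫ := by
    have hyx' : 0 < ‖y - x‖ := norm_pos_iff.2 (sub_ne_zero.2 hyx)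
    obtain ⟨s, hs, hs1, hsc⟩ : ∃ s : ℝ, 0 < s ∧ s ≤ 1 ∧ s * ‖y - x‖ ≤ c :=
      ⟨min 1 (c / ‖y - x‖), by positivity, min_le_left _ _, by
        rw [← le_div_iff₀ hyx']; exact min_le_right _ _⟩
    refine ⟨s • (y - x), smul_ne_zero hs.ne' (sub_ne_zero.2 hyx), by
      rwa [norm_smul, Real.norm_of_nonneg hs.le], ?_⟩
    have h1 := hconv.2 hxΩ hy (sub_nonneg.2 hs1) hs.le (by ring)
    rw [show (1 - s) • x + s • y = x + s • (y - x) by module] at h1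
    simp only [smul_eq_mul] at h1
    rw [inner_smul_right]
    have := mul_le_mul_of_nonneg_left hcon hs.le
    linarith
  have hpn : 0 < ‖p‖ := by
    refine norm_pos_iff.2 fun h => ?_
    have := hp 0 hC.zero_mem
    rw [h, inner_zero_left, hC.v_zero] at this
    linarith
  have hpsm := HP Ω v φ hC x p hxΩ (by linarith) hp
  have hlsmall : ∀ y, ‖y‖ ≤ C0 → v x + ⟪p, y - x⟫ < 1 := by
    intro y hy
    have h1 := real_inner_le_norm p (y - x)
    have h2 : ‖p‖ * ‖y - x‖ ≤ 1 / (4 * (C0 + 1)) * (C0 + 1) := by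
      have := norm_sub_le y x
      gcongr
      linarith
    have h3 : 1 / (4 * (C0 + 1)) * (C0 + 1) = 1 / 4 := by field_simp
    have := (hsmall x (by linarith)).2.1
    linarith
  set E : Set (Euc n) := {y | y ∈ Ω ∧ v y ≤ 1 ∧ ⟪φ, y⟫ ≤ 1 / 2} with hE
  have hEc : IsCompact E := by
    have : E = {x | x ∈ Ω ∧ v x ≤ 1 ∧ ⟪φ, x⟫ ≤ 1} ∩ {x | ⟪φ, x⟫ ≤ 1 / 2} := by
      ext w
      constructor
      · rintro ⟨h1, h2, h3⟩
        exact ⟨⟨h1, h2, by linarith⟩, h3⟩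
      · rintro ⟨⟨h1, h2, -⟩, h3⟩
        exact ⟨h1, h2, h3⟩
    rw [this]
    exact hC.compact.inter_right (isClosed_le (by fun_prop) continuous_const)
  have hEB : ∀ y ∈ E, ‖y‖ ≤ C0 := fun y hy =>
    HB Lam Ω v φ hC' y hy.1 hy.2.1 (by linarith [hy.2.2])
  have hvE : ContinuousOn v E := hC.gen.1.mono fun y hy => hy.1
  set f : Euc n → ℝ := fun y => v y - (v x + ⟪p, y - x⟫) with hf
  have hfE : ContinuousOn f E := hvE.sub (by fun_prop)
  have hf0 : ∀ y ∈ Ω, 0 ≤ f y := fun y hy => by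
    have := hp y hy
    simp only [hf]; linarith
  set F : Set (Euc n) := E ∩ f ⁻¹' {0} with hF
  have hFc : IsCompact F :=
    hEc.of_isClosed_subset (hfE.preimage_isClosed_of_isClosed hEc.isClosed isClosed_singleton)
      inter_subset_left
  have hxF : x ∈ F := by
    have := hsmall x (by linarith)
    exact ⟨⟨hxΩ, by linarith, this.2.2.le⟩, by simp [hf]⟩
  have heF : x + e ∈ F := by
    have := hsmall (x + e) ((norm_add_le _ _).trans (by linarith))
    refine ⟨⟨this.1, by linarith, this.2.2.le⟩, le_antisymm ?_ (hf0 _ this.1)⟩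
    simp only [hf, add_sub_cancel_left]; linarith
  obtain ⟨ys, hys, hmax⟩ := hFc.exists_isMaxOn ⟨x, hxF⟩
    (by fun_prop : ContinuousOn (fun y => ⟪e, y⟫) F)
  set W := ⟪e, ys - x⟫ with hW
  have hWpos : 0 < W := by
    have h1 : ⟪e, x + e⟫ ≤ ⟪e, ys⟫ := hmax heF
    rw [inner_add_right, real_inner_self_eq_norm_sq] at h1
    have h2 : 0 < ‖e‖ := norm_pos_iff.2 he0
    rw [hW, inner_sub_right]
    have : 0 < ‖e‖ ^ 2 := by positivity
    linarith
  -- points of `E` far away from the contact set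
  set G : Set (Euc n) := E ∩ ({y | v y ∈ Ici (1 : ℝ)} ∪ {y | 1 / 2 ≤ ⟪φ, y⟫} ∪
    {y | ε * W ≤ ⟪e, y - ys⟫}) with hG
  have hGc : IsCompact G := by
    refine hEc.of_isClosed_subset ?_ inter_subset_left
    have : G = (E ∩ v ⁻¹' Ici 1) ∪ (E ∩ ({y | 1 / 2 ≤ ⟪φ, y⟫} ∪ {y | ε * W ≤ ⟪e, y - ys⟫})) := by
      rw [hG, union_assoc, inter_union_distrib_left]; rfl
    rw [this]
    refine (hvE.preimage_isClosed_of_isClosed hEc.isClosed isClosed_Ici).union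
      (hEc.isClosed.inter ((isClosed_le continuous_const (by fun_prop)).union
        (isClosed_le continuous_const (by fun_prop))))
  have hGf : ∀ y ∈ G, 0 < f y := by
    rintro y ⟨hyE, hy⟩
    refine (hf0 y hyE.1).lt_of_ne fun h0 => ?_
    have hyF : y ∈ F := ⟨hyE, h0.symm⟩
    have hyC := hEB y hyE
    have h1 : v y = v x + ⟪p, y - x⟫ := by simp only [hf] at h0; linarith
    rcases hy with (hy | hy) | hy
    · have h2 : 1 ≤ v y := hy
      have := hlsmall y hyC
      linarith
    · have h2 := HL Ω v φ hC x hxΩ p (by linarith) hp y hyC (le_antisymm hyE.2.2 hy)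
      have h3 := hC'.v_nonneg hyE.1
      linarith
    · have h2 : ⟪e, y⟫ ≤ ⟪e, ys⟫ := hmax hyF
      have h3 : ε * W ≤ ⟪e, y - ys⟫ := hy
      rw [inner_sub_right] at h3
      have : 0 < ε * W := by positivity
      linarith
  obtain ⟨δ, hδ, hδG⟩ := hGc.exists_forall_le' (hfE.mono inter_subset_left) hGf
  set Q := 1 + ‖e‖ * C0 / W with hQ
  have hQpos : 0 < Q := by positivity
  obtain ⟨h, hh, hhQ, hhT⟩ : ∃ h : ℝ, 0 < h ∧ h * Q < δ ∧ tallC n * (2 * h) ≤ v x := by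
    refine ⟨min (δ / (2 * Q)) (v x / (2 * tallC n)), by positivity, ?_, ?_⟩
    · calc _ ≤ δ / (2 * Q) * Q := by gcongr; exact min_le_left _ _
        _ = δ / 2 := by field_simp
        _ < δ := by linarith
    · calc _ ≤ tallC n * (2 * (v x / (2 * tallC n))) := by gcongr; exact min_le_right _ _
        _ = v x := by field_simp
  set al := v x - ⟪p, x⟫ + h * (1 - ⟪e, ys⟫ / (2 * W)) with hal
  set pl := p + (h / (2 * W)) • e with hpl
  have hl : ∀ y, al + ⟪pl, y⟫ = (v x + ⟪p, y - x⟫) + h * (1 + ⟪e, y - ys⟫ / (2 * W)) := by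
    intro y
    simp only [hal, hpl, inner_add_left, inner_smul_left, inner_sub_right]
    simp
    ring
  set S := cutSet Ω v φ (1 / 2) al pl with hS
  have hnear : ∀ y ∈ E, v y < al + ⟪pl, y⟫ → v y < 1 ∧ ⟪φ, y⟫ < 1 / 2 ∧ ⟪e, y - ys⟫ < ε * W := by
    intro y hyE hlt
    have hnG : y ∉ G := by
      intro hyG
      have h1 := hδG y hyG
      rw [hl] at hlt
      have h2 : 1 + ⟪e, y - ys⟫ / (2 * W) ≤ Q := by
        have h3 := real_inner_le_norm e (y - ys)
        have h4 : ‖e‖ * ‖y - ys‖ ≤ ‖e‖ * (C0 + C0) := by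
          gcongr
          exact (norm_sub_le _ _).trans (add_le_add (hEB y hyE) (hEB ys hys.1))
        rw [hQ]
        have h5 : ⟪e, y - ys⟫ / (2 * W) ≤ ‖e‖ * (C0 + C0) / (2 * W) := by gcongr; linarith
        have h6 : ‖e‖ * (C0 + C0) / (2 * W) = ‖e‖ * C0 / W := by field_simp; ring
        linarith
      have h3 : h * (1 + ⟪e, y - ys⟫ / (2 * W)) ≤ h * Q := by gcongr
      simp only [hf] at h1
      linarith
    refine ⟨not_le.1 fun h => hnG ⟨hyE, Or.inl (Or.inl h)⟩,
      not_le.1 fun h => hnG ⟨hyE, Or.inl (Or.inr h)⟩, not_le.1 fun h => hnG ⟨hyE, Or.inr h⟩⟩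
  have hSnear : ∀ y ∈ S, ⟪e, y - ys⟫ < ε * W := fun y hy =>
    (hnear y ⟨hy.1, hy.2.1.le, hy.2.2.1.le⟩ hy.2.2.2).2.2
  have hsec : IsSection n q lam Lam Ω v S al pl (2 * h) := by
    refine hC'.isSection_cutSet (by norm_num) ?_ ?_
    · intro y hy hlt
      obtain ⟨h1, h2, h3, -⟩ := hC'.closure_cutSet (by norm_num) _ _ hy
      have := hnear y ⟨h1, h2, h3⟩ hlt
      exact ⟨this.1, this.2.1⟩
    · intro y hy
      rw [hl]
      have h1 := hp y hy.1
      have h2 := (hSnear y hy).le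
      have h3 : ⟪e, y - ys⟫ / (2 * W) ≤ 1 := by
        rw [div_le_one (by positivity)]
        have : ε * W ≤ 2 * W := by gcongr
        linarith
      have h4 : h * (1 + ⟪e, y - ys⟫ / (2 * W)) ≤ h * (1 + 1) := by gcongr
      linarith
  have hysl : al + ⟪pl, ys⟫ - v ys = h := by
    have : v ys - (v x + ⟪p, ys - x⟫) = 0 := hys.2
    rw [hl, sub_self, inner_zero_right, zero_div]
    linarith
  have hxl : al + ⟪pl, x⟫ = v x + h / 2 := by
    rw [hl, sub_self, inner_zero_right]
    have : ⟪e, x - ys⟫ = -W := by rw [hW, inner_sub_right, inner_sub_right]; ring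
    rw [this]
    field_simp
    ring
  have hysS : ys ∈ S := by
    have h1 : v ys < al + ⟪pl, ys⟫ := by linarith
    have h2 := hnear ys hys.1 h1
    exact ⟨hys.1.1, h2.1, h2.2.1, h1⟩
  have hxS : x ∈ S := by
    have h1 : v x < al + ⟪pl, x⟫ := by rw [hxl]; linarith
    have h2 := hnear x hxF.1 h1
    exact ⟨hxΩ, h2.1, h2.2.1, h1⟩
  refine HS lam Lam Ω v S al pl (2 * h) ys e (ε * W) W hlam hLam.le
    (by rw [div_mul_cancel₀ _ hlam.ne']) hsec hysS (by rw [hysl]) hWpos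
    (fun y hy => (hSnear y hy).le) ⟨x, hxS, ?_⟩ (by gcongr) (Or.inl ⟨x, hxS, ?_⟩)
  · rw [hW, inner_sub_right, inner_sub_right]; linarith
  · rw [hxl]; linarith

section Coordinates

variable {n : ℕ}

theorem fstCoords_apply (x : Euc n) (i : Fin (n - 1)) :
    fstCoords x i = x ⟨i, lt_of_lt_of_le i.isLt (Nat.sub_le n 1)⟩ := rfl

theorem app_apply (x' : Euc (n - 1)) (t : ℝ) (i : Fin n) :
    app n x' t i = if h : (i : ℕ) < n - 1 then x' ⟨i, h⟩ else t := rfl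

theorem lastCoord_eq (hn : 0 < n) (x : Euc n) : lastCoord x = x ⟨n - 1, by omega⟩ := by
  unfold lastCoord; rw [dif_pos hn]

theorem lastCoord_app (hn : 0 < n) (x' : Euc (n - 1)) (t : ℝ) : lastCoord (app n x' t) = t := by
  rw [lastCoord_eq hn, app_apply, dif_neg (by simp)]

theorem fstCoords_app (x' : Euc (n - 1)) (t : ℝ) : fstCoords (app n x' t) = x' := by
  ext i
  rw [fstCoords_apply, app_apply, dif_pos i.isLt]

theorem app_fstCoords (hn : 0 < n) (x : Euc n) : app n (fstCoords x) (lastCoord x) = x := by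
  ext i
  rw [app_apply, lastCoord_eq hn]
  split_ifs with h
  · rfl
  · have : (⟨n - 1, by omega⟩ : Fin n) = i := Fin.ext (by have := i.isLt; simp only; omega)
    rw [this]

theorem app_add (x' y' : Euc (n - 1)) (s t : ℝ) :
    app n (x' + y') (s + t) = app n x' s + app n y' t := by
  ext i
  rw [PiLp.add_apply, app_apply, app_apply, app_apply]
  split_ifs <;> simp

theorem app_smul (a : ℝ) (x' : Euc (n - 1)) (t : ℝ) :
    app n (a • x') (a * t) = a • app n x' t := by
  ext i
  rw [PiLp.smul_apply, app_apply, app_apply]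
  split_ifs <;> simp

theorem fstCoords_zero : fstCoords (0 : Euc n) = 0 := rfl

theorem inner_app (hn : 0 < n) (x' y' : Euc (n - 1)) (s t : ℝ) :
    ⟪app n x' s, app n y' t⟫ = ⟪x', y'⟫ + s * t := by
  obtain ⟨m, rfl⟩ : ∃ m, n = m + 1 := ⟨n - 1, by omega⟩
  rw [PiLp.inner_apply, PiLp.inner_apply, Fin.sum_univ_castSucc]
  congr 1
  · refine Finset.sum_congr rfl fun i _ => ?_
    rw [app_apply, app_apply, dif_pos (by simp), dif_pos (by simp)]
    rfl
  · rw [app_apply, app_apply, dif_neg (by simp), dif_neg (by simp)]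
    simp [mul_comm]

/-- The last standard basis vector. -/
def lastVec (n : ℕ) : Euc n := app n 0 1

theorem inner_lastVec (hn : 0 < n) (x : Euc n) : ⟪lastVec n, x⟫ = lastCoord x := by
  conv_lhs => rw [← app_fstCoords hn x, lastVec, inner_app hn]
  rw [inner_zero_left]; ring

theorem norm_lastVec (hn : 0 < n) : ‖lastVec n‖ = 1 := by
  have : ‖lastVec n‖ ^ 2 = 1 := by
    rw [← real_inner_self_eq_norm_sq, inner_lastVec hn, lastVec, lastCoord_app hn]
  nlinarith [norm_nonneg (lastVec n)]

theorem app_eq (x' : Euc (n - 1)) (t : ℝ) : app n x' t = app n x' 0 + t • lastVec n := by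
  rw [lastVec, ← app_smul, ← app_add]; simp

theorem norm_app_zero (hn : 0 < n) (x' : Euc (n - 1)) : ‖app n x' 0‖ = ‖x'‖ := by
  have : ‖app n x' 0‖ ^ 2 = ‖x'‖ ^ 2 := by
    rw [← real_inner_self_eq_norm_sq, inner_app hn, real_inner_self_eq_norm_sq]; ring
  exact (pow_left_inj₀ (norm_nonneg _) (norm_nonneg _) two_ne_zero).1 this

theorem norm_fstCoords_le (hn : 0 < n) (x : Euc n) : ‖fstCoords x‖ ≤ ‖x‖ := by
  have : ‖x‖ ^ 2 = ‖fstCoords x‖ ^ 2 + lastCoord x * lastCoord x := by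
    conv_lhs => rw [← app_fstCoords hn x]
    rw [← real_inner_self_eq_norm_sq, inner_app hn, real_inner_self_eq_norm_sq]
  refine (pow_le_pow_iff_left₀ (norm_nonneg _) (norm_nonneg _) two_ne_zero).1 ?_
  nlinarith [mul_self_nonneg (lastCoord x)]

theorem fstCoords_sub (x y : Euc n) : fstCoords (x - y) = fstCoords x - fstCoords y := rfl

end Coordinates

theorem AssumptionH.epiConf {n : ℕ} (hn : 0 < n) {q lam Lam r R : ℝ} (hr : 0 < r) (hrR : r < R)
    {Ω : Set (Euc n)} {v : Euc n → ℝ} {ψ : Euc (n - 1) → ℝ} (hΩ : IsOpen Ω)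
    (hv : GenSol n q lam Lam Ω v) (h : AssumptionH n r R Ω v ψ) :
    EpiConf n q lam Lam (min (1 / 4) (r / (2 * (1 + R)))) (2 * R + 1) Ω v (lastVec n) := by
  obtain ⟨h0, hexp, hnn, hψc, hψ, hgraph, hcomp, x0, -, hin, hout⟩ := h
  have hR : 0 < R := hr.trans hrR
  have hv0 : v 0 = 0 := hexp.1.2
  have hmem : ∀ x ∈ Ω, v x = 0 → lastCoord x ≤ 1 →
      fstCoords x ∈ sliceOne n Ω v ∧ ψ (fstCoords x) ≤ lastCoord x := by
    intro x hx hx0 hx1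
    have : x ∈ coin Ω v ∩ {x | 0 ≤ lastCoord x ∧ lastCoord x ≤ 1} :=
      ⟨⟨hx, hx0⟩, hnn x ⟨hx, hx0⟩, hx1⟩
    rw [hgraph] at this
    exact ⟨this.1, this.2.1⟩
  have h0s : (0 : Euc (n - 1)) ∈ sliceOne n Ω v := by
    have := (hmem 0 h0 hv0 (by rw [← inner_lastVec hn]; simp)).1
    rwa [fstCoords_zero] at this
  have hx0R : ‖x0‖ < R := by
    have := hout h0s
    rwa [mem_ball, dist_zero_left] at this
  refine
  { isOpen := hΩ
    gen := hv
    zero_mem := h0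
    v_zero := hv0
    nonneg := fun x hx hx0 => by rw [inner_lastVec hn]; exact hnn x ⟨hx, hx0⟩
    compact := ?_
    inner_ball := ?_
    bdd := ?_
    top := ?_
    unit := norm_lastVec hn
    epi := ?_ }
  · convert hcomp using 1
    ext x
    simp only [inner_lastVec hn]
    exact ⟨fun ⟨h1, h2, h3⟩ => ⟨⟨h1, h2⟩, h3⟩, fun ⟨⟨h1, h2⟩, h3⟩ => ⟨h1, h2, h3⟩⟩
  · refine ⟨app n ((3 / 4 : ℝ) • x0) (3 / 4), fun y hy => ?_⟩
    set z := app n ((3 / 4 : ℝ) • x0) (3 / 4) with hz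
    rw [mem_ball, dist_eq_norm, lt_min_iff] at hy
    set t := lastCoord y with ht
    have htz : |t - 3 / 4| ≤ ‖y - z‖ := by
      have h1 := abs_real_inner_le_norm (lastVec n) (y - z)
      rw [norm_lastVec hn, one_mul, inner_sub_right, inner_lastVec hn, inner_lastVec hn, hz,
        lastCoord_app hn] at h1
      exact h1
    have hyz : ‖fstCoords y - (3 / 4 : ℝ) • x0‖ ≤ ‖y - z‖ := by
      have h1 := norm_fstCoords_le hn (y - z)
      rwa [fstCoords_sub, hz, fstCoords_app] at h1
    have ht1 := abs_le.1 htz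
    have ht2 : 1 / 2 < t := by linarith
    have ht0 : 0 < t := by linarith
    have hsl : (1 / t) • fstCoords y ∈ sliceOne n Ω v := by
      refine hin ?_
      rw [mem_ball, dist_eq_norm]
      have h2 : ‖fstCoords y - t • x0‖ ≤ ‖y - z‖ * (1 + R) := by
        have h3 : fstCoords y - t • x0 =
            (fstCoords y - (3 / 4 : ℝ) • x0) - (t - 3 / 4) • x0 := by module
        rw [h3]
        refine (norm_sub_le _ _).trans ?_
        rw [norm_smul, Real.norm_eq_abs]
        have : |t - 3 / 4| * ‖x0‖ ≤ ‖y - z‖ * R := by gcongr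
        linarith
      have h4 : (1 / t) • fstCoords y - x0 = (1 / t) • (fstCoords y - t • x0) := by
        rw [smul_sub, smul_smul, one_div_mul_cancel ht0.ne', one_smul]
      have h5 : ‖y - z‖ * (2 * (1 + R)) < r := (lt_div_iff₀ (by positivity)).1 hy.2
      rw [h4, norm_smul, Real.norm_of_nonneg (by positivity), one_div_mul_eq_div,
        div_lt_iff₀ ht0]
      have h6 : r * (1 / 2) < r * t := by gcongr
      linarith
    have hy1 : y = t • app n ((1 / t) • fstCoords y) 1 + (1 - t) • (0 : Euc n) := by
      rw [smul_zero, add_zero, ← app_smul, smul_smul, mul_one_div_cancel ht0.ne', one_smul,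
        mul_one, ht, app_fstCoords hn]
    rw [inner_lastVec hn]
    have hK : Convex ℝ (coin Ω v) := by
      have : coin Ω v = {x ∈ Ω | v x ≤ 0} := by
        ext x
        exact ⟨fun h => ⟨h.1, h.2.le⟩, fun h => ⟨h.1, le_antisymm h.2 (hv.2.2.1 x h.1)⟩⟩
      rw [this]
      exact hv.2.1.convex_le 0
    have hyK : y ∈ coin Ω v := by
      rw [hy1]
      exact hK hsl ⟨h0, hv0⟩ ht0.le (by linarith) (by ring)
    exact ⟨hyK.1, hyK.2, by linarith⟩
  · intro x hx hxv hxφ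
    rw [inner_lastVec hn] at hxφ
    have h1 := hout (hmem x hx hxv hxφ).1
    rw [mem_ball, dist_eq_norm] at h1
    have h2 : ‖fstCoords x‖ ≤ 2 * R := by
      calc ‖fstCoords x‖ = ‖(fstCoords x - x0) + x0‖ := by rw [sub_add_cancel]
        _ ≤ _ := (norm_add_le _ _).trans (by linarith)
    calc ‖x‖ = ‖app n (fstCoords x) 0 + lastCoord x • lastVec n‖ := by
          rw [← app_eq, app_fstCoords hn]
      _ ≤ ‖fstCoords x‖ + |lastCoord x| := by
          refine (norm_add_le _ _).trans ?_
          rw [norm_app_zero hn, norm_smul, norm_lastVec hn, mul_one, Real.norm_eq_abs]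
      _ ≤ 2 * R + 1 := by
          rw [abs_of_nonneg (hnn x ⟨hx, hxv⟩)]; linarith
  · exact ⟨app n 0 1, h0s.1, h0s.2, by rw [inner_lastVec hn, lastCoord_app hn]⟩
  · intro x hx hxv s hs hs1
    rw [inner_lastVec hn] at hs ⊢
    have h1 := hmem x hx hxv (hs.trans hs1)
    have h2 : x + (s - lastCoord x) • lastVec n = app n (fstCoords x) s := by
      conv_lhs => rw [← app_fstCoords hn x]
      rw [lastCoord_app hn, app_eq, app_eq (t := s)]
      module
    rw [h2]
    have h3 : app n (fstCoords x) s ∈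
        {x | fstCoords x ∈ sliceOne n Ω v ∧ ψ (fstCoords x) ≤ lastCoord x ∧ lastCoord x ≤ 1} := by
      refine ⟨?_, ?_, ?_⟩
      · rw [fstCoords_app]; exact h1.1
      · rw [fstCoords_app, lastCoord_app hn]; exact h1.2.trans hs
      · rw [lastCoord_app hn]; exact hs1
    rw [← hgraph] at h3
    exact ⟨h3.1.1, h3.1.2⟩

theorem exists_pos_forall_le (l : List ℝ) (h : ∀ x ∈ l, 0 < x) : ∃ c > 0, ∀ x ∈ l, c ≤ x := by
  induction l with
  | nil => exact ⟨1, one_pos, by simp⟩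
  | cons a l ih =>
    obtain ⟨c, hc, H⟩ := ih fun x hx => h x (List.mem_cons_of_mem a hx)
    refine ⟨min a c, lt_min (h a List.mem_cons_self) hc, fun x hx => ?_⟩
    rcases List.mem_cons.1 hx with rfl | hx
    · exact min_le_left _ _
    · exact (min_le_right _ _).trans (H x hx)

theorem AssumptionH.app_mem_iff {n : ℕ} (hn : 0 < n) {r R : ℝ} {Ω : Set (Euc n)}
    {v : Euc n → ℝ} {ψ : Euc (n - 1) → ℝ} (h : AssumptionH n r R Ω v ψ) {x' : Euc (n - 1)}
    {t : ℝ} (ht : t ≤ 1) :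
    app n x' t ∈ coin Ω v ↔ x' ∈ sliceOne n Ω v ∧ ψ x' ≤ t := by
  obtain ⟨-, -, hnn, -, -, hgraph, -⟩ := h
  constructor
  · intro hx
    have h1 : app n x' t ∈ coin Ω v ∩ {x | 0 ≤ lastCoord x ∧ lastCoord x ≤ 1} :=
      ⟨hx, hnn _ hx, by rwa [lastCoord_app hn]⟩
    rw [hgraph, mem_ofPred_eq, fstCoords_app, lastCoord_app hn] at h1
    exact ⟨h1.1, h1.2.1⟩
  · intro hx
    have h1 : app n x' t ∈ {x | fstCoords x ∈ sliceOne n Ω v ∧ ψ (fstCoords x) ≤ lastCoord x ∧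
        lastCoord x ≤ 1} := by
      rw [mem_ofPred_eq, fstCoords_app, lastCoord_app hn]
      exact ⟨hx.1, hx.2, ht⟩
    rw [← hgraph] at h1
    exact h1.1

theorem graph_lower_growth (n : ℕ) (hn : 0 < n) {q lam Lam r R : ℝ} (hq0 : 0 ≤ q) (hqn : q < n)
    (hlam : 0 < lam) (hLam : 0 < Lam) (hr : 0 < r) (hrR : r < R) :
    ∃ c β : ℝ, 0 < c ∧ 0 < β ∧ ∀ (Ω : Set (Euc n)) (v : Euc n → ℝ) (ψ : Euc (n - 1) → ℝ),
      IsOpen Ω → GenSol n q lam Lam Ω v → AssumptionH n r R Ω v ψ →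
      ∀ x' ∈ sliceOne n Ω v, c * ‖x'‖ ^ β ≤ ψ x' := by
  have hR : 0 < R := hr.trans hrR
  obtain ⟨C, γ, hC, hγ, H⟩ := epiConf_outer n hn (Lam := Lam) (ρ := min (1 / 4) (r / (2 * (1 + R))))
    (R := 2 * R + 1) hq0 hqn hlam hLam (by positivity) (by positivity)
  refine ⟨1 / C ^ (1 / γ), 1 / γ, by positivity, by positivity, ?_⟩
  intro Ω v ψ hΩ hv h x' hx'
  have hE := h.epiConf hn hr hrR hΩ hv
  obtain ⟨hψ0, hψ1⟩ := h.2.2.2.2.1 x' hx'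
  have key : ∀ t, 0 < t → t ≤ 1 → ψ x' ≤ t → ‖x'‖ ≤ C * t ^ γ := by
    intro t ht ht1 hψt
    have h1 := (h.app_mem_iff hn ht1).2 ⟨hx', hψt⟩
    have h2 := H Ω v _ hE t (app n x' t) ht ht1
      ⟨h1.1, h1.2, by rw [inner_lastVec hn, lastCoord_app hn]⟩
    rwa [inner_lastVec hn, lastCoord_app hn, app_eq, add_sub_cancel_right, norm_app_zero hn] at h2
  have hψC : ‖x'‖ ≤ C * ψ x' ^ γ := by
    rcases hψ0.lt_or_eq with h0 | h0
    · exact key _ h0 hψ1 le_rfl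
    · rw [← h0, Real.zero_rpow hγ.ne', mul_zero]
      by_contra! hx0
      obtain ⟨b, hb, hbε⟩ := exists_pos_mul_rpow_le hC hγ (half_pos hx0)
      have h1 := key (min b 1) (by positivity) (min_le_right _ _) (by rw [← h0]; positivity)
      have h2 : C * (min b 1) ^ γ ≤ C * b ^ γ := by
        gcongr
        exact min_le_left _ _
      linarith
  have h3 : ‖x'‖ ^ (1 / γ) ≤ C ^ (1 / γ) * ψ x' := by
    calc ‖x'‖ ^ (1 / γ) ≤ (C * ψ x' ^ γ) ^ (1 / γ) := by gcongr
      _ = C ^ (1 / γ) * ψ x' := by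
        rw [Real.mul_rpow hC.le (by positivity), ← Real.rpow_mul hψ0, mul_one_div_cancel hγ.ne',
          Real.rpow_one]
  rw [one_div_mul_eq_div, div_le_iff₀ (by positivity)]
  linarith

theorem graph_upper_growth (n : ℕ) (hn : 0 < n) {q lam Lam r R : ℝ} (hq0 : 0 ≤ q) (hqn : q < n)
    (hlam : 0 < lam) (hLam : 0 < Lam) (hr : 0 < r) (hrR : r < R) :
    ∃ C α c : ℝ, 0 < C ∧ 0 < α ∧ 0 < c ∧ ∀ (Ω : Set (Euc n)) (v : Euc n → ℝ)
      (ψ : Euc (n - 1) → ℝ), IsOpen Ω → GenSol n q lam Lam Ω v → AssumptionH n r R Ω v ψ →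
      ∀ x' : Euc (n - 1), ‖x'‖ ≤ c → x' ∈ sliceOne n Ω v ∧ ψ x' ≤ C * ‖x'‖ ^ (1 + α) := by
  have hR : 0 < R := hr.trans hrR
  obtain ⟨c, γ, hc, hγ, hγ1, H⟩ := epiConf_inner n hn (Lam := Lam)
    (ρ := min (1 / 4) (r / (2 * (1 + R))))
    (R := 2 * R + 1) hq0 hqn hlam hLam (by positivity) (by positivity)
  refine ⟨1 / c ^ (1 / γ), 1 / γ - 1, c, by positivity, by
    rw [sub_pos, lt_div_iff₀ hγ]; linarith, hc, ?_⟩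
  intro Ω v ψ hΩ hv h x' hx'
  have hE := h.epiConf hn hr hrR hΩ hv
  have key : ∀ t, 0 < t → t ≤ 1 → ‖x'‖ ≤ c * t ^ γ → x' ∈ sliceOne n Ω v ∧ ψ x' ≤ t := by
    intro t ht ht1 hxt
    have h1 := H Ω v _ hE t (app n x' 0) ht ht1 (by rw [inner_lastVec hn, lastCoord_app hn])
      (by rwa [norm_app_zero hn])
    rw [← app_eq] at h1
    exact (h.app_mem_iff hn ht1).1 h1
  refine ⟨(key 1 one_pos le_rfl (by simpa using hx')).1, ?_⟩
  rw [add_sub_cancel]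
  rcases (norm_nonneg x').lt_or_eq with h0 | h0
  · have h1 : (‖x'‖ / c) ^ (1 / γ) ≤ 1 :=
      Real.rpow_le_one (by positivity) ((div_le_one hc).2 hx') (by positivity)
    have h2 := (key _ (by positivity) h1 (by
      rw [← Real.rpow_mul (by positivity), one_div_mul_cancel hγ.ne', Real.rpow_one,
        mul_div_cancel₀ _ hc.ne'])).2
    rwa [Real.div_rpow h0.le hc.le, div_eq_inv_mul, ← one_div] at h2
  · have h1 : x' = 0 := norm_eq_zero.1 h0.symm
    have h2 : app n (0 : Euc (n - 1)) 0 = 0 := by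
      have := app_smul (n := n) 0 0 0
      simpa using this
    have h3 : app n (0 : Euc (n - 1)) 0 ∈ coin Ω v := by rw [h2]; exact h.2.1.1
    have h4 := ((h.app_mem_iff hn zero_le_one).1 h3).2
    rw [h1]
    exact h4.trans (by positivity)

theorem epiConf_dist_growth (n : ℕ) (hn : 0 < n) {q lam Lam ρ R : ℝ} (hq0 : 0 ≤ q)
    (hqn : q < n) (hlam : 0 < lam) (hLam : 0 < Lam) (hρ : 0 < ρ) (hR : 0 < R) :
    ∃ C α c β c1 : ℝ, 0 < C ∧ 0 < α ∧ 0 < c ∧ 0 < β ∧ 0 < c1 ∧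
      ∀ (Ω : Set (Euc n)) (v : Euc n → ℝ) (φ : Euc n), EpiConf n q lam Lam ρ R Ω v φ →
      ∀ x ∈ Ω, ‖x‖ ≤ c →
      c1 * infDist x (coin Ω v) ^ β ≤ v x ∧ v x ≤ C * infDist x (coin Ω v) ^ (1 + α) := by
  obtain ⟨C, α, b, hC, hα, hb, HG⟩ := epiConf_growth n hn hq0 hqn hlam hLam hρ hR
  obtain ⟨c1, hc1, HL⟩ := epiConf_lower_bound n (Lam := Lam) hq0 hqn hlam hρ hR
  obtain ⟨c, hc, hcb⟩ := exists_pos_forall_le [b / 2, 1 / 2] (by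
    simp only [List.forall_mem_cons]; exact ⟨by positivity, by norm_num, by simp⟩)
  simp only [List.forall_mem_cons] at hcb
  obtain ⟨hcb, hc2, -⟩ := hcb
  have hβ := ndExp_pos hn hqn
  refine ⟨C, α, c, ndExp n q, c1, hC, hα, hc, hβ, hc1, ?_⟩
  intro Ω v φ hE x hx hxc
  obtain ⟨k, hk, hk0, hkφ, hkx, hmin⟩ := epiConf_exists_nearest hE.toConf x
  have hD : infDist x (coin Ω v) = ‖x - k‖ := by
    refine le_antisymm ?_ ((le_infDist (s := coin Ω v) ⟨k, hk, hk0⟩).2 ?_)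
    · rw [← dist_eq_norm]
      exact infDist_le_dist_of_mem ⟨hk, hk0⟩
    · intro y hy
      rw [dist_comm, dist_eq_norm]
      rcases le_or_gt ⟪φ, y⟫ 1 with h1 | h1
      · exact hmin y hy.1 hy.2 h1
      · have h2 := real_inner_le_norm φ y
        rw [hE.unit, one_mul] at h2
        have h3 := norm_sub_norm_le y x
        linarith
  rw [hD]
  constructor
  · rcases (norm_nonneg (x - k)).lt_or_eq with h0 | h0
    · exact HL Ω v φ hE x hx (by linarith) _ h0 (by linarith) hmin
    · rw [← h0, Real.zero_rpow hβ.ne', mul_zero]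
      exact hE.toConf.v_nonneg hx
  · have h1 : ‖k‖ ≤ 2 * c := by
      have := norm_sub_le x (x - k)
      rw [sub_sub_cancel] at this
      linarith
    have h2 := HG Ω v φ hE k (x - k) (by linarith) (by linarith) hk0
    rwa [add_sub_cancel] at h2

/-- **Interior `C^{1,α}` regularity of the solution and the free boundary (`|K| > 0` case).**
There are `α ∈ (0,1)` and `0 < c < C`, depending only on `n, q, λ, Λ, r, R`, such that
for every generalized solution of `λ v^q χ_{v>0} ≤ det D²v ≤ Λ v^q χ_{v>0}` in `Ω`
satisfying Assumption (H): the slice `K₁'` and the set `{v ≤ 1} ∩ {x_n ≤ 3/4}` are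
normalized between balls, `v ∈ C^{1,α}(B_c(0))`, the free-boundary graph function `ψ`
satisfies `c|x'|^{(1+α)/α} ≤ ψ(x') ≤ C|x'|^{1+α}`, `v` is strictly convex at each point of
`B_c(0) \ K`, and `c·dist(x,K)^{(1+α)/α} ≤ v(x) ≤ C·dist(x,K)^{1+α}` in `B_c(0)`. -/
theorem c1alpha_regularity_positive_measure_K
    (n : ℕ) (hn : 2 ≤ n) (q lam Lam r R : ℝ)
    (hq0 : 0 ≤ q) (hqn : q < n) (hlam : 0 < lam) (hlL : lam ≤ Lam)
    (hr : 0 < r) (hrR : r < R) :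
    ∃ α c C : ℝ, α ∈ Set.Ioo (0 : ℝ) 1 ∧ 0 < c ∧ c < C ∧
      ∀ (Ω : Set (EuclideanSpace ℝ (Fin n))) (v : EuclideanSpace ℝ (Fin n) → ℝ)
        (ψ : EuclideanSpace ℝ (Fin (n - 1)) → ℝ),
        IsOpen Ω → Convex ℝ Ω → GenSol n q lam Lam Ω v → AssumptionH n r R Ω v ψ →
        -- (1) normalization of the slice K₁'
        (Metric.ball (0 : EuclideanSpace ℝ (Fin (n - 1))) c ⊆ sliceOne n Ω v ∧
          sliceOne n Ω v ⊆ Metric.ball (0 : EuclideanSpace ℝ (Fin (n - 1))) C) ∧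
        -- (2) normalization of {v ≤ 1} ∩ {x_n ≤ 3/4}
        (Metric.ball (0 : EuclideanSpace ℝ (Fin n)) c
            ⊆ ({x ∈ Ω | v x ≤ 1} ∩ {x | lastCoord x ≤ 3 / 4}) ∧
          ({x ∈ Ω | v x ≤ 1} ∩ {x | lastCoord x ≤ 3 / 4})
            ⊆ Metric.ball (0 : EuclideanSpace ℝ (Fin n)) C) ∧
        -- (3) C^{1,α} bound for v on B_c(0)
        (∀ x ∈ Metric.ball (0 : EuclideanSpace ℝ (Fin n)) c,
          DifferentiableAt ℝ v x ∧ |v x| + ‖fderiv ℝ v x‖ ≤ C) ∧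
        (∀ x ∈ Metric.ball (0 : EuclideanSpace ℝ (Fin n)) c,
          ∀ y ∈ Metric.ball (0 : EuclideanSpace ℝ (Fin n)) c,
            ‖fderiv ℝ v x - fderiv ℝ v y‖ ≤ C * ‖x - y‖ ^ α) ∧
        -- (4) growth of the free boundary graph ψ
        (∀ x' ∈ Metric.ball (0 : EuclideanSpace ℝ (Fin (n - 1))) c,
          c * ‖x'‖ ^ ((1 + α) / α) ≤ ψ x' ∧ ψ x' ≤ C * ‖x'‖ ^ (1 + α)) ∧
        -- (5) strict convexity of v in B_c(0) \ K
        (∀ x ∈ Metric.ball (0 : EuclideanSpace ℝ (Fin n)) c, x ∉ coin Ω v →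
          ∃ p ∈ subgrad Ω v x, ∀ y ∈ Ω, y ≠ x → v x + ⟪p, y - x⟫ < v y) ∧
        -- (6) growth of v in terms of the distance to K
        (∀ x ∈ Metric.ball (0 : EuclideanSpace ℝ (Fin n)) c,
          c * Metric.infDist x (coin Ω v) ^ ((1 + α) / α) ≤ v x ∧
            v x ≤ C * Metric.infDist x (coin Ω v) ^ (1 + α)) := by
  have hn0 : 0 < n := by omega
  have hLam : 0 < Lam := hlam.trans_le hlL
  have hR : 0 < R := hr.trans hrR
  have hρ : 0 < min (1 / 4) (r / (2 * (1 + R))) := by positivity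
  have hR2 : 0 < 2 * R + 1 := by positivity
  obtain ⟨d0, hd0, HU⟩ := conf_upper_bound n hq0 hqn hlam hLam hρ hR2
  obtain ⟨C1, hC1, HB⟩ := conf_bounded n hq0 hqn hlam hρ hR2
  obtain ⟨c2, hc2, HS⟩ := epiConf_small_slope n hn0 hq0 hqn hlam hLam hρ hR2 one_pos
  obtain ⟨C3, α3, c3, hC3, hα3, hc3, HD⟩ := epiConf_hasFDerivAt n hn0 hq0 hqn hlam hLam hρ hR2
  obtain ⟨c4, β4, hc4, hβ4, HL⟩ := graph_lower_growth n hn0 hq0 hqn hlam hLam hr hrR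
  obtain ⟨C5, α5, c5, hC5, hα5, hc5, HG⟩ := graph_upper_growth n hn0 hq0 hqn hlam hLam hr hrR
  obtain ⟨c6, hc6, HT⟩ := epiConf_strict n hn0 hq0 hqn hlam hLam hρ hR2
  obtain ⟨C7, α7, c7, β7, c8, hC7, hα7, hc7, hβ7, hc8, HE⟩ :=
    epiConf_dist_growth n hn0 hq0 hqn hlam hLam hρ hR2
  obtain ⟨α, hα, hαl⟩ := exists_pos_forall_le [1 / 2, α3, α5, α7, 1 / β4, 1 / β7] (by
    simp only [List.forall_mem_cons, List.not_mem_nil, false_imp_iff, implies_true, and_true]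
    refine ⟨?_, ?_, ?_, ?_, ?_, ?_⟩ <;> positivity)
  obtain ⟨c, hc, hcl⟩ := exists_pos_forall_le [1 / 2, d0, c2, c3, c4, c5, c6, c7, c8] (by
    simp only [List.forall_mem_cons, List.not_mem_nil, false_imp_iff, implies_true, and_true]
    refine ⟨?_, ?_, ?_, ?_, ?_, ?_, ?_, ?_, ?_⟩ <;> positivity)
  simp only [List.forall_mem_cons, List.not_mem_nil, false_imp_iff, implies_true, and_true]
    at hαl hcl
  obtain ⟨hα1, hαα3, hαα5, hαα7, hαβ4, hαβ7⟩ := hαl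
  obtain ⟨hch, hcd0, hcc2, hcc3, hcc4, hcc5, hcc6, hcc7, hcc8⟩ := hcl
  have hβα : ∀ β, 0 < β → α ≤ 1 / β → β ≤ (1 + α) / α := by
    intro β hβ h
    have h1 := (le_div_iff₀ hβ).1 h
    rw [le_div_iff₀ hα]
    linarith
  have hpow : ∀ a s t : ℝ, 0 ≤ a → a ≤ 1 → 0 < s → s ≤ t → a ^ t ≤ a ^ s := by
    intro a s t ha ha1 hs hst
    rcases ha.lt_or_eq with h0 | h0
    · exact Real.rpow_le_rpow_of_exponent_ge h0 ha1 hst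
    · rw [← h0, Real.zero_rpow hs.ne', Real.zero_rpow (hs.trans_le hst).ne']
  refine ⟨α, c, C1 + C3 + C5 + C7 + 2 * R + 4, ⟨hα, by linarith⟩, hc, by linarith, ?_⟩
  intro Ω v ψ hΩ _ hv h
  have hE := h.epiConf hn0 hr hrR hΩ hv
  have hC := hE.toConf
  have hball : ∀ x ∈ ball (0 : Euc n) c, ‖x‖ < c ∧ x ∈ Ω ∧ v x ≤ 1 := by
    intro x hx
    rw [mem_ball_zero_iff] at hx
    have h1 := HU Ω v _ hC 0 hC.zero_mem hC.v_zero (by simp) x (by linarith)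
    rw [zero_add] at h1
    exact ⟨hx, h1.1, h1.2.2.trans ((div_le_one hd0).2 (by linarith))⟩
  have hsub : ∀ x ∈ ball (0 : Euc n) c, ∃ p ∈ subgrad Ω v x, HasFDerivAt v (innerSL ℝ p) x := by
    intro x hx
    obtain ⟨hxc, hxΩ, -⟩ := hball x hx
    obtain ⟨p, hp⟩ := exists_mem_subgrad hΩ hv.1 hC.convexOn hxΩ
    exact ⟨p, hp, (HD Ω v _ hE).1 x p (by linarith) hp⟩
  refine ⟨⟨?_, ?_⟩, ⟨?_, ?_⟩, ?_, ?_, ?_, ?_, ?_⟩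
  · intro x' hx'
    rw [mem_ball_zero_iff] at hx'
    exact (HG Ω v ψ hΩ hv h x' (by linarith)).1
  · intro x' hx'
    rw [mem_ball_zero_iff]
    have h1 := hC.bdd _ hx'.1 hx'.2 (by rw [inner_lastVec hn0, lastCoord_app hn0])
    have h2 := norm_fstCoords_le hn0 (app n x' 1)
    rw [fstCoords_app] at h2
    linarith
  · intro x hx
    obtain ⟨hxc, hxΩ, hvx⟩ := hball x hx
    refine ⟨⟨hxΩ, hvx⟩, ?_⟩
    have h1 := real_inner_le_norm (lastVec n) x
    rw [inner_lastVec hn0, norm_lastVec hn0, one_mul] at h1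
    rw [mem_ofPred_eq]
    linarith
  · rintro x ⟨⟨hx, hvx⟩, hx1⟩
    rw [mem_ofPred_eq] at hx1
    rw [mem_ball_zero_iff]
    have h1 := HB Lam Ω v _ hC x hx hvx (by rw [inner_lastVec hn0]; linarith)
    linarith
  · intro x hx
    obtain ⟨hxc, hxΩ, hvx⟩ := hball x hx
    obtain ⟨p, hp, hpd⟩ := hsub x hx
    refine ⟨hpd.differentiableAt, ?_⟩
    have h1 := HS Ω v _ hE x p hxΩ (by linarith) hp
    rw [hpd.fderiv, innerSL_apply_norm (𝕜 := ℝ), abs_of_nonneg (hC.v_nonneg hxΩ)]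
    linarith
  · intro x hx y hy
    obtain ⟨hxc, -, -⟩ := hball x hx
    obtain ⟨hyc, -, -⟩ := hball y hy
    obtain ⟨p, hp, hpd⟩ := hsub x hx
    obtain ⟨p', hp', hpd'⟩ := hsub y hy
    rw [hpd.fderiv, hpd'.fderiv, ← map_sub, innerSL_apply_norm (𝕜 := ℝ)]
    have h1 := norm_sub_le x y
    calc ‖p - p'‖ ≤ C3 * ‖x - y‖ ^ α3 :=
          (HD Ω v _ hE).2 x y p p' (by linarith) (by linarith) hp hp'
      _ ≤ _ := by
        refine mul_le_mul (by linarith) (hpow _ _ _ (norm_nonneg _) (by linarith) hα hαα3)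
          (by positivity) (by positivity)
  · intro x' hx'
    rw [mem_ball_zero_iff] at hx'
    obtain ⟨h1, h2⟩ := HG Ω v ψ hΩ hv h x' (by linarith)
    constructor
    · refine le_trans ?_ (HL Ω v ψ hΩ hv h x' h1)
      exact mul_le_mul hcc4 (hpow _ _ _ (norm_nonneg _) (by linarith) hβ4 (hβα _ hβ4 hαβ4))
        (by positivity) hc4.le
    · refine h2.trans ?_
      exact mul_le_mul (by linarith)
        (hpow _ _ _ (norm_nonneg _) (by linarith) (by linarith) (by linarith))
        (by positivity) (by positivity)
  · intro x hx hxK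
    obtain ⟨hxc, hxΩ, -⟩ := hball x hx
    obtain ⟨p, hp, -⟩ := hsub x hx
    have hv0 : 0 < v x := lt_of_le_of_ne (hC.v_nonneg hxΩ) fun h0 => hxK ⟨hxΩ, h0.symm⟩
    exact ⟨p, hp, HT Ω v _ hE x hxΩ (by linarith) hv0 p hp⟩
  · intro x hx
    obtain ⟨hxc, hxΩ, -⟩ := hball x hx
    obtain ⟨h1, h2⟩ := HE Ω v _ hE x hxΩ (by linarith)
    have hD1 : infDist x (coin Ω v) ≤ 1 := by
      have h3 := infDist_le_dist_of_mem (s := coin Ω v) (x := x) (y := 0)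
        ⟨hC.zero_mem, hC.v_zero⟩
      rw [dist_zero_right] at h3
      linarith
    have hD0 : 0 ≤ infDist x (coin Ω v) := infDist_nonneg
    constructor
    · refine le_trans ?_ h1
      exact mul_le_mul hcc8 (hpow _ _ _ hD0 hD1 hβ7 (hβα _ hβ7 hαβ7)) (by positivity) hc8.le
    · refine h2.trans ?_
      exact mul_le_mul (by linarith) (hpow _ _ _ hD0 hD1 (by linarith) (by linarith))
        (by positivity) (by positivity)
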